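/- Let X be a finitely primitive countable Markov shift, φ: X → ℝ a measurable function and μ_φ a Gibbs state for the potential φ. Fix y ∈ X, and for each n ≥ 1 let ζ_{y,n} = (1/Z_n(φ, σ^{-n}y)) Σ_{x ∈ σ^{-n}y} exp(S_nφ(x)) δ_{δ_x^n}, where σ^{-n}y = {x ∈ X : σ^n x = y}. Then {ζ_{y,n}} is exponentially tight and satisfies the Large Deviation Principle with the convex good rate function I(μ) = -inf_{G ∋ μ} sup_G F (infimum over open G ⊂ M containing μ). -/

import Mathlib

open MeasureTheory Filter Topology Set
open scoped ENNReal NNReal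

namespace CMS

/-! ### Generic dynamical notions -/

variable {X : Type*}

/-- Birkhoff sum `S_n φ`. -/
noncomputable def birkhoff (T : X → X) (φ : X → ℝ) (n : ℕ) (x : X) : ℝ :=
  ∑ i ∈ Finset.range n, φ (T^[i] x)

/-- A measure is invariant under `T`. -/
def Invariant [MeasurableSpace X] (T : X → X) (μ : Measure X) : Prop :=
  Measure.map T μ = μ

/-- `∫ φ dμ > -∞`, i.e. the negative part of `φ` is integrable. -/
def IntegralGtBot [MeasurableSpace X] (φ : X → ℝ) (μ : Measure X) : Prop :=
  (∫⁻ x, ENNReal.ofReal (-φ x) ∂μ) ≠ ⊤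

/-- The integral of `φ`, with values in `EReal` (defined whenever one of the parts is finite). -/
noncomputable def eintegral [MeasurableSpace X] (φ : X → ℝ) (μ : Measure X) : EReal :=
  ((∫⁻ x, ENNReal.ofReal (φ x) ∂μ : ℝ≥0∞) : EReal) -
    ((∫⁻ x, ENNReal.ofReal (-φ x) ∂μ : ℝ≥0∞) : EReal)

/-- Entropy of the countable partition induced by a map `g` with countable range. -/
noncomputable def partitionEntropy [MeasurableSpace X] {α : Type*} (μ : Measure X) (g : X → α) :
    ℝ≥0∞ :=
  ∑' a : α, ENNReal.ofReal (-((μ (g ⁻¹' {a})).toReal * Real.log ((μ (g ⁻¹' {a})).toReal)))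

/-- Kolmogorov–Sinaĭ entropy of `T` with respect to `μ`: the supremum over finite measurable
partitions (coded by maps `X → ℕ` with finite range) of the asymptotic entropy of iterated
joins of the partition. -/
noncomputable def entropy [MeasurableSpace X] (T : X → X) (μ : Measure X) : ℝ≥0∞ :=
  ⨆ (p : X → ℕ) (_ : Measurable p ∧ (Set.range p).Finite),
    atTop.liminf fun n : ℕ =>
      ENNReal.ofReal ((n : ℝ)⁻¹) * partitionEntropy μ (fun x => fun i : Fin n => p (T^[i] x))

/-- The empirical measure `δ_x^n = (1/n) ∑_{i<n} δ_{T^i x}` (with junk convention `n = 0 ↦ n = 1`,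
irrelevant since only `n ≥ 1` is ever used). -/
noncomputable def empirical [MeasurableSpace X] (T : X → X) (x : X) (n : ℕ) :
    ProbabilityMeasure X :=
  ⟨((max n 1 : ℕ) : ℝ≥0∞)⁻¹ • ∑ i ∈ Finset.range (max n 1), Measure.dirac (T^[i] x), by
    refine ⟨?_⟩
    have h1 : (∑ i ∈ Finset.range (max n 1), Measure.dirac (T^[i] x)) Set.univ
        = ((max n 1 : ℕ) : ℝ≥0∞) := by
      rw [Measure.finset_sum_apply]
      simp
    rw [Measure.smul_apply, h1, smul_eq_mul, ENNReal.inv_mul_cancel] <;> simp⟩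

noncomputable instance [MeasurableSpace X] [TopologicalSpace X] [OpensMeasurableSpace X] :
    MeasurableSpace (ProbabilityMeasure X) := borel _

/-- Sets of periodic points. -/
def perSet (T : X → X) (n : ℕ) : Set X := {x | T^[n] x = x}

/-- Sets of iterated preimages of a point. -/
def preimSet (T : X → X) (n : ℕ) (y : X) : Set X := {x | T^[n] x = y}

/-- The partition function `Z_n(φ, C)` over a subset `C`. -/
noncomputable def Zfn [MeasurableSpace X] (T : X → X) (φ : X → ℝ) (n : ℕ) (C : Set X) : ℝ≥0∞ :=
  ∑' x : C, ENNReal.ofReal (Real.exp (birkhoff T φ n x))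

/-- The distribution of the empirical measures under `μ`. -/
noncomputable def empDistr [MeasurableSpace X] [TopologicalSpace X] [OpensMeasurableSpace X]
    (T : X → X) (μ : Measure X) (n : ℕ) : Measure (ProbabilityMeasure X) :=
  Measure.map (fun x => empirical T x n) μ

/-- The distribution `Z_n(φ,C)⁻¹ ∑_{x ∈ C} e^{S_nφ(x)} δ_{δ_x^n}` on the space of probability
measures, for a countable set `C` (of weighted periodic points or iterated preimages). -/
noncomputable def weightedDistr [MeasurableSpace X] [TopologicalSpace X] [OpensMeasurableSpace X]
    (T : X → X) (φ : X → ℝ) (n : ℕ) (C : Set X) : Measure (ProbabilityMeasure X) :=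
  (Zfn T φ n C)⁻¹ •
    Measure.sum (fun x : C =>
      ENNReal.ofReal (Real.exp (birkhoff T φ n x)) • Measure.dirac (empirical T (x : X) n))

/-! ### Large deviations notions -/

variable {Y : Type*}

/-- The large deviation principle for a sequence of (sub)probability measures with rate
function `J`. -/
def HasLDP [TopologicalSpace Y] [MeasurableSpace Y] (μ : ℕ → Measure Y) (J : Y → EReal) : Prop :=
  (∀ G : Set Y, IsOpen G →
      -(⨅ y ∈ G, J y) ≤
        atTop.liminf fun n : ℕ => (((n : ℝ)⁻¹ : ℝ) : EReal) * ENNReal.log (μ n G)) ∧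
  (∀ K : Set Y, IsClosed K →
      atTop.limsup (fun n : ℕ => (((n : ℝ)⁻¹ : ℝ) : EReal) * ENNReal.log (μ n K)) ≤
        -(⨅ y ∈ K, J y))

/-- Exponential tightness of a sequence of measures. -/
def ExpTight [TopologicalSpace Y] [MeasurableSpace Y] (μ : ℕ → Measure Y) : Prop :=
  ∀ L : ℝ, 0 < L → ∃ K : Set Y, IsCompact K ∧
    atTop.limsup (fun n : ℕ => (((n : ℝ)⁻¹ : ℝ) : EReal) * ENNReal.log (μ n Kᶜ)) ≤ ((-L : ℝ) : EReal)

/-- A good rate function: lower semicontinuous with compact sublevel sets. -/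
def GoodRate [TopologicalSpace Y] (J : Y → EReal) : Prop :=
  LowerSemicontinuous J ∧ ∀ α : ℝ, 0 ≤ α → IsCompact {y | J y ≤ (α : EReal)}

/-- The rate function `I(μ) = - inf_{G ∋ μ} sup_G F`. -/
noncomputable def rateOf [TopologicalSpace Y] (F : Y → EReal) (μ : Y) : EReal :=
  -(⨅ (G : Set Y) (_ : IsOpen G ∧ μ ∈ G), ⨆ ν ∈ G, F ν)

/-- The convex combination `t μ + (1-t) ν` of two probability measures. -/
noncomputable def mix [MeasurableSpace X] (t : ℝ) (h0 : 0 ≤ t) (h1 : t ≤ 1)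
    (μ ν : ProbabilityMeasure X) : ProbabilityMeasure X :=
  ⟨ENNReal.ofReal t • (μ : Measure X) + ENNReal.ofReal (1 - t) • (ν : Measure X), by
    refine ⟨?_⟩
    simp only [Measure.add_apply, Measure.smul_apply, smul_eq_mul, measure_univ, mul_one]
    rw [← ENNReal.ofReal_add h0 (by linarith)]
    norm_num⟩

/-- Convexity of a rate function on probability measures. -/
def ConvexRate [MeasurableSpace X] (J : ProbabilityMeasure X → EReal) : Prop :=
  ∀ μ ν : ProbabilityMeasure X, ∀ t : ℝ, ∀ (h0 : 0 ≤ t) (h1 : t ≤ 1),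
    J (mix t h0 h1 μ ν) ≤ ((t : ℝ) : EReal) * J μ + ((1 - t : ℝ) : EReal) * J ν

-- The free energy functional `F`.
open Classical in
noncomputable def freeEnergy [MeasurableSpace X] (T : X → X) (φ : X → ℝ) (P : ℝ)
    (ν : ProbabilityMeasure X) : EReal :=
  if Invariant T (ν : Measure X) ∧ IntegralGtBot φ (ν : Measure X)
  then ((entropy T (ν : Measure X) : ℝ≥0∞) : EReal) + eintegral φ (ν : Measure X) - ((P : ℝ) : EReal)
  else ⊥

/-! ### Countable Markov shifts -/

variable {S : Type*}

/-- The topological Markov shift with alphabet `S` and transition relation `A`. -/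
def Space (A : S → S → Prop) : Type _ := {x : ℕ → S // ∀ i, A (x i) (x (i + 1))}

variable (A : S → S → Prop)

instance [TopologicalSpace S] : TopologicalSpace (Space A) :=
  inferInstanceAs (TopologicalSpace {x : ℕ → S // ∀ i, A (x i) (x (i + 1))})

noncomputable instance [TopologicalSpace S] : MeasurableSpace (Space A) := borel _

instance [TopologicalSpace S] : BorelSpace (Space A) := ⟨rfl⟩

/-- The left shift. -/
def shift : Space A → Space A := fun x => ⟨fun i => x.1 (i + 1), fun i => x.2 (i + 1)⟩

/-- Admissible words. -/
def Admissible (w : List S) : Prop := w ≠ [] ∧ w.Chain' A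

/-- The cylinder set of a word. -/
def cylinder (w : List S) : Set (Space A) := {x | ∀ i : Fin w.length, x.1 i = w.get i}

variable {A}

/-- The initial word of length `n` of a point. -/
def word (x : Space A) (n : ℕ) : List S := List.ofFn (fun i : Fin n => x.1 i)

variable (A)

/-- `μ` is a Gibbs state for the potential `φ` with constants `c₀` and `P`. -/
def IsGibbsWith [TopologicalSpace S] (φ : Space A → ℝ) (μ : Measure (Space A)) (c₀ P : ℝ) :
    Prop :=
  ∀ n : ℕ, 1 ≤ n → ∀ x : Space A,
    c₀⁻¹ * Real.exp (-(P * n) + birkhoff (shift A) φ n x)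
        ≤ (μ (cylinder A (word x n))).toReal ∧
      (μ (cylinder A (word x n))).toReal
        ≤ c₀ * Real.exp (-(P * n) + birkhoff (shift A) φ n x)

/-- `μ` is a Gibbs state for `φ`. -/
def IsGibbs [TopologicalSpace S] (φ : Space A → ℝ) (μ : Measure (Space A)) : Prop :=
  ∃ c₀ P : ℝ, 1 ≤ c₀ ∧ IsGibbsWith A φ μ c₀ P

/-- The transition matrix has no row or column identically zero. -/
def NoZeroRowCol : Prop := (∀ a : S, ∃ b, A a b) ∧ ∀ b : S, ∃ a, A a b

/-- Finite irreducibility. -/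
def FinitelyIrreducible : Prop :=
  ∃ Λ : Finset (List S), ∀ v w : List S, Admissible A v → Admissible A w →
    ∃ l ∈ Λ, Admissible A (v ++ l ++ w)

/-- Finite primitiveness. -/
def FinitelyPrimitive : Prop :=
  ∃ Λ : Finset (List S), (∃ N : ℕ, ∀ l ∈ Λ, l.length = N) ∧
    ∀ v w : List S, Admissible A v → Admissible A w →
      ∃ l ∈ Λ, Admissible A (v ++ l ++ w)

/-- Topological transitivity. -/
def TopTransitive : Prop :=
  ∀ a b : S, ∃ n : ℕ, 1 ≤ n ∧
    (cylinder A [a] ∩ (shift A)^[n] ⁻¹' (cylinder A [b])).Nonempty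

/-- Varadhan's functional `Q(ψ) = sup_μ (∫ψ dμ - I(μ))`. -/
noncomputable def varQ {X : Type*} [MeasurableSpace X] (I : ProbabilityMeasure X → EReal)
    (ψ : X → ℝ) : EReal :=
  ⨆ μ : ProbabilityMeasure X, (((∫ x, ψ x ∂(μ : Measure X)) : ℝ) : EReal) - I μ

/-- `φ` is uniformly continuous for the standard metric of the shift space. -/
def UnifCont (φ : Space A → ℝ) : Prop :=
  ∀ ε : ℝ, 0 < ε → ∃ N : ℕ, ∀ x y : Space A, (∀ i < N, x.1 i = y.1 i) → |φ x - φ y| ≤ ε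

/-- `φ` is bounded. -/
def Bdd (φ : Space A → ℝ) : Prop := ∃ C : ℝ, ∀ x : Space A, |φ x| ≤ C

end CMS

set_option linter.unusedSectionVars false

namespace CMS

section Coding
variable {S : Type*} {A : S → S → Prop}

/-- The points sharing the first `n` symbols of `x`. -/
def cyl (x : Space A) (n : ℕ) : Set (Space A) := {z | ∀ i < n, z.1 i = x.1 i}

lemma mem_cyl {x z : Space A} {n : ℕ} : z ∈ cyl x n ↔ ∀ i < n, z.1 i = x.1 i := Iff.rfl

lemma mem_cyl_self (x : Space A) (n : ℕ) : x ∈ cyl x n := fun _ _ => rfl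

lemma cyl_eq_of_mem {x z : Space A} {n : ℕ} (h : z ∈ cyl x n) : cyl z n = cyl x n := by
  ext u
  exact ⟨fun hu i hi => (hu i hi).trans (h i hi), fun hu i hi => (hu i hi).trans (h i hi).symm⟩

lemma cylinder_word (x : Space A) (n : ℕ) : cylinder A (word x n) = cyl x n := by
  ext z
  simp only [cylinder, word, mem_cyl, Set.mem_ofPred_eq]
  constructor
  · intro h i hi
    simpa using h ⟨i, by simpa using hi⟩
  · intro h i
    have := h i.1 (by simpa using i.2)
    simpa using this

lemma cylinder_eq_cyl {w : List S} {z : Space A} (hz : z ∈ cylinder A w) :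
    cylinder A w = cyl z w.length := by
  ext u
  constructor
  · intro hu i hi
    exact (hu ⟨i, hi⟩).trans (hz ⟨i, hi⟩).symm
  · intro hu i
    exact (hu i.1 i.2).trans (hz i)

lemma shift_apply (x : Space A) (i : ℕ) : (shift A x).1 i = x.1 (i + 1) := rfl

lemma shift_iterate_apply (n : ℕ) (x : Space A) (i : ℕ) :
    ((shift A)^[n] x).1 i = x.1 (n + i) := by
  induction n generalizing x with
  | zero => simp
  | succ n ih => rw [Function.iterate_succ_apply, ih, shift_apply, add_right_comm]

lemma Space.ext {x z : Space A} (h : ∀ i, x.1 i = z.1 i) : x = z := Subtype.ext (funext h)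

lemma shift_iterate_mem_cyl {x z : Space A} {n k : ℕ} (h : z ∈ cyl x (n + k)) :
    (shift A)^[n] z ∈ cyl ((shift A)^[n] x) k := by
  intro i hi
  rw [shift_iterate_apply, shift_iterate_apply]
  exact h _ (by omega)

lemma cyl_anti (x : Space A) {m n : ℕ} (h : m ≤ n) : cyl x n ⊆ cyl x m :=
  fun _ hz i hi => hz i (by omega)

variable [TopologicalSpace S] [DiscreteTopology S]

lemma continuous_coord (i : ℕ) : Continuous fun x : Space A => x.1 i :=
  (continuous_apply i).comp continuous_subtype_val

lemma isOpen_cyl (x : Space A) (n : ℕ) : IsOpen (cyl x n) := by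
  have : cyl x n = ⋂ i ∈ Finset.range n, (fun z : Space A => z.1 i) ⁻¹' {x.1 i} := by
    ext z; simp [mem_cyl]
  rw [this]
  exact isOpen_biInter_finset fun i _ => (isOpen_discrete _).preimage (continuous_coord i)

/-- A function of finitely many coordinates is continuous. -/
lemma continuous_of_prefix {α : Type*} [TopologicalSpace α] {f : Space A → α} {n : ℕ}
    (h : ∀ x, ∀ z ∈ cyl x n, f z = f x) : Continuous f := by
  refine IsLocallyConstant.continuous ((IsLocallyConstant.iff_exists_open f).2 fun x => ?_)
  exact ⟨cyl x n, isOpen_cyl x n, mem_cyl_self x n, fun z hz => h x z hz⟩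

lemma isClopen_of_prefix {D : Set (Space A)} {n : ℕ}
    (h : ∀ x, ∀ z ∈ cyl x n, (z ∈ D ↔ x ∈ D)) : IsClopen D := by
  have hl : IsLocallyConstant fun x => (x ∈ D : Prop) :=
    (IsLocallyConstant.iff_exists_open _).2 fun x =>
      ⟨cyl x n, isOpen_cyl x n, mem_cyl_self x n, fun z hz => propext (h x z hz)⟩
  have := hl.isClopen_fiber True
  simpa using this

lemma isClopen_cylinder (w : List S) : IsClopen (cylinder A w) := by
  refine isClopen_of_prefix (n := w.length) fun x z hz => ?_
  constructor
  · intro h i; rw [← h i]; exact (hz i i.2).symm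
  · intro h i; rw [← h i]; exact (hz i i.2)

lemma isClopen_cyl (x : Space A) (n : ℕ) : IsClopen (cyl x n) := by
  rw [← cylinder_word]; exact isClopen_cylinder _

lemma measurableSet_cyl (x : Space A) (n : ℕ) : MeasurableSet (cyl x n) :=
  (isClopen_cyl x n).isOpen.measurableSet

lemma continuous_shift : Continuous (shift A) :=
  Continuous.subtype_mk (continuous_pi fun i => continuous_coord (i + 1)) _

instance : T2Space (Space A) := inferInstanceAs (T2Space {x : ℕ → S // ∀ i, A (x i) (x (i + 1))})

lemma exists_cyl_subset {U : Set (Space A)} (hU : IsOpen U) {x : Space A} (hx : x ∈ U) :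
    ∃ n, cyl x n ⊆ U := by
  obtain ⟨V, hV, rfl⟩ := isOpen_induced_iff.1 hU
  obtain ⟨I, u, hu, hsub⟩ := isOpen_pi_iff.1 hV x.1 hx
  refine ⟨I.sup id + 1, fun z hz => hsub fun i hi => ?_⟩
  have : z.1 i = x.1 i := hz i (Nat.lt_succ_of_le (Finset.le_sup (f := id) hi))
  change z.1 i ∈ u i
  rw [this]; exact (hu i hi).2

lemma isPiSystem_cylinder : IsPiSystem (range fun w : List S => cylinder A w) := by
  rintro _ ⟨v, rfl⟩ _ ⟨w, rfl⟩ ⟨z, hv, hw⟩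
  refine ⟨word z (max v.length w.length), ?_⟩
  simp only
  rw [cylinder_word, cylinder_eq_cyl hv, cylinder_eq_cyl hw]
  ext u
  constructor
  · exact fun h => ⟨cyl_anti z (le_max_left _ _) h, cyl_anti z (le_max_right _ _) h⟩
  · rintro ⟨h1, h2⟩ i hi
    rcases lt_max_iff.1 hi with h | h
    exacts [h1 i h, h2 i h]

variable [Countable S]

instance : SecondCountableTopology (Space A) :=
  (Topology.IsEmbedding.subtypeVal
    (p := fun x : ℕ → S => ∀ i, A (x i) (x (i + 1)))).secondCountableTopology

instance : TopologicalSpace.MetrizableSpace (Space A) :=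
  (Topology.IsEmbedding.subtypeVal
    (p := fun x : ℕ → S => ∀ i, A (x i) (x (i + 1)))).metrizableSpace

lemma exists_cylinder_nbhd {G : Set (ProbabilityMeasure (Space A))} (hG : IsOpen G)
    {μ : ProbabilityMeasure (Space A)} (hμ : μ ∈ G) :
    ∃ (I : Finset (List S)) (ε : ℝ), 0 < ε ∧ ∀ ν : ProbabilityMeasure (Space A),
      (∀ w ∈ I, |(ν : Measure (Space A)).real (cylinder A w)
        - (μ : Measure (Space A)).real (cylinder A w)| < ε) → ν ∈ G := by
  let Ψ : ProbabilityMeasure (Space A) → (List S → ℝ) :=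
    fun ν w => (ν : Measure (Space A)).real (cylinder A w)
  let l : Filter (ProbabilityMeasure (Space A)) := comap Ψ (𝓝 (Ψ μ))
  have hl : Tendsto id l (𝓝 μ) := by
    refine isPiSystem_cylinder.tendsto_probabilityMeasure_of_tendsto_of_mem
      (μ := id) ?_ ?_ ?_
    · rintro _ ⟨w, rfl⟩; exact (isClopen_cylinder w).isOpen.measurableSet
    · intro u hu x hx
      obtain ⟨n, hn⟩ := exists_cyl_subset hu hx
      refine ⟨_, ⟨word x n, rfl⟩, ?_, ?_⟩
      · simp only [cylinder_word]; exact (isOpen_cyl x n).mem_nhds (mem_cyl_self x n)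
      · simp only [cylinder_word]; exact hn
    · rintro _ ⟨w, rfl⟩
      have h1 : Tendsto (fun ν => Ψ ν w) l (𝓝 (Ψ μ w)) :=
        (tendsto_pi_nhds.1 (tendsto_comap (f := Ψ) (x := 𝓝 (Ψ μ)))) w
      rw [← NNReal.tendsto_coe]
      exact h1
  have hmem : G ∈ l := hl (hG.mem_nhds hμ)
  obtain ⟨t, ht, hsub⟩ := hmem
  rw [nhds_pi, Filter.mem_pi] at ht
  obtain ⟨I, hI, u, hu, hsub'⟩ := ht
  have hε : ∀ w, ∃ ε > 0, Metric.ball (Ψ μ w) ε ⊆ u w := fun w => Metric.mem_nhds_iff.1 (hu w)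
  choose ε hε0 hε using hε
  obtain ⟨δ, hδ0, hδ⟩ : ∃ δ > 0, ∀ w ∈ hI.toFinset, δ ≤ ε w := by
    by_cases hne : hI.toFinset.Nonempty
    · refine ⟨hI.toFinset.inf' hne ε, ?_, fun w hw => Finset.inf'_le _ hw⟩
      exact (Finset.lt_inf'_iff hne).2 fun w _ => hε0 w
    · exact ⟨1, one_pos, fun w hw => (hne ⟨w, hw⟩).elim⟩
  refine ⟨hI.toFinset, δ, hδ0, fun ν hν => hsub (hsub' fun w hw => hε w ?_)⟩
  have := hν w (hI.mem_toFinset.2 hw)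
  rw [Metric.mem_ball, Real.dist_eq]
  exact this.trans_le (hδ w (hI.mem_toFinset.2 hw))

lemma isOpen_cylinder_nbhd (I : Finset (List S)) (ε : ℝ) (μ : ProbabilityMeasure (Space A)) :
    IsOpen {ν : ProbabilityMeasure (Space A) |
      ∀ w ∈ I, |(ν : Measure (Space A)).real (cylinder A w)
        - (μ : Measure (Space A)).real (cylinder A w)| < ε} := by
  have : {ν : ProbabilityMeasure (Space A) |
      ∀ w ∈ I, |(ν : Measure (Space A)).real (cylinder A w)
        - (μ : Measure (Space A)).real (cylinder A w)| < ε} =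
      ⋂ w ∈ I, {ν : ProbabilityMeasure (Space A) |
        |(ν : Measure (Space A)).real (cylinder A w)
        - (μ : Measure (Space A)).real (cylinder A w)| < ε} := by
    ext ν; simp
  rw [this]
  refine isOpen_biInter_finset fun w _ => ?_
  have hc : Continuous fun ν : ProbabilityMeasure (Space A) =>
      (ν : Measure (Space A)).real (cylinder A w) := by
    refine continuous_iff_continuousAt.2 fun ν => ?_
    have := ProbabilityMeasure.tendsto_measure_of_isClopen_of_tendsto
      (tendsto_id (x := 𝓝 ν)) (isClopen_cylinder w)
    have h2 := (NNReal.tendsto_coe.2 this)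
    exact h2
  exact isOpen_lt (by fun_prop) continuous_const

lemma isCompact_of_finite_coords (F : ℕ → Set S) (hF : ∀ i, (F i).Finite) :
    IsCompact {x : Space A | ∀ i, x.1 i ∈ F i} := by
  have h1 : IsCompact (Set.univ.pi F) := isCompact_univ_pi fun i => (hF i).isCompact
  have hcl : IsClosed {x : ℕ → S | ∀ i, A (x i) (x (i + 1))} := by
    have : {x : ℕ → S | ∀ i, A (x i) (x (i + 1))} =
        ⋂ i, (fun x : ℕ → S => (x i, x (i + 1))) ⁻¹' {p | A p.1 p.2} := by
      ext x; simp
    rw [this]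
    exact isClosed_iInter fun i => (isClosed_discrete _).preimage (by fun_prop)
  have h2 := (hcl.isClosedEmbedding_subtypeVal).isCompact_preimage h1
  convert! h2 using 1
  ext x
  exact Set.mem_univ_pi.symm

end Coding

section Birkhoff
variable {X : Type*} {T : X → X}

lemma birkhoff_add (ψ : X → ℝ) (m n : ℕ) (x : X) :
    birkhoff T ψ (m + n) x = birkhoff T ψ m x + birkhoff T ψ n (T^[m] x) := by
  simp only [birkhoff, Finset.sum_range_add]
  congr 1
  refine Finset.sum_congr rfl fun i _ => ?_
  rw [← Function.iterate_add_apply, add_comm i m]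

lemma birkhoff_zero (ψ : X → ℝ) (x : X) : birkhoff T ψ 0 x = 0 := by simp [birkhoff]

lemma birkhoff_one (ψ : X → ℝ) (x : X) : birkhoff T ψ 1 x = ψ x := by simp [birkhoff]

lemma birkhoff_sub_const (φ : X → ℝ) (P : ℝ) (n : ℕ) (x : X) :
    birkhoff T (fun z => φ z - P) n x = birkhoff T φ n x - P * n := by
  simp [birkhoff, Finset.sum_sub_distrib, mul_comm]

lemma empirical_real [MeasurableSpace X] (x : X) {n : ℕ} (hn : 1 ≤ n) {D : Set X}
    (hD : MeasurableSet D) :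
    ((empirical T x n : ProbabilityMeasure X) : Measure X).real D
      = (n : ℝ)⁻¹ * birkhoff T (D.indicator 1) n x := by
  have hmax : max n 1 = n := by omega
  change ((((max n 1 : ℕ) : ℝ≥0∞)⁻¹ • ∑ i ∈ Finset.range (max n 1), Measure.dirac (T^[i] x))
    D).toReal = _
  rw [hmax, Measure.smul_apply, Measure.finsetSum_apply, smul_eq_mul, ENNReal.toReal_mul,
    ENNReal.toReal_inv, ENNReal.toReal_natCast, ENNReal.toReal_sum]
  · congr 1
    refine Finset.sum_congr rfl fun i _ => ?_
    rw [Measure.dirac_apply' _ hD]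
    by_cases h : T^[i] x ∈ D <;> simp [h]
  · intro i _; exact measure_ne_top _ _

end Birkhoff

section Depth
variable {S : Type*} {A : S → S → Prop}

/-- Birkhoff sums of a `[0,1]`-valued function of `r` coordinates vary by at most `r` along points
which share an initial word. -/
lemma abs_birkhoff_sub_le {f : Space A → ℝ} {r : ℕ} (h0 : ∀ x, 0 ≤ f x) (h1 : ∀ x, f x ≤ 1)
    (hf : ∀ x, ∀ z ∈ cyl x r, f z = f x) {n : ℕ} {x z : Space A} (hz : z ∈ cyl x n) :
    |birkhoff (shift A) f n z - birkhoff (shift A) f n x| ≤ r := by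
  have hb : ∀ u v, |f u - f v| ≤ 1 := fun u v =>
    abs_sub_le_iff.2 ⟨by linarith [h0 v, h1 u], by linarith [h0 u, h1 v]⟩
  unfold birkhoff
  rw [← Finset.sum_sub_distrib]
  calc |∑ i ∈ Finset.range n, (f ((shift A)^[i] z) - f ((shift A)^[i] x))|
      ≤ ∑ i ∈ Finset.range n, |f ((shift A)^[i] z) - f ((shift A)^[i] x)| :=
        Finset.abs_sum_le_sum_abs _ _
    _ ≤ ∑ i ∈ Finset.range n, (if n - r ≤ i then (1 : ℝ) else 0) := by
        refine Finset.sum_le_sum fun i hi => ?_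
        split_ifs with h
        · exact hb _ _
        · rw [hf ((shift A)^[i] x) ((shift A)^[i] z)
            (shift_iterate_mem_cyl (cyl_anti x (by omega) hz))]
          simp
    _ ≤ r := by
        rw [Finset.sum_ite]
        simp only [Finset.sum_const, nsmul_eq_mul, mul_one, add_zero,
          smul_zero]
        have : (Finset.filter (fun i => n - r ≤ i) (Finset.range n)) ⊆ Finset.Ico (n - r) n := by
          intro i; simp; omega
        have h2 := Finset.card_le_card this
        rw [Nat.card_Ico] at h2
        exact_mod_cast h2.trans (by omega)

lemma birkhoff_nonneg_le {f : Space A → ℝ} (h0 : ∀ x, 0 ≤ f x) (h1 : ∀ x, f x ≤ 1) (n : ℕ)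
    (x : Space A) : 0 ≤ birkhoff (shift A) f n x ∧ birkhoff (shift A) f n x ≤ n := by
  constructor
  · exact Finset.sum_nonneg fun i _ => h0 _
  · calc _ ≤ ∑ i ∈ Finset.range n, (1 : ℝ) := Finset.sum_le_sum fun i _ => h1 _
      _ = n := by simp

end Depth

/-! ### Entropy of partitions -/

section PartitionEntropy

variable {X α β : Type*} [MeasurableSpace X]

lemma partitionEntropy_eq_negMulLog (μ : Measure X) (g : X → α) :
    partitionEntropy μ g = ∑' a, ENNReal.ofReal (Real.negMulLog (μ.real (g ⁻¹' {a}))) := by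
  simp [partitionEntropy, Real.negMulLog, Measure.real]

lemma partitionEntropy_eq_lintegral [Countable α] (μ : Measure X) [IsProbabilityMeasure μ]
    {g : X → α} (hg : ∀ a, MeasurableSet (g ⁻¹' {a})) :
    partitionEntropy μ g = ∫⁻ x, ENNReal.ofReal (-Real.log (μ.real (g ⁻¹' {g x}))) ∂μ := by
  let _ : MeasurableSpace α := ⊤
  have hgm : Measurable g := measurable_to_countable' hg
  rw [← lintegral_map (f := fun a => ENNReal.ofReal (-Real.log (μ.real (g ⁻¹' {a}))))
    (measurable_of_countable _) hgm, lintegral_countable', partitionEntropy]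
  refine tsum_congr fun a => ?_
  rw [Measure.map_apply hgm (measurableSet_singleton a), ← mul_neg,
    ENNReal.ofReal_mul ENNReal.toReal_nonneg, ENNReal.ofReal_toReal (measure_ne_top _ _), mul_comm]
  rfl

lemma partitionEntropy_mono [Countable α] [Countable β] (μ : Measure X) [IsProbabilityMeasure μ]
    {g : X → α} (hg : ∀ a, MeasurableSet (g ⁻¹' {a})) {f : X → β}
    (hf : ∀ a, MeasurableSet (f ⁻¹' {a})) (hfg : ∀ x z, g z = g x → f z = f x) :
    partitionEntropy μ f ≤ partitionEntropy μ g := by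
  rw [partitionEntropy_eq_lintegral μ hg, partitionEntropy_eq_lintegral μ hf]
  have hpos : ∀ᵐ x ∂μ, 0 < μ.real (g ⁻¹' {g x}) := by
    have h : {x | ¬ 0 < μ.real (g ⁻¹' {g x})} ⊆
        ⋃ a ∈ {a : α | μ (g ⁻¹' {a}) = 0}, g ⁻¹' {a} := by
      intro x hx
      simp only [mem_iUnion]
      refine ⟨g x, ?_, rfl⟩
      have := le_antisymm (not_lt.1 hx) measureReal_nonneg
      simpa [Measure.real, ENNReal.toReal_eq_zero_iff] using this
    exact measure_mono_null h ((measure_biUnion_null_iff (to_countable _)).2 fun a ha => ha)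
  refine lintegral_mono_ae ?_
  filter_upwards [hpos] with x hx
  refine ENNReal.ofReal_le_ofReal (neg_le_neg (Real.log_le_log hx ?_))
  exact measureReal_mono (fun z hz => hfg x z hz)

lemma partitionEntropy_fintype [Fintype α] (μ : Measure X) [IsProbabilityMeasure μ] (g : X → α) :
    partitionEntropy μ g = ENNReal.ofReal (∑ a, Real.negMulLog (μ.real (g ⁻¹' {a}))) := by
  rw [partitionEntropy_eq_negMulLog, tsum_fintype, ENNReal.ofReal_sum_of_nonneg]
  exact fun a _ => Real.negMulLog_nonneg measureReal_nonneg measureReal_le_one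

lemma sum_measureReal_preimage [Fintype α] (μ : Measure X) [IsProbabilityMeasure μ]
    {g : X → α} (hg : ∀ a, MeasurableSet (g ⁻¹' {a})) {D : Set X} (hD : MeasurableSet D) :
    ∑ a, μ.real (D ∩ g ⁻¹' {a}) = μ.real D := by
  rw [← measureReal_biUnion_finset]
  · congr 1
    ext x
    simp
  · intro a _ b _ hab
    refine Set.disjoint_left.2 fun x hx hx' => hab ?_
    exact hx.2.symm.trans hx'.2
  · exact fun a _ => hD.inter (hg a)

lemma partitionEntropy_prod_le [Fintype α] [Fintype β] (μ : Measure X) [IsProbabilityMeasure μ]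
    {g : X → α} (hg : ∀ a, MeasurableSet (g ⁻¹' {a})) {f : X → β}
    (hf : ∀ a, MeasurableSet (f ⁻¹' {a})) :
    partitionEntropy μ (fun x => (g x, f x)) ≤ partitionEntropy μ g + partitionEntropy μ f := by
  rw [partitionEntropy_fintype, partitionEntropy_fintype, partitionEntropy_fintype,
    ← ENNReal.ofReal_add (Finset.sum_nonneg fun a _ => Real.negMulLog_nonneg measureReal_nonneg
      measureReal_le_one) (Finset.sum_nonneg fun a _ => Real.negMulLog_nonneg measureReal_nonneg
      measureReal_le_one)]
  refine ENNReal.ofReal_le_ofReal ?_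
  set p : α → β → ℝ := fun a b => μ.real (g ⁻¹' {a} ∩ f ⁻¹' {b}) with hp
  have hpa : ∀ a, μ.real (g ⁻¹' {a}) = ∑ b, p a b := fun a =>
    (sum_measureReal_preimage μ hf (hg a)).symm
  have hpb : ∀ b, μ.real (f ⁻¹' {b}) = ∑ a, p a b := fun b => by
    rw [← sum_measureReal_preimage μ hg (hf b)]
    simp only [hp, inter_comm]
  have h1a : ∑ a, μ.real (g ⁻¹' {a}) = 1 := by
    have := sum_measureReal_preimage μ hg MeasurableSet.univ
    simpa using this
  have h1b : ∑ a, μ.real (f ⁻¹' {a}) = 1 := by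
    have := sum_measureReal_preimage μ hf MeasurableSet.univ
    simpa using this
  have hpp : ∀ a b, μ.real ((fun x => (g x, f x)) ⁻¹' {(a, b)}) = p a b := by
    intro a b
    simp only [hp]
    congr 1
    ext x
    simp [Prod.ext_iff]
  rw [Fintype.sum_prod_type]
  simp only [hpp]
  have key : ∀ a b, Real.negMulLog (p a b) ≤
      -(p a b * Real.log (μ.real (g ⁻¹' {a}))) - p a b * Real.log (μ.real (f ⁻¹' {b}))
        + (μ.real (g ⁻¹' {a}) * μ.real (f ⁻¹' {b}) - p a b) := by
    intro a b
    have h0 : 0 ≤ p a b := measureReal_nonneg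
    rcases h0.eq_or_lt with h0 | h0
    · rw [← h0]
      simp only [Real.negMulLog_zero, zero_mul, neg_zero, sub_zero, zero_add]
      exact mul_nonneg measureReal_nonneg measureReal_nonneg
    · have ha : 0 < μ.real (g ⁻¹' {a}) := h0.trans_le (measureReal_mono inter_subset_left)
      have hb : 0 < μ.real (f ⁻¹' {b}) := h0.trans_le (measureReal_mono inter_subset_right)
      set u := μ.real (g ⁻¹' {a})
      set v := μ.real (f ⁻¹' {b})
      have hl := Real.log_le_sub_one_of_pos (x := u * v / p a b) (by positivity)
      rw [Real.log_div (by positivity) h0.ne', Real.log_mul ha.ne' hb.ne'] at hl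
      have := mul_le_mul_of_nonneg_left hl h0.le
      have e : p a b * (u * v / p a b - 1) = u * v - p a b := by
        field_simp
      rw [e] at this
      simp only [Real.negMulLog]
      linarith
  calc ∑ a, ∑ b, Real.negMulLog (p a b) ≤ ∑ a, ∑ b,
        (-(p a b * Real.log (μ.real (g ⁻¹' {a}))) - p a b * Real.log (μ.real (f ⁻¹' {b}))
        + (μ.real (g ⁻¹' {a}) * μ.real (f ⁻¹' {b}) - p a b)) :=
        Finset.sum_le_sum fun a _ => Finset.sum_le_sum fun b _ => key a b
    _ = ∑ a, Real.negMulLog (μ.real (g ⁻¹' {a})) + ∑ b, Real.negMulLog (μ.real (f ⁻¹' {b})) := by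
        simp only [Finset.sum_add_distrib, Finset.sum_sub_distrib, Finset.sum_neg_distrib,
          ← Finset.mul_sum, ← Finset.sum_mul, h1a, h1b, ← hpa]
        rw [Finset.sum_comm (f := fun a b => p a b * Real.log (μ.real (f ⁻¹' {b})))]
        simp only [← Finset.sum_mul, ← hpb, Real.negMulLog]
        simp only [neg_mul, Finset.sum_neg_distrib]
        simp
        ring

lemma sum_mul_partitionEntropy_le {ι : Type*} (s : Finset ι) (w : ι → ℝ) (hw : ∀ j ∈ s, 0 ≤ w j)
    (hw1 : ∑ j ∈ s, w j = 1) (ρ : ι → Measure X) [∀ j, IsProbabilityMeasure (ρ j)]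
    (ν : Measure X) (g : X → α)
    (hν : ∀ a, ν.real (g ⁻¹' {a}) = ∑ j ∈ s, w j * (ρ j).real (g ⁻¹' {a})) :
    ∑ j ∈ s, ENNReal.ofReal (w j) * partitionEntropy (ρ j) g ≤ partitionEntropy ν g := by
  simp only [partitionEntropy_eq_negMulLog, ← ENNReal.tsum_mul_left]
  rw [← Summable.tsum_finsetSum (fun _ _ => ENNReal.summable)]
  refine ENNReal.tsum_le_tsum fun a => ?_
  have := Real.concaveOn_negMulLog.le_map_sum hw hw1
    (p := fun j => (ρ j).real (g ⁻¹' {a})) (fun j _ => measureReal_nonneg)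
  simp only [smul_eq_mul] at this
  rw [hν]
  refine le_trans (le_of_eq ?_) (ENNReal.ofReal_le_ofReal this)
  rw [ENNReal.ofReal_sum_of_nonneg]
  · refine Finset.sum_congr rfl fun j hj => ?_
    rw [ENNReal.ofReal_mul (hw j hj)]
  · exact fun j hj => mul_nonneg (hw j hj)
      (Real.negMulLog_nonneg measureReal_nonneg measureReal_le_one)

end PartitionEntropy

section Iterates

variable {X α : Type*} [MeasurableSpace X] {T : X → X}

lemma measurableSet_preimage_pi {ι α : Type*} [Countable ι] {f : X → ι → α}
    (hf : ∀ i a, MeasurableSet ((fun x => f x i) ⁻¹' {a})) (v : ι → α) :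
    MeasurableSet (f ⁻¹' {v}) := by
  have : f ⁻¹' {v} = ⋂ i, (fun x => f x i) ⁻¹' {v i} := by
    ext x
    simp [funext_iff]
  rw [this]
  exact MeasurableSet.iInter fun i => hf i _

lemma measurableSet_preimage_iterates {α : Type*} (hT : Measurable T) {f : X → α}
    (hf : ∀ a, MeasurableSet (f ⁻¹' {a})) {n : ℕ} (v : Fin n → α) :
    MeasurableSet ((fun x => fun i : Fin n => f (T^[i] x)) ⁻¹' {v}) :=
  measurableSet_preimage_pi (f := fun x => fun i : Fin n => f (T^[i] x))
    (fun i a => (hT.iterate i) (hf a)) v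

lemma measurableSet_eqOn [Countable α] {p q : X → α}
    (hp : ∀ a, MeasurableSet (p ⁻¹' {a})) (hq : ∀ a, MeasurableSet (q ⁻¹' {a})) :
    MeasurableSet {x | p x = q x} := by
  have : {x | p x = q x} = ⋃ a, p ⁻¹' {a} ∩ q ⁻¹' {a} := by
    ext x
    simp [eq_comm]
  rw [this]
  exact MeasurableSet.iUnion fun a => (hp a).inter (hq a)

lemma partitionEntropy_iterates_le [Fintype α] {μ : Measure X} [IsProbabilityMeasure μ]
    (hT : Measurable T) (hμ : Invariant T μ) {e : X → α} (he : ∀ a, MeasurableSet (e ⁻¹' {a}))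
    (n : ℕ) :
    partitionEntropy μ (fun x => fun i : Fin n => e (T^[i] x)) ≤ n * partitionEntropy μ e := by
  have hme : ∀ (i : ℕ) a, MeasurableSet ((fun x => e (T^[i] x)) ⁻¹' {a}) := fun i a =>
    (hT.iterate i) (he a)
  have hmp : MeasurePreserving T μ μ := ⟨hT, hμ⟩
  have hiter : ∀ i : ℕ, partitionEntropy μ (fun x => e (T^[i] x)) = partitionEntropy μ e := by
    intro i
    simp only [partitionEntropy]
    refine tsum_congr fun a => ?_
    rw [← (hmp.iterate i).measure_preimage (he a).nullMeasurableSet]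
    rfl
  induction n with
  | zero =>
    rw [partitionEntropy_eq_negMulLog]
    simp only [Nat.cast_zero, zero_mul, nonpos_iff_eq_zero, ENNReal.tsum_eq_zero]
    intro a
    have : (fun x => fun i : Fin 0 => e (T^[i] x)) ⁻¹' {a} = univ :=
      eq_univ_of_forall fun x => Subsingleton.elim _ _
    rw [this]
    simp
  | succ n ih =>
    classical
    refine (partitionEntropy_mono μ (g := fun x => ((fun i : Fin n => e (T^[i] x)), e (T^[n] x)))
      ?_ ?_ ?_).trans ((partitionEntropy_prod_le μ ?_ ?_).trans ?_)
    · rintro ⟨v, a⟩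
      have : (fun x => ((fun i : Fin n => e (T^[i] x)), e (T^[n] x))) ⁻¹' {(v, a)} =
          (fun x => fun i : Fin n => e (T^[i] x)) ⁻¹' {v} ∩ (fun x => e (T^[n] x)) ⁻¹' {a} := by
        ext x
        simp
      rw [this]
      exact (measurableSet_preimage_iterates hT he v).inter (hme n a)
    · exact fun v => measurableSet_preimage_iterates hT he v
    · intro x z h
      obtain ⟨h1, h2⟩ := Prod.ext_iff.1 h
      funext i
      refine Fin.lastCases h2 (fun j => ?_) i
      exact congrFun h1 j
    · exact fun v => measurableSet_preimage_iterates hT he v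
    · exact hme n
    · rw [hiter]
      push_cast
      rw [add_mul, one_mul]
      gcongr

lemma partitionEntropy_iterates_le_add [Fintype α] {μ : Measure X} [IsProbabilityMeasure μ]
    [DecidableEq α] (hT : Measurable T) (hμ : Invariant T μ) {p q : X → α}
    (hp : ∀ a, MeasurableSet (p ⁻¹' {a})) (hq : ∀ a, MeasurableSet (q ⁻¹' {a})) (n : ℕ) :
    partitionEntropy μ (fun x => fun i : Fin n => p (T^[i] x)) ≤
      partitionEntropy μ (fun x => fun i : Fin n => q (T^[i] x)) +
        n * partitionEntropy μ (fun x => if p x = q x then none else some (p x)) := by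
  set e : X → Option α := fun x => if p x = q x then none else some (p x) with he
  have hpq : MeasurableSet {x | p x = q x} := measurableSet_eqOn hp hq
  have hem : ∀ a, MeasurableSet (e ⁻¹' {a}) := by
    rintro (_ | a)
    · convert! hpq using 1
      ext x
      simp [he]
    · have : e ⁻¹' {some a} = {x | p x = q x}ᶜ ∩ p ⁻¹' {a} := by
        ext x
        by_cases h : p x = q x <;> simp [he, h]
      rw [this]
      exact hpq.compl.inter (hp a)
  refine (partitionEntropy_mono μ (g := fun x => ((fun i : Fin n => q (T^[i] x)),
    fun i : Fin n => e (T^[i] x))) ?_ ?_ ?_).trans ((partitionEntropy_prod_le μ ?_ ?_).trans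
      (add_le_add_right (partitionEntropy_iterates_le hT hμ hem n) _))
  · rintro ⟨v, a⟩
    have : (fun x => ((fun i : Fin n => q (T^[i] x)), fun i : Fin n => e (T^[i] x))) ⁻¹' {(v, a)} =
        (fun x => fun i : Fin n => q (T^[i] x)) ⁻¹' {v} ∩
          (fun x => fun i : Fin n => e (T^[i] x)) ⁻¹' {a} := by
      ext x
      simp
    rw [this]
    exact (measurableSet_preimage_iterates hT hq v).inter (measurableSet_preimage_iterates hT hem a)
  · exact measurableSet_preimage_iterates hT hp
  · intro x z h
    obtain ⟨h1, h2⟩ := Prod.ext_iff.1 h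
    funext i
    have h1 : q (T^[i] z) = q (T^[i] x) := congrFun h1 i
    have h2 : e (T^[i] z) = e (T^[i] x) := congrFun h2 i
    simp only [he] at h2
    split_ifs at h2 with h3 h4 h4
    · rw [h3, h4, h1]
    · exact Option.some.inj h2
  · exact measurableSet_preimage_iterates hT hq
  · exact measurableSet_preimage_iterates hT hem

lemma exists_partitionEntropy_option_le (α : Type*) [Fintype α] {ε : ℝ} (hε : 0 < ε) :
    ∃ δ : ℝ, 0 < δ ∧ ∀ (μ : Measure X) [IsProbabilityMeasure μ] (e : X → Option α),
      MeasurableSet (e ⁻¹' {none}) → μ.real (e ⁻¹' {none})ᶜ < δ →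
        partitionEntropy μ e ≤ ENNReal.ofReal ε := by
  set M : ℝ := Fintype.card α + 1 with hM
  have hMpos : 0 < M := by positivity
  have h0 := Metric.continuous_iff.1 Real.continuous_negMulLog 0 (ε / M) (by positivity)
  have h1 := Metric.continuous_iff.1 Real.continuous_negMulLog 1 (ε / M) (by positivity)
  obtain ⟨δ₀, hδ₀, h0⟩ := h0
  obtain ⟨δ₁, hδ₁, h1⟩ := h1
  refine ⟨min δ₀ δ₁, lt_min hδ₀ hδ₁, fun μ _ e hm he => ?_⟩
  rw [partitionEntropy_fintype]
  refine ENNReal.ofReal_le_ofReal ?_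
  rw [Fintype.sum_option]
  have hn : Real.negMulLog (μ.real (e ⁻¹' {none})) ≤ ε / M := by
    have := h1 (μ.real (e ⁻¹' {none})) (by
      rw [Real.dist_eq, abs_sub_comm, ← probReal_compl_eq_one_sub hm,
        abs_of_nonneg measureReal_nonneg]
      exact he.trans_le (min_le_right _ _))
    rw [Real.dist_eq, Real.negMulLog_one, sub_zero] at this
    exact (le_abs_self _).trans this.le
  have hs : ∀ a, Real.negMulLog (μ.real (e ⁻¹' {some a})) ≤ ε / M := by
    intro a
    have := h0 (μ.real (e ⁻¹' {some a})) (by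
      rw [Real.dist_eq, sub_zero, abs_of_nonneg measureReal_nonneg]
      refine (measureReal_mono ?_).trans_lt (he.trans_le (min_le_left _ _))
      intro x hx hx'
      simp only [mem_preimage, mem_singleton_iff] at hx hx'
      rw [hx] at hx'
      cases hx')
    rw [Real.dist_eq, Real.negMulLog_zero, sub_zero] at this
    exact (le_abs_self _).trans this.le
  calc _ ≤ ε / M + ∑ _a : α, ε / M := add_le_add hn (Finset.sum_le_sum fun a _ => hs a)
    _ = ε := by
      rw [Finset.sum_const, Finset.card_univ, nsmul_eq_mul]
      field_simp
      rw [hM]; ring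

end Iterates

section Prefix

variable {S : Type*} [Countable S] [TopologicalSpace S] [DiscreteTopology S] {A : S → S → Prop}

/-- The first `m` symbols of a point. -/
def pre (m : ℕ) (x : Space A) : Fin m → S := fun i => x.1 i

lemma pre_eq_iff {m : ℕ} {x z : Space A} : pre m z = pre m x ↔ z ∈ cyl x m := by
  simp only [pre, funext_iff, mem_cyl, Fin.forall_iff]

lemma measurableSet_pre (m : ℕ) (v : Fin m → S) :
    MeasurableSet ((pre m : Space A → _) ⁻¹' {v}) := by
  refine (isClopen_of_prefix (D := (pre m : Space A → _) ⁻¹' {v}) (n := m)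
      fun x z hz => ?_).2.measurableSet
  simp only [mem_preimage, mem_singleton_iff, pre_eq_iff.2 hz]

/-- Sets depending on finitely many coordinates. -/
def finiteDepth (A : S → S → Prop) : Set (Set (Space A)) :=
  {D | ∃ n, ∀ x, ∀ z ∈ cyl x n, (z ∈ D ↔ x ∈ D)}

lemma isSetAlgebra_finiteDepth : IsSetAlgebra (finiteDepth A) where
  empty_mem := ⟨0, by simp⟩
  compl_mem := by
    rintro s ⟨n, hn⟩
    exact ⟨n, fun x z hz => not_congr (hn x z hz)⟩
  union_mem := by
    rintro s t ⟨n, hn⟩ ⟨m, hm⟩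
    exact ⟨max n m, fun x z hz => or_congr (hn x z (cyl_anti x (le_max_left _ _) hz))
      (hm x z (cyl_anti x (le_max_right _ _) hz))⟩

lemma cylinder_mem_finiteDepth (w : List S) : cylinder A w ∈ finiteDepth A := by
  refine ⟨w.length, fun x z hz => ?_⟩
  simp only [cylinder, mem_ofPred_eq]
  refine forall_congr' fun i => ?_
  rw [hz i i.2]

lemma generateFrom_finiteDepth :
    MeasurableSpace.generateFrom (finiteDepth A) = (inferInstance : MeasurableSpace (Space A)) := by
  refine le_antisymm (MeasurableSpace.generateFrom_le ?_) ?_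
  · rintro D ⟨n, hn⟩
    exact (isClopen_of_prefix hn).2.measurableSet
  · change borel _ ≤ _
    refine MeasurableSpace.generateFrom_le fun U hU => ?_
    have : U = ⋃ w ∈ {w : List S | cylinder A w ⊆ U}, cylinder A w := by
      ext x
      simp only [mem_iUnion, exists_prop]
      refine ⟨fun hx => ?_, fun ⟨w, hw, hx⟩ => hw hx⟩
      obtain ⟨n, hn⟩ := exists_cyl_subset hU hx
      refine ⟨word x n, ?_, ?_⟩
      · change cylinder A (word x n) ⊆ U
        rwa [cylinder_word]
      · rw [cylinder_word]
        exact mem_cyl_self x n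
    rw [this]
    exact MeasurableSet.biUnion (to_countable _) fun w _ =>
      MeasurableSpace.measurableSet_generateFrom (cylinder_mem_finiteDepth w)

lemma exists_finiteDepth_approx {α : Type*} [Fintype α] [Nonempty α] (ν : Measure (Space A))
    [IsProbabilityMeasure ν] {p : Space A → α} (hp : ∀ a, MeasurableSet (p ⁻¹' {a}))
    {δ : ℝ} (hδ : 0 < δ) :
    ∃ (q : Space A → α) (r : ℕ), (∀ x, ∀ z ∈ cyl x r, q z = q x) ∧
      ν.real {x | p x ≠ q x} < δ := by
  classical
  have hd := Measure.MeasureDense.of_generateFrom_isSetAlgebra_finite ν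
    isSetAlgebra_finiteDepth (generateFrom_finiteDepth (A := A)).symm
  have hcard : 0 < (Fintype.card α : ℝ) := by exact_mod_cast Fintype.card_pos
  set η := δ / (2 * Fintype.card α) with hη
  have hη0 : 0 < η := by positivity
  choose t ht hts using fun a => hd.approx (p ⁻¹' {a}) (hp a) (measure_ne_top _ _) η hη0
  choose n hn using ht
  set q : Space A → α := fun x => if h : ∃ a, x ∈ t a ∧ ∀ b, x ∈ t b → b = a then h.choose
    else Classical.arbitrary α with hq
  refine ⟨q, Finset.univ.sup n, ?_, ?_⟩
  · intro x z hz
    have : ∀ a, (z ∈ t a ↔ x ∈ t a) := fun a =>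
      hn a x z (cyl_anti x (Finset.le_sup (Finset.mem_univ a)) hz)
    simp only [hq, this]
  · have hsub : {x | p x ≠ q x} ⊆ ⋃ a ∈ (Finset.univ : Finset α), symmDiff (p ⁻¹' {a}) (t a) := by
      intro x hx
      by_contra hcon
      simp only [mem_iUnion, Finset.mem_univ, exists_const, not_exists, mem_symmDiff, mem_preimage,
        mem_singleton_iff] at hcon
      have hiff : ∀ a, x ∈ t a ↔ p x = a := by
        intro a
        have := hcon a
        tauto
      have hex : ∃ a, x ∈ t a ∧ ∀ b, x ∈ t b → b = a :=
        ⟨p x, (hiff _).2 rfl, fun b hb => ((hiff b).1 hb).symm⟩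
      refine hx ?_
      simp only [hq, dif_pos hex]
      exact (hiff _).1 hex.choose_spec.1
    calc ν.real {x | p x ≠ q x} ≤ ν.real (⋃ a ∈ (Finset.univ : Finset α),
          symmDiff (p ⁻¹' {a}) (t a)) := measureReal_mono hsub (measure_ne_top _ _)
      _ ≤ ∑ a, ν.real (symmDiff (p ⁻¹' {a}) (t a)) := measureReal_biUnion_finset_le Finset.univ _
      _ ≤ ∑ _a : α, η := Finset.sum_le_sum fun a _ => by
          have := ENNReal.toReal_mono ENNReal.ofReal_ne_top (hts a).le
          rwa [ENNReal.toReal_ofReal hη0.le] at this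
      _ = δ / 2 := by
          rw [Finset.sum_const, Finset.card_univ, nsmul_eq_mul, hη]
          field_simp
      _ < δ := by linarith

theorem eventually_le_partitionEntropy_pre (ν : Measure (Space A)) [IsProbabilityMeasure ν]
    (hν : Invariant (shift A) ν) {h : ℝ} (h0 : 0 ≤ h)
    (hh : ENNReal.ofReal h < entropy (shift A) ν) :
    ∀ᶠ m : ℕ in atTop, ENNReal.ofReal (m * h) ≤ partitionEntropy ν (pre m) := by
  classical
  obtain ⟨h₂, hh₁, hh₂⟩ := exists_between hh
  have h₂top : h₂ ≠ ⊤ := hh₂.ne_top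
  obtain ⟨k, rfl⟩ : ∃ k : ℝ, h₂ = ENNReal.ofReal k :=
      ⟨h₂.toReal, (ENNReal.ofReal_toReal h₂top).symm⟩
  have hk : h < k := (ENNReal.ofReal_lt_ofReal_iff_of_nonneg h0).1 hh₁
  simp only [entropy, lt_iSup_iff] at hh₂
  obtain ⟨p₀, ⟨hp₀, hfin⟩, hlim⟩ := hh₂
  have hev := Filter.eventually_lt_of_lt_liminf hlim
  let _ : Fintype (range p₀) := hfin.fintype
  have hne : Nonempty (Space A) := by
    by_contra hcon
    have : IsEmpty (Space A) := not_nonempty_iff.1 hcon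
    have h1 := measure_univ (μ := ν)
    rw [univ_eq_empty_iff.2 this] at h1
    simp at h1
  set p : Space A → range p₀ := fun x => ⟨p₀ x, x, rfl⟩ with hpdef
  have hp : ∀ a, MeasurableSet (p ⁻¹' {a}) := by
    rintro ⟨a, ha⟩
    convert! hp₀ (measurableSet_singleton a) using 1
    ext x
    exact Subtype.ext_iff
  have : Nonempty (range p₀) := ⟨p (Classical.arbitrary _)⟩
  set ε := (k - h) / 2 with hεd
  have hε : 0 < ε := by simp only [hεd]; linarith
  obtain ⟨δ, hδ, hopt⟩ := exists_partitionEntropy_option_le (X := Space A) (range p₀) hε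
  obtain ⟨q, r, hqr, hpq⟩ := exists_finiteDepth_approx ν hp hδ
  have hq : ∀ a, MeasurableSet (q ⁻¹' {a}) := fun a =>
    (isClopen_of_prefix (A := A) (D := q ⁻¹' {a}) (n := r) fun x z hz => by
      simp only [mem_preimage, mem_singleton_iff, hqr x z hz]).2.measurableSet
  have hT : Measurable (shift A) := continuous_shift.measurable
  have he := hopt ν (fun x => if p x = q x then none else some (p x)) (by
      convert! measurableSet_eqOn hp hq using 1
      ext x
      simp) (by
      convert hpq using 2
      ext x
      simp)
  have main : ∀ᶠ n : ℕ in atTop, ENNReal.ofReal (n * (h + ε)) ≤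
      partitionEntropy ν (pre (n + r)) := by
    filter_upwards [hev, eventually_ge_atTop 1] with n hn hn1
    have hnpos : (0 : ℝ) < n := by exact_mod_cast hn1
    have h1 : ENNReal.ofReal (n * k) ≤
        partitionEntropy ν (fun x => fun i : Fin n => p₀ ((shift A)^[i] x)) := by
      have := mul_le_mul_right hn.le (ENNReal.ofReal n)
      rwa [← mul_assoc, ← ENNReal.ofReal_mul hnpos.le, ← ENNReal.ofReal_mul hnpos.le,
        mul_inv_cancel₀ hnpos.ne', ENNReal.ofReal_one, one_mul] at this
    have h2 : partitionEntropy ν (fun x => fun i : Fin n => p₀ ((shift A)^[i] x)) ≤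
        partitionEntropy ν (fun x => fun i : Fin n => p ((shift A)^[i] x)) :=
      partitionEntropy_mono ν (measurableSet_preimage_iterates hT hp)
        (measurableSet_preimage_iterates hT fun a => hp₀ (measurableSet_singleton a))
            fun x z hxz => by
          funext i
          exact congrArg Subtype.val (congrFun hxz i)
    have h3 := partitionEntropy_iterates_le_add hT hν hp hq n
    have h4 : partitionEntropy ν (fun x => fun i : Fin n => q ((shift A)^[i] x)) ≤
        partitionEntropy ν (pre (n + r)) := by
      refine partitionEntropy_mono ν (measurableSet_pre _) (measurableSet_preimage_iterates hT hq)
          fun x z hxz => ?_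
      funext i
      refine hqr _ _ (shift_iterate_mem_cyl ?_)
      exact cyl_anti x (by omega) (pre_eq_iff.1 hxz)
    have h5 : ENNReal.ofReal (n * k) ≤
        partitionEntropy ν (pre (n + r)) + ENNReal.ofReal (n * ε) := by
      refine (h1.trans (h2.trans h3)).trans (add_le_add h4 ?_)
      rw [ENNReal.ofReal_mul hnpos.le, ENNReal.ofReal_natCast]
      exact mul_le_mul_right he _
    have h6 : ENNReal.ofReal (n * k) = ENNReal.ofReal (n * (h + ε)) + ENNReal.ofReal (n * ε) := by
      rw [← ENNReal.ofReal_add (by positivity) (by positivity)]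
      congr 1
      simp only [hεd]
      ring
    rw [h6] at h5
    exact (ENNReal.add_le_add_iff_right ENNReal.ofReal_ne_top).1 h5
  have hlast : ∀ᶠ n : ℕ in atTop, ((n : ℝ) + r) * h ≤ n * (h + ε) := by
    have := (tendsto_natCast_atTop_atTop (R := ℝ)).eventually_ge_atTop (r * h / ε)
    filter_upwards [this] with n hn
    rw [div_le_iff₀ hε] at hn
    nlinarith
  obtain ⟨n₀, hn₀⟩ := eventually_atTop.1 (main.and hlast)
  filter_upwards [eventually_ge_atTop (n₀ + r)] with m hm
  obtain ⟨n, rfl⟩ : ∃ n, m = n + r := ⟨m - r, by omega⟩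
  obtain ⟨h1, h2⟩ := hn₀ n (by omega)
  refine le_trans (ENNReal.ofReal_le_ofReal ?_) h1
  push_cast
  exact h2

end Prefix

section Zfn

variable {X : Type*} [MeasurableSpace X] {T : X → X}

lemma Zfn_mono (ψ : X → ℝ) (n : ℕ) {C D : Set X} (h : C ⊆ D) : Zfn T ψ n C ≤ Zfn T ψ n D :=
  ENNReal.tsum_mono_subtype (fun x => ENNReal.ofReal (Real.exp (birkhoff T ψ n x))) h

lemma weightedDistr_sub_const [TopologicalSpace X] [OpensMeasurableSpace X] (φ : X → ℝ) (P : ℝ)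
    (n : ℕ) (C : Set X) :
    weightedDistr T (fun x => φ x - P) n C = weightedDistr T φ n C := by
  have hfac : ∀ x, ENNReal.ofReal (Real.exp (birkhoff T φ n x)) =
      ENNReal.ofReal (Real.exp (n * P)) *
        ENNReal.ofReal (Real.exp (birkhoff T (fun x => φ x - P) n x)) := by
    intro x
    rw [birkhoff_sub_const, ← ENNReal.ofReal_mul (Real.exp_pos _).le, ← Real.exp_add]
    congr 2
    ring
  have h0 : ENNReal.ofReal (Real.exp (n * P)) ≠ 0 := by simp [Real.exp_pos]
  have htop : ENNReal.ofReal (Real.exp (n * P)) ≠ ⊤ := ENNReal.ofReal_ne_top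
  have hZ : Zfn T φ n C = ENNReal.ofReal (Real.exp (n * P)) * Zfn T (fun x => φ x - P) n C := by
    simp only [Zfn, hfac, ENNReal.tsum_mul_left]
  refine Measure.ext fun G hG => ?_
  simp only [weightedDistr, Measure.smul_apply, smul_eq_mul, Measure.sum_apply _ hG]
  rw [hZ]
  simp only [hfac, mul_assoc, ENNReal.tsum_mul_left]
  rw [ENNReal.mul_inv (Or.inl h0) (Or.inl htop), mul_comm (ENNReal.ofReal _)⁻¹, mul_assoc,
    ← mul_assoc (ENNReal.ofReal _)⁻¹, ENNReal.inv_mul_cancel h0 htop, one_mul]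

lemma weightedDistr_apply [TopologicalSpace X] [OpensMeasurableSpace X] (ψ : X → ℝ) (n : ℕ)
    (C : Set X) {G : Set (ProbabilityMeasure X)} (hG : MeasurableSet G) :
    weightedDistr T ψ n C G = (Zfn T ψ n C)⁻¹ * Zfn T ψ n (C ∩ {x | empirical T x n ∈ G}) := by
  simp only [weightedDistr, Measure.smul_apply, smul_eq_mul, Measure.sum_apply _ hG]
  congr 1
  simp only [Zfn, Measure.dirac_apply' _ hG]
  rw [tsum_subtype C fun x => ENNReal.ofReal (Real.exp (birkhoff T ψ n x)) *
      G.indicator 1 (empirical T x n),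
    tsum_subtype (C ∩ {x | empirical T x n ∈ G}) fun x =>
      ENNReal.ofReal (Real.exp (birkhoff T ψ n x))]
  refine tsum_congr fun x => ?_
  by_cases h1 : x ∈ C <;> by_cases h2 : empirical T x n ∈ G <;> simp [h1, h2]

end Zfn

section Gibbs

variable {S : Type*} [Countable S] [TopologicalSpace S] [DiscreteTopology S] {A : S → S → Prop}

/-- A normalized potential together with its Gibbs state and the gluing property of a finitely
primitive shift. -/
structure GibbsData (ψ : Space A → ℝ) (μ : Measure (Space A)) (c κ : ℝ) (N : ℕ) : Prop where
  prob : IsProbabilityMeasure μ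
  meas : Measurable ψ
  one_le : 1 ≤ c
  exp_le : ∀ n x, Real.exp (birkhoff (shift A) ψ n x) ≤ c * μ.real (cyl x n)
  le_exp : ∀ n x, μ.real (cyl x n) ≤ c * Real.exp (birkhoff (shift A) ψ n x)
  κ_pos : 0 < κ
  glue : ∀ n, 1 ≤ n → ∀ x x' : Space A, ∃ z ∈ cyl x n, (shift A)^[n + N] z = x' ∧
    κ * Real.exp (birkhoff (shift A) ψ n x) ≤ Real.exp (birkhoff (shift A) ψ (n + N) z)

lemma admissible_word (x : Space A) {n : ℕ} (hn : 1 ≤ n) : Admissible A (word x n) := by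
  refine ⟨?_, ?_⟩
  · intro h
    have := congrArg List.length h
    simp [word] at this
    omega
  · change List.IsChain A _
    rw [List.isChain_iff_getElem]
    intro i hi
    simp only [word, List.getElem_ofFn]
    exact x.2 i

lemma exists_glue {x x' : Space A} {n : ℕ} {l : List S}
    (h : Admissible A (word x n ++ l ++ word x' 1)) :
    ∃ z ∈ cyl x n, (shift A)^[n + l.length] z = x' ∧ (shift A)^[n] z ∈ cylinder A l := by
  obtain ⟨-, h⟩ := h
  replace h : List.IsChain A (word x n ++ l ++ word x' 1) := h
  rw [List.isChain_iff_getElem] at h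
  set L := word x n ++ l ++ word x' 1 with hL
  have hlen : L.length = n + l.length + 1 := by simp [hL, word]; omega
  have hw : ∀ (u : Space A) (m i : ℕ) (hi : i < (word u m).length), (word u m)[i] = u.1 i := by
    intro u m i hi
    simp [word]
  have hwl : ∀ (u : Space A) (m : ℕ), (word u m).length = m := fun u m => by simp [word]
  have hlast : ∀ hi : n + l.length < L.length, L[n + l.length] = x'.1 0 := by
    intro hi
    simp only [hL]
    rw [List.getElem_append_right (by simp [hwl]), hw]
    simp [hwl]
  set f : ℕ → S := fun i => if hi : i < n + l.length then L[i]'(by omega)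
    else x'.1 (i - (n + l.length)) with hf
  have hfL : ∀ i (hi : i ≤ n + l.length), f i = L[i]'(by omega) := by
    intro i hi
    rcases hi.lt_or_eq with hi | rfl
    · simp only [hf, dif_pos hi]
    · simp only [hf, lt_irrefl, dif_neg, not_false_eq_true, Nat.sub_self]
      exact (hlast (by omega)).symm
  have hfx : ∀ i, f (n + l.length + i) = x'.1 i := by
    intro i
    simp only [hf]
    rw [dif_neg (by omega), Nat.add_sub_cancel_left]
  have hadj : ∀ i, A (f i) (f (i + 1)) := by
    intro i
    rcases lt_or_ge i (n + l.length) with hi | hi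
    · rw [hfL i hi.le, hfL (i + 1) hi]
      exact h i (by omega)
    · obtain ⟨j, rfl⟩ := Nat.exists_eq_add_of_le hi
      rw [hfx, add_assoc, hfx]
      exact x'.2 j
  obtain ⟨z, hz⟩ : ∃ z : Space A, ∀ i, z.1 i = f i := ⟨⟨f, hadj⟩, fun _ => rfl⟩
  refine ⟨z, ?_, ?_, ?_⟩
  · intro i hi
    rw [hz, hfL i (by omega)]
    simp only [hL]
    rw [
        List.getElem_append_left (by simp [hwl]; omega), List.getElem_append_left (by simp [hwl]; omega),
      hw]
  · refine Space.ext fun i => ?_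
    rw [shift_iterate_apply, hz]
    exact hfx i
  · intro i
    rw [shift_iterate_apply, hz, hfL _ (by omega)]
    simp only [hL]
    rw [List.getElem_append_left (by simp [hwl]), List.getElem_append_right (by simp [hwl])]
    simp [hwl]

theorem exists_gibbsData (hprim : FinitelyPrimitive A) {φ : Space A → ℝ} (hφ : Measurable φ)
    (μ : Measure (Space A)) [IsProbabilityMeasure μ] {c P : ℝ} (hc : 1 ≤ c)
    (hG : IsGibbsWith A φ μ c P) :
    ∃ κ N, GibbsData (fun x => φ x - P) μ c κ N := by
  obtain ⟨Λ, ⟨N, hN⟩, hΛ⟩ := hprim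
  set ψ : Space A → ℝ := fun x => φ x - P with hψ
  have hc0 : 0 < c := by linarith
  have hb : ∀ n x, Real.exp (-(P * n) + birkhoff (shift A) φ n x) =
      Real.exp (birkhoff (shift A) ψ n x) := by
    intro n x
    rw [hψ, birkhoff_sub_const]
    congr 1
    ring
  have h0 : ∀ x : Space A, μ.real (cyl x 0) = 1 := by
    intro x
    have : cyl x 0 = univ := eq_univ_of_forall fun z i hi => absurd hi (by omega)
    rw [this, probReal_univ]
  have hexp_le : ∀ n x, Real.exp (birkhoff (shift A) ψ n x) ≤ c * μ.real (cyl x n) := by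
    intro n x
    rcases Nat.eq_zero_or_pos n with rfl | hn
    · rw [birkhoff_zero, h0]
      simpa using hc
    · have := (hG n hn x).1
      rw [hb, cylinder_word, inv_mul_le_iff₀ hc0] at this
      exact this
  have hle_exp : ∀ n x, μ.real (cyl x n) ≤ c * Real.exp (birkhoff (shift A) ψ n x) := by
    intro n x
    rcases Nat.eq_zero_or_pos n with rfl | hn
    · rw [birkhoff_zero, h0]
      simpa using hc
    · have := (hG n hn x).2
      rw [hb, cylinder_word] at this
      exact this
  have hmin : ∃ κ₀ : ℝ, 0 < κ₀ ∧ ∀ l ∈ Λ, 0 < μ.real (cylinder A l) →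
      κ₀ ≤ μ.real (cylinder A l) := by
    clear hΛ hN
    induction Λ using Finset.cons_induction with
    | empty => exact ⟨1, one_pos, by simp⟩
    | cons a s ha ih =>
      obtain ⟨κ₀, hκ₀, h⟩ := ih
      by_cases hpos : 0 < μ.real (cylinder A a)
      · refine ⟨min κ₀ (μ.real (cylinder A a)), lt_min hκ₀ hpos, fun l hl hl0 => ?_⟩
        rcases Finset.mem_cons.1 hl with rfl | hl
        · exact min_le_right _ _
        · exact (min_le_left _ _).trans (h l hl hl0)
      · refine ⟨κ₀, hκ₀, fun l hl hl0 => ?_⟩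
        rcases Finset.mem_cons.1 hl with rfl | hl
        · exact absurd hl0 hpos
        · exact h l hl hl0
  obtain ⟨κ₀, hκ₀, hmin⟩ := hmin
  refine ⟨κ₀ / c ^ 3, N, ⟨inferInstance, hφ.sub_const P, hc, hexp_le, hle_exp, by positivity, ?_⟩⟩
  intro n hn x x'
  obtain ⟨l, hl, hadm⟩ := hΛ _ _ (admissible_word x hn) (admissible_word x' le_rfl)
  obtain ⟨z, hz, hzx, hzl⟩ := exists_glue hadm
  rw [hN l hl] at hzx
  refine ⟨z, hz, hzx, ?_⟩
  rw [birkhoff_add, Real.exp_add]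
  have hcyl := cylinder_eq_cyl hzl
  rw [hN l hl] at hcyl
  have h1 := hexp_le N ((shift A)^[n] z)
  have h2 := hle_exp N ((shift A)^[n] z)
  rw [← hcyl] at h1 h2
  have hpos : 0 < μ.real (cylinder A l) := by
    have := (Real.exp_pos _).trans_le h1
    exact pos_of_mul_pos_right this hc0.le
  have h3 := (hmin l hl hpos).trans h2
  have h4 := hexp_le n x
  have h5 := hle_exp n z
  rw [cyl_eq_of_mem hz] at h5
  have h6 : Real.exp (birkhoff (shift A) ψ n x) ≤ c ^ 2 * Real.exp (birkhoff (shift A) ψ n z) := by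
    calc _ ≤ _ := h4
      _ ≤ c * (c * Real.exp (birkhoff (shift A) ψ n z)) := by gcongr
      _ = _ := by ring
  calc κ₀ / c ^ 3 * Real.exp (birkhoff (shift A) ψ n x)
      ≤ (c * Real.exp (birkhoff (shift A) ψ N ((shift A)^[n] z))) / c ^ 3 *
        (c ^ 2 * Real.exp (birkhoff (shift A) ψ n z)) := by gcongr
    _ = _ := by field_simp

variable {ψ : Space A → ℝ} {μ : Measure (Space A)} {c κ : ℝ} {N : ℕ}

lemma GibbsData.exp_le_of_mem (hg : GibbsData ψ μ c κ N) {x z : Space A} {n : ℕ}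
    (hz : z ∈ cyl x n) :
    Real.exp (birkhoff (shift A) ψ n x) ≤ c ^ 2 * Real.exp (birkhoff (shift A) ψ n z) := by
  have h5 := hg.le_exp n z
  rw [cyl_eq_of_mem hz] at h5
  have hc := hg.one_le
  calc _ ≤ _ := hg.exp_le n x
    _ ≤ c * (c * Real.exp (birkhoff (shift A) ψ n z)) := by gcongr
    _ = _ := by ring

lemma GibbsData.measure_cyl_pos (hg : GibbsData ψ μ c κ N) (x : Space A) (n : ℕ) :
    0 < μ.real (cyl x n) :=
  pos_of_mul_pos_right ((Real.exp_pos _).trans_le (hg.exp_le n x)) (by linarith [hg.one_le])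

lemma injOn_pre_preimSet (y : Space A) (n : ℕ) :
    InjOn (pre n) (preimSet (shift A) n y) := by
  intro x hx z hz h
  refine Space.ext fun i => ?_
  rcases lt_or_ge i n with hi | hi
  · exact congrFun h ⟨i, hi⟩
  · obtain ⟨j, rfl⟩ := Nat.exists_eq_add_of_le hi
    rw [← shift_iterate_apply, ← shift_iterate_apply]
    rw [show (shift A)^[n] x = y from hx, show (shift A)^[n] z = y from hz]

lemma GibbsData.Zfn_le (hg : GibbsData ψ μ c κ N) {n : ℕ} {C : Set (Space A)}
    (hC : InjOn (pre n) C) : Zfn (shift A) ψ n C ≤ ENNReal.ofReal c := by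
  have := hg.prob
  have hc : 0 ≤ c := by linarith [hg.one_le]
  calc Zfn (shift A) ψ n C ≤ ∑' x : C, ENNReal.ofReal c * μ (cyl (x : Space A) n) := by
        refine ENNReal.tsum_le_tsum fun x => ?_
        refine (ENNReal.ofReal_le_ofReal (hg.exp_le n x)).trans ?_
        rw [ENNReal.ofReal_mul hc, ofReal_measureReal]
    _ = ENNReal.ofReal c * ∑' x : C, μ (cyl (x : Space A) n) := ENNReal.tsum_mul_left
    _ ≤ ENNReal.ofReal c * 1 := by
        gcongr
        refine (tsum_meas_le_meas_iUnion_of_disjoint μ (fun x : C => measurableSet_cyl _ n)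
          ?_).trans prob_le_one
        intro x z hxz
        refine Set.disjoint_left.2 fun u hu hu' => hxz ?_
        refine Subtype.ext (hC x.2 z.2 ?_)
        rw [← pre_eq_iff.2 hu, ← pre_eq_iff.2 hu']
    _ = _ := mul_one _

lemma GibbsData.le_Zfn (hg : GibbsData ψ μ c κ N) (y : Space A) {n : ℕ} (hn : N + 1 ≤ n) :
    ENNReal.ofReal (κ / c) ≤ Zfn (shift A) ψ n (preimSet (shift A) n y) := by
  have := hg.prob
  have hc : 0 < c := by linarith [hg.one_le]
  have hκ := hg.κ_pos
  obtain ⟨m, rfl⟩ : ∃ m, n = m + N := ⟨n - N, by omega⟩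
  choose z hz hzy hzκ using fun x : Space A => hg.glue m (by omega) x y
  choose u hu using fun v : range (pre m : Space A → _) => v.2
  have h1 : (1 : ℝ≥0∞) ≤ ∑' v : range (pre m : Space A → _), μ (cyl (u v) m) := by
    rw [← measure_univ (μ := μ)]
    refine (measure_mono ?_).trans (measure_iUnion_le _)
    intro x _
    refine mem_iUnion.2 ⟨⟨pre m x, x, rfl⟩, ?_⟩
    exact pre_eq_iff.1 (hu ⟨pre m x, x, rfl⟩).symm
  have hinj : Function.Injective (fun v : range (pre m : Space A → _) =>
      (⟨z (u v), hzy _⟩ : preimSet (shift A) (m + N) y)) := by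
    intro v v' hvv
    have : z (u v) = z (u v') := congrArg Subtype.val hvv
    refine Subtype.ext ?_
    rw [← hu v, ← hu v', ← pre_eq_iff.2 (hz (u v)), this, pre_eq_iff.2 (hz (u v'))]
  calc ENNReal.ofReal (κ / c) = ENNReal.ofReal (κ / c) * 1 := (mul_one _).symm
    _ ≤ ENNReal.ofReal (κ / c) * ∑' v : range (pre m : Space A → _), μ (cyl (u v) m) := by gcongr
    _ = ∑' v : range (pre m : Space A → _), ENNReal.ofReal (κ / c) * μ (cyl (u v) m) :=
        ENNReal.tsum_mul_left.symm
    _ ≤ ∑' v : range (pre m : Space A → _),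
        ENNReal.ofReal (Real.exp (birkhoff (shift A) ψ (m + N) (z (u v)))) := by
        refine ENNReal.tsum_le_tsum fun v => ?_
        rw [← ofReal_measureReal (μ := μ), ← ENNReal.ofReal_mul (by positivity)]
        refine ENNReal.ofReal_le_ofReal ((?_ : _ ≤ _).trans (hzκ (u v)))
        have := hg.le_exp m (u v)
        calc κ / c * μ.real (cyl (u v) m) ≤
            κ / c * (c * Real.exp (birkhoff (shift A) ψ m (u v))) := by
              gcongr
          _ = _ := by field_simp
    _ ≤ _ := ENNReal.tsum_comp_le_tsum_of_injective hinj
        (fun x : preimSet (shift A) (m + N) y => ENNReal.ofReal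
          (Real.exp (birkhoff (shift A) ψ (m + N) (x : Space A))))

lemma GibbsData.weightedDistr_le (hg : GibbsData ψ μ c κ N) (y : Space A) {n : ℕ} (hn : N + 1 ≤ n)
    {G : Set (ProbabilityMeasure (Space A))} (hG : MeasurableSet G) :
    weightedDistr (shift A) ψ n (preimSet (shift A) n y) G ≤ ENNReal.ofReal (c / κ) *
      Zfn (shift A) ψ n (preimSet (shift A) n y ∩ {x | empirical (shift A) x n ∈ G}) := by
  have hc : 0 < c := by linarith [hg.one_le]
  have hκ := hg.κ_pos
  rw [weightedDistr_apply _ _ _ hG]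
  gcongr
  rw [ENNReal.inv_le_iff_inv_le, ← ENNReal.ofReal_inv_of_pos (by positivity), inv_div]
  exact hg.le_Zfn y hn

lemma GibbsData.le_weightedDistr (hg : GibbsData ψ μ c κ N) (y : Space A) (n : ℕ)
    {G : Set (ProbabilityMeasure (Space A))} (hG : MeasurableSet G) :
    ENNReal.ofReal c⁻¹ *
      Zfn (shift A) ψ n (preimSet (shift A) n y ∩ {x | empirical (shift A) x n ∈ G}) ≤
    weightedDistr (shift A) ψ n (preimSet (shift A) n y) G := by
  have hc : 0 < c := by linarith [hg.one_le]
  rw [weightedDistr_apply _ _ _ hG, ENNReal.ofReal_inv_of_pos hc]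
  gcongr
  exact hg.Zfn_le (injOn_pre_preimSet y n)

end Gibbs

lemma tsum_prod_fin {S : Type*} (u : S → ℝ≥0∞) (n : ℕ) :
    ∑' v : Fin n → S, ∏ i, u (v i) = (∑' a, u a) ^ n := by
  induction n with
  | zero => simp
  | succ n ih =>
    rw [← (Fin.consEquiv fun _ => S).tsum_eq, ENNReal.tsum_prod', pow_succ', ← ih,
      ← ENNReal.tsum_mul_right]
    refine tsum_congr fun a => ?_
    rw [← ENNReal.tsum_mul_left]
    refine tsum_congr fun v => ?_
    simp [Fin.consEquiv, Fin.prod_univ_succ]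

section Tight

variable {S : Type*} [Countable S] [TopologicalSpace S] [DiscreteTopology S] {A : S → S → Prop}
variable {ψ : Space A → ℝ} {μ : Measure (Space A)} {c κ : ℝ} {N : ℕ}

open Classical in
/-- Number of the first `n` symbols of `x` outside `F`. -/
noncomputable def outCount (F : Set S) (n : ℕ) (x : Space A) : ℕ :=
  ((Finset.range n).filter fun i => x.1 i ∉ F).card

open Classical in
lemma GibbsData.exp_birkhoff_le_prod (hg : GibbsData ψ μ c κ N) (F : Set S) (θ : ℝ) (n : ℕ)
    (x : Space A) :
    ENNReal.ofReal (Real.exp (birkhoff (shift A) ψ n x + θ * outCount F n x)) ≤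
      ∏ i : Fin n, (ENNReal.ofReal c * μ (cylinder A [x.1 i]) *
        if x.1 i ∈ F then 1 else ENNReal.ofReal (Real.exp θ)) := by
  have := hg.prob
  have hc : 0 ≤ c := by linarith [hg.one_le]
  have e : birkhoff (shift A) ψ n x + θ * outCount F n x =
      ∑ i ∈ Finset.range n, (ψ ((shift A)^[i] x) + if x.1 i ∈ F then 0 else θ) := by
    rw [Finset.sum_add_distrib, birkhoff, outCount, Finset.card_filter]
    push_cast
    rw [Finset.mul_sum]
    congr 1
    refine Finset.sum_congr rfl fun i _ => ?_
    by_cases h : x.1 i ∈ F <;> simp [h]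
  rw [e, Real.exp_sum, ENNReal.ofReal_prod_of_nonneg fun _ _ => (Real.exp_pos _).le,
    Finset.prod_range]
  refine Finset.prod_le_prod' fun i _ => ?_
  rw [Real.exp_add, ENNReal.ofReal_mul (Real.exp_pos _).le]
  refine mul_le_mul' ?_ ?_
  · have h := hg.exp_le 1 ((shift A)^[i] x)
    rw [birkhoff_one] at h
    have hcyl : cyl ((shift A)^[(i : ℕ)] x) 1 = cylinder A [x.1 i] := by
      rw [← cylinder_word]
      congr 1
      simp [word, shift_iterate_apply]
    rw [hcyl] at h
    refine (ENNReal.ofReal_le_ofReal h).trans ?_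
    rw [ENNReal.ofReal_mul hc, ofReal_measureReal]
  · by_cases h : x.1 i ∈ F <;> simp [h]

lemma pairwise_disjoint_cylinder_singleton :
    Pairwise (Function.onFun Disjoint fun a : S => cylinder A [a]) := by
  intro a b hab
  refine Set.disjoint_left.2 fun x hx hx' => hab ?_
  exact (hx (0 : Fin 1)).symm.trans (hx' (0 : Fin 1))

lemma tsum_measure_cylinder_le [IsProbabilityMeasure μ] (F : Set S) :
    ∑' a, F.indicator (fun a => μ (cylinder A [a])) a ≤ μ {x : Space A | x.1 0 ∈ F} := by
  rw [← tsum_subtype F fun a => μ (cylinder A [a])]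
  refine (tsum_meas_le_meas_iUnion_of_disjoint μ
      (fun a : F => (isClopen_cylinder _).2.measurableSet)
    (fun a b hab => pairwise_disjoint_cylinder_singleton fun h => hab (Subtype.ext h))).trans ?_
  refine measure_mono (iUnion_subset fun a x hx => ?_)
  rw [mem_ofPred_eq, show x.1 0 = a from hx (0 : Fin 1)]
  exact a.2

open Classical in
lemma GibbsData.tsum_exp_outCount_le (hg : GibbsData ψ μ c κ N) {F : Set S} {θ : ℝ}
    (hF : ENNReal.ofReal (Real.exp θ) * μ {x : Space A | x.1 0 ∈ Fᶜ} ≤ 1) {n : ℕ}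
    {C : Set (Space A)} (hC : InjOn (pre n) C) :
    ∑' x : C, ENNReal.ofReal (Real.exp (birkhoff (shift A) ψ n x + θ * outCount F n (x : Space A)))
      ≤ ENNReal.ofReal (2 * c) ^ n := by
  have := hg.prob
  set u : S → ℝ≥0∞ := fun a => ENNReal.ofReal c * μ (cylinder A [a]) *
        if a ∈ F then 1 else ENNReal.ofReal (Real.exp θ) with hu
  have hsum : ∑' a, u a ≤ ENNReal.ofReal (2 * c) := by
    have h1 : ∀ a, u a = ENNReal.ofReal c * (F.indicator (fun a => μ (cylinder A [a])) a +
        ENNReal.ofReal (Real.exp θ) * Fᶜ.indicator (fun a => μ (cylinder A [a])) a) := by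
      intro a
      by_cases h : a ∈ F <;> simp [hu, h]
      ring
    simp only [h1, ENNReal.tsum_mul_left, ENNReal.tsum_add]
    rw [mul_comm 2, ENNReal.ofReal_mul (by linarith [hg.one_le])]
    gcongr
    calc _ ≤ (1 : ℝ≥0∞) + ENNReal.ofReal (Real.exp θ) * μ {x : Space A | x.1 0 ∈ Fᶜ} := by
          gcongr
          · exact (tsum_measure_cylinder_le F).trans prob_le_one
          · exact tsum_measure_cylinder_le Fᶜ
      _ ≤ 1 + 1 := by gcongr
      _ = ENNReal.ofReal 2 := by norm_num
  calc _ ≤ ∑' x : C, ∏ i, u (pre n (x : Space A) i) :=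
        ENNReal.tsum_le_tsum fun x => hg.exp_birkhoff_le_prod F θ n x
    _ ≤ ∑' v : Fin n → S, ∏ i, u (v i) :=
        ENNReal.tsum_comp_le_tsum_of_injective (f := fun x : C => pre n (x : Space A))
          (fun x z h => Subtype.ext (hC x.2 z.2 h)) (fun v : Fin n → S => ∏ i, u (v i))
    _ = (∑' a, u a) ^ n := tsum_prod_fin u n
    _ ≤ _ := by gcongr

lemma exists_finite_measure_compl_le [IsProbabilityMeasure μ] {ε : ℝ≥0∞} (hε : 0 < ε)
    (F₀ : Finset S) : ∃ F : Finset S, F₀ ⊆ F ∧ μ {x : Space A | x.1 0 ∈ (F : Set S)ᶜ} ≤ ε := by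
  have hanti : Antitone fun F : Finset S => {x : Space A | x.1 0 ∈ (F : Set S)ᶜ} :=
    fun F F' h x hx hx' => hx (h hx')
  have hm : ∀ F : Finset S, NullMeasurableSet {x : Space A | x.1 0 ∈ (F : Set S)ᶜ} μ := fun F =>
    (isClopen_of_prefix (n := 1) fun x z hz => by
      simp only [mem_ofPred_eq, hz 0 one_pos]).2.measurableSet.nullMeasurableSet
  have ht := tendsto_measure_iInter_atTop (μ := μ) hm hanti ⟨∅, measure_ne_top _ _⟩
  have hempty : ⋂ F : Finset S, {x : Space A | x.1 0 ∈ (F : Set S)ᶜ} = ∅ := by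
    refine eq_empty_of_forall_notMem fun x hx => ?_
    have := mem_iInter.1 hx {x.1 0}
    simp at this
  rw [hempty, measure_empty] at ht
  obtain ⟨F, h1, h2⟩ := ((ht.eventually (ge_mem_nhds hε)).and (eventually_ge_atTop F₀)).exists
  exact ⟨F, h2, h1⟩

lemma measure_outside_le {F : ℕ → Set S} {y : Space A} (hy : ∀ t, ∀ l ≤ t, y.1 l ∈ F t) {n : ℕ}
    (hn : 1 ≤ n) {x : Space A} (hx : x ∈ preimSet (shift A) n y)
    (hcount : ∀ t, (outCount (F t) n x : ℝ) ≤ n * (1 / 2) ^ t) (j : ℕ) :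
    (empirical (shift A) x n : Measure (Space A)).real {z | ∀ l, z.1 l ∈ F (l + j)}ᶜ
      ≤ 2 * (1 / 2) ^ j := by
  classical
  have hmeas : MeasurableSet {z : Space A | ∀ l, z.1 l ∈ F (l + j)}ᶜ := by
    have : {z : Space A | ∀ l, z.1 l ∈ F (l + j)} = ⋂ l, {z : Space A | z.1 l ∈ F (l + j)} := by
      ext z; simp
    rw [this]
    refine (MeasurableSet.iInter fun l => ?_).compl
    exact (isClopen_of_prefix (n := l + 1) fun x z hz => by
      simp only [mem_ofPred_eq, hz l (by omega)]).2.measurableSet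
  rw [empirical_real x hn hmeas]
  have hnpos : (0 : ℝ) < n := by exact_mod_cast hn
  rw [inv_mul_le_iff₀ hnpos]
  have hpt : ∀ i ∈ Finset.range n, ({z : Space A | ∀ l, z.1 l ∈ F (l + j)}ᶜ.indicator
      (1 : Space A → ℝ) ((shift A)^[i] x)) ≤
      ∑ l ∈ Finset.range n, if i + l < n ∧ x.1 (i + l) ∉ F (l + j) then 1 else 0 := by
    intro i hi
    have hnn : (0 : ℝ) ≤ ∑ l ∈ Finset.range n, if i + l < n ∧ x.1 (i + l) ∉ F (l + j) then 1
      else 0 := Finset.sum_nonneg fun _ _ => by split_ifs <;> norm_num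
    by_cases h : (shift A)^[i] x ∈ {z : Space A | ∀ l, z.1 l ∈ F (l + j)}ᶜ
    · rw [indicator_of_mem h]
      simp only [mem_compl_iff, mem_ofPred_eq, shift_iterate_apply, not_forall] at h
      obtain ⟨l, hl⟩ := h
      have hil : i + l < n := by
        by_contra hcon
        obtain ⟨k, hk⟩ := Nat.exists_eq_add_of_le (not_lt.1 hcon)
        refine hl ?_
        rw [hk, ← shift_iterate_apply, show (shift A)^[n] x = y from hx]
        have := Finset.mem_range.1 hi
        exact hy _ _ (by omega)
      refine le_trans ?_ (Finset.single_le_sum (fun _ _ => by split_ifs <;> norm_num)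
        (Finset.mem_range.2 (show l < n by omega)))
      rw [if_pos ⟨hil, hl⟩]
      simp
    · rw [indicator_of_notMem h]
      exact hnn
  calc birkhoff (shift A) ({z : Space A | ∀ l, z.1 l ∈ F (l + j)}ᶜ.indicator 1) n x
      ≤ ∑ i ∈ Finset.range n, ∑ l ∈ Finset.range n,
        (if i + l < n ∧ x.1 (i + l) ∉ F (l + j) then (1 : ℝ) else 0) := Finset.sum_le_sum hpt
    _ = ∑ l ∈ Finset.range n, ∑ i ∈ Finset.range n,
        (if i + l < n ∧ x.1 (i + l) ∉ F (l + j) then (1 : ℝ) else 0) := Finset.sum_comm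
    _ ≤ ∑ l ∈ Finset.range n, (outCount (F (l + j)) n x : ℝ) := by
        refine Finset.sum_le_sum fun l _ => ?_
        rw [Finset.sum_boole, outCount]
        norm_cast
        refine Finset.card_le_card_of_injOn (fun i => i + l) ?_ ?_
        · intro i hi
          simp only [Finset.coe_filter, Finset.mem_range, mem_ofPred_eq] at hi ⊢
          exact hi.2
        · intro a _ b _ h
          simpa using h
    _ ≤ ∑ l ∈ Finset.range n, (n : ℝ) * (1 / 2) ^ (l + j) :=
        Finset.sum_le_sum fun l _ => hcount _
    _ = n * (1 / 2) ^ j * ∑ l ∈ Finset.range n, (1 / 2 : ℝ) ^ l := by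
        rw [Finset.mul_sum]
        refine Finset.sum_congr rfl fun l _ => ?_
        rw [pow_add]; ring
    _ ≤ n * (1 / 2) ^ j * 2 := by
        gcongr
        exact sum_geometric_two_le n
    _ = _ := by ring

theorem GibbsData.exists_compact_Zfn_le (hg : GibbsData ψ μ c κ N) (y : Space A)
    {L : ℝ} (hL : 0 ≤ L) :
    ∃ K : Set (ProbabilityMeasure (Space A)), IsCompact K ∧ ∀ n, 1 ≤ n →
      Zfn (shift A) ψ n (preimSet (shift A) n y ∩ {x | empirical (shift A) x n ∉ K}) ≤
        ENNReal.ofReal (2 * Real.exp (-(L * n))) := by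
  have := hg.prob
  have hc : 1 ≤ c := hg.one_le
  set L' : ℝ := L + Real.log (2 * c) with hL'
  set θ : ℕ → ℝ := fun t => 2 ^ t * (L' + t) with hθ
  choose F hF₀ hF using fun t : ℕ => exists_finite_measure_compl_le (A := A) (μ := μ)
    (ε := (ENNReal.ofReal (Real.exp (θ t)))⁻¹) (by simp)
    (((Finset.range (t + 1)).finite_toSet.image y.1).toFinset)
  have hy : ∀ t, ∀ l ≤ t, y.1 l ∈ (F t : Set S) := by
    intro t l hl
    refine hF₀ t ?_
    simp only [Finite.mem_toFinset]
    exact ⟨l, by simpa using Nat.lt_succ_of_le hl, rfl⟩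
  set Kj : ℕ → Set (Space A) := fun j => {z | ∀ l, z.1 l ∈ (F (l + j) : Set S)} with hKj
  have hcpt : ∀ j, IsCompact (Kj j) := fun j =>
    isCompact_of_finite_coords (fun l => (F (l + j) : Set S)) fun l => Finset.finite_toSet _
  set u : ℕ → ℝ≥0 := fun j => 2 * (1 / 2) ^ j with hu
  have hu0 : Tendsto u atTop (𝓝 0) := by
    have := (tendsto_pow_atTop_nhds_zero_of_lt_one (r := (1 / 2 : ℝ≥0)) (by positivity) (by
      rw [div_lt_one (by norm_num)]; norm_num)).const_mul 2
    rwa [mul_zero] at this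
  refine ⟨_, isCompact_setOfPred_probabilityMeasure_mass_eq_compl_isCompact_le hu0 hcpt
    (Or.inl inferInstance), fun n hn => ?_⟩
  have hnpos : (0 : ℝ) < n := by exact_mod_cast hn
  set C := preimSet (shift A) n y with hCdef
  have hC : InjOn (pre n) C := injOn_pre_preimSet y n
  have hsub : C ∩ {x | empirical (shift A) x n ∉
      {μ : ProbabilityMeasure (Space A) | ∀ j, μ (Kj j)ᶜ ≤ u j}} ⊆
      ⋃ t : ℕ, C ∩ {x | (n : ℝ) * (1 / 2) ^ t < outCount (F t : Set S) n x} := by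
    rintro x ⟨hx, hxK⟩
    by_contra hcon
    simp only [mem_iUnion, mem_inter_iff, hx, true_and, mem_ofPred_eq, not_exists, not_lt] at hcon
    refine hxK fun j => ?_
    have := measure_outside_le (F := fun t => (F t : Set S)) hy hn hx hcon j
    rw [← NNReal.coe_le_coe]
    exact this
  have hone : ∀ t : ℕ, Zfn (shift A) ψ n
      (C ∩ {x | (n : ℝ) * (1 / 2) ^ t < outCount (F t : Set S) n x}) ≤
      ENNReal.ofReal (Real.exp (-(L * n))) * (2⁻¹) ^ t := by
    intro t
    set D := C ∩ {x | (n : ℝ) * (1 / 2) ^ t < outCount (F t : Set S) n x} with hD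
    have hpos : 0 ≤ θ t := by
      have := Real.log_nonneg (x := 2 * c) (by linarith)
      simp only [hθ, hL']
      positivity
    · have hb := hg.tsum_exp_outCount_le (F := (F t : Set S)) (θ := θ t) (n := n) (C := D) (by
        refine (mul_le_mul_right (hF t) _).trans ?_
        exact ENNReal.mul_inv_le_one _) (hC.mono inter_subset_left)
      calc Zfn (shift A) ψ n D ≤ ∑' x : D, ENNReal.ofReal (Real.exp (-((L' + t) * n))) *
            ENNReal.ofReal (Real.exp (birkhoff (shift A) ψ n x +
              θ t * outCount (F t : Set S) n (x : Space A))) := by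
            refine ENNReal.tsum_le_tsum fun x => ?_
            rw [← ENNReal.ofReal_mul (Real.exp_pos _).le, ← Real.exp_add]
            refine ENNReal.ofReal_le_ofReal (Real.exp_le_exp.2 ?_)
            have h1 := mul_le_mul_of_nonneg_left (le_of_lt x.2.2) hpos
            have h2 : θ t * (n * (1 / 2) ^ t) = (L' + t) * n := by
              simp only [hθ]
              rw [one_div, inv_pow]
              field_simp
            linarith
        _ ≤ ENNReal.ofReal (Real.exp (-((L' + t) * n))) * ENNReal.ofReal (2 * c) ^ n := by
            rw [ENNReal.tsum_mul_left]
            gcongr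
        _ ≤ ENNReal.ofReal (Real.exp (-(L * n)) * (1 / 2) ^ t) := by
            rw [← ENNReal.ofReal_pow (by linarith), ← ENNReal.ofReal_mul (Real.exp_pos _).le]
            refine ENNReal.ofReal_le_ofReal ?_
            have e1 : (2 * c) ^ n = Real.exp (n * Real.log (2 * c)) := by
              rw [Real.exp_nat_mul, Real.exp_log (by linarith)]
            rw [e1, ← Real.exp_add]
            have e2 : -((L' + t) * n) + n * Real.log (2 * c) = -(L * n) + -(t * n : ℝ) := by
              rw [hL']; ring
            rw [e2, Real.exp_add]
            gcongr
            have e3 : Real.exp (-(t * n : ℝ)) ≤ Real.exp (-1) ^ t := by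
              rw [← Real.exp_nat_mul]
              refine Real.exp_le_exp.2 ?_
              have : (1 : ℝ) ≤ n := by exact_mod_cast hn
              nlinarith [(Nat.cast_nonneg t : (0 : ℝ) ≤ t)]
            refine e3.trans (pow_le_pow_left₀ (Real.exp_pos _).le ?_ _)
            rw [Real.exp_neg, one_div]
            refine inv_anti₀ (by norm_num) ?_
            linarith [Real.add_one_le_exp (1 : ℝ)]
        _ = _ := by
            rw [ENNReal.ofReal_mul (Real.exp_pos _).le, ENNReal.ofReal_pow (by norm_num)]
            congr 2
            rw [one_div, ENNReal.ofReal_inv_of_pos (by norm_num)]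
            norm_num
  calc _ ≤ Zfn (shift A) ψ n (⋃ t : ℕ, C ∩ {x | (n : ℝ) * (1 / 2) ^ t <
        outCount (F t : Set S) n x}) := Zfn_mono ψ n hsub
    _ ≤ ∑' t : ℕ, Zfn (shift A) ψ n (C ∩ {x | (n : ℝ) * (1 / 2) ^ t <
        outCount (F t : Set S) n x}) :=
        ENNReal.tsum_iUnion_le_tsum (fun x => ENNReal.ofReal (Real.exp (birkhoff (shift A) ψ n x))) _
    _ ≤ ∑' t : ℕ, ENNReal.ofReal (Real.exp (-(L * n))) * (2⁻¹) ^ t := ENNReal.tsum_le_tsum hone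
    _ = _ := by
        rw [ENNReal.tsum_mul_left, ENNReal.tsum_geometric, mul_comm 2,
          ENNReal.ofReal_mul (Real.exp_pos _).le]
        congr 1
        rw [ENNReal.one_sub_inv_two, inv_inv]
        norm_num

end Tight

lemma sum_biUnion_le {J B : Type*} [DecidableEq B] (s : Finset J) (t : J → Finset B) {f : B → ℝ}
    (hf : ∀ b, 0 ≤ f b) : ∑ b ∈ s.biUnion t, f b ≤ ∑ j ∈ s, ∑ b ∈ t j, f b := by
  classical
  induction s using Finset.induction_on with
  | empty => simp
  | insert a s ha ih =>
    rw [Finset.biUnion_insert, Finset.sum_insert ha]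
    have := Finset.sum_union_inter (s₁ := t a) (s₂ := s.biUnion t) (f := f)
    have h0 : 0 ≤ ∑ b ∈ t a ∩ s.biUnion t, f b := Finset.sum_nonneg fun b _ => hf b
    linarith

section WeakLaw

variable {ι : Type*} [Fintype ι] {p : ι → ℝ}

lemma sum_fin_succ_fun (k : ℕ) (G : (Fin (k + 1) → ι) → ℝ) :
    ∑ b, G b = ∑ a, ∑ b : Fin k → ι, G (Fin.cons a b) := by
  rw [← (Fin.consEquiv fun _ => ι).sum_comp, Fintype.sum_prod_type]
  rfl

lemma sum_prod_weights (hp1 : ∑ a, p a = 1) (k : ℕ) : ∑ b : Fin k → ι, ∏ i, p (b i) = 1 := by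
  induction k with
  | zero => simp
  | succ k ih =>
    rw [sum_fin_succ_fun]
    simp only [Fin.prod_univ_succ, Fin.cons_zero, Fin.cons_succ, ← Finset.mul_sum, ih, mul_one, hp1]

lemma sum_prod_mul_sum (hp1 : ∑ a, p a = 1) {u : ι → ℝ} (hu : ∑ a, p a * u a = 0) (k : ℕ) :
    ∑ b : Fin k → ι, (∏ i, p (b i)) * ∑ i, u (b i) = 0 := by
  induction k with
  | zero => simp
  | succ k ih =>
    rw [sum_fin_succ_fun]
    have : ∀ a, ∑ b : Fin k → ι, (∏ i, p ((Fin.cons a b : Fin (k + 1) → ι) i)) *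
        ∑ i, u ((Fin.cons a b : Fin (k + 1) → ι) i) = p a * u a := by
      intro a
      simp only [Fin.prod_univ_succ, Fin.sum_univ_succ, Fin.cons_zero, Fin.cons_succ, mul_add,
        Finset.sum_add_distrib, mul_assoc, ← Finset.mul_sum, ih]
      rw [← Finset.sum_mul, sum_prod_weights hp1]
      ring
    simp only [this, hu]

lemma sum_prod_mul_sq (hp1 : ∑ a, p a = 1) {u : ι → ℝ} (hu : ∑ a, p a * u a = 0) (k : ℕ) :
    ∑ b : Fin k → ι, (∏ i, p (b i)) * (∑ i, u (b i)) ^ 2 = k * ∑ a, p a * u a ^ 2 := by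
  induction k with
  | zero => simp
  | succ k ih =>
    rw [sum_fin_succ_fun]
    have : ∀ a, ∑ b : Fin k → ι, (∏ i, p ((Fin.cons a b : Fin (k + 1) → ι) i)) *
        (∑ i, u ((Fin.cons a b : Fin (k + 1) → ι) i)) ^ 2 =
        p a * u a ^ 2 + p a * (k * ∑ a, p a * u a ^ 2) := by
      intro a
      have e : ∀ b : Fin k → ι, (p a * ∏ i, p (b i)) * (u a + ∑ i, u (b i)) ^ 2 =
          p a * u a ^ 2 * (∏ i, p (b i)) + 2 * p a * u a * ((∏ i, p (b i)) * ∑ i, u (b i)) +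
            p a * ((∏ i, p (b i)) * (∑ i, u (b i)) ^ 2) := fun b => by ring
      simp only [Fin.prod_univ_succ, Fin.sum_univ_succ, Fin.cons_zero, Fin.cons_succ, e,
        Finset.sum_add_distrib, ← Finset.mul_sum, ih, sum_prod_mul_sum hp1 hu,
        sum_prod_weights hp1]
      ring
    simp only [this, Finset.sum_add_distrib, ← Finset.sum_mul, hp1]
    push_cast
    ring

open Classical in
lemma sum_prod_deviation_le (hp0 : ∀ a, 0 ≤ p a) (hp1 : ∑ a, p a = 1) (u : ι → ℝ) {δ : ℝ}
    (hδ : 0 < δ) {k : ℕ} (hk : 1 ≤ k) :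
    ∑ b : Fin k → ι with k * δ < |∑ i, u (b i) - k * ∑ a, p a * u a|, ∏ i, p (b i) ≤
      (∑ a, p a * (u a - ∑ a, p a * u a) ^ 2) / (k * δ ^ 2) := by
  set M := ∑ a, p a * u a with hM
  have hkpos : (0 : ℝ) < k := by exact_mod_cast hk
  have hc : ∑ a, p a * (u a - M) = 0 := by
    simp only [mul_sub, Finset.sum_sub_distrib, ← Finset.sum_mul, hp1, ← hM]
    ring
  have hsq := sum_prod_mul_sq hp1 hc k
  have hcen : ∀ b : Fin k → ι, ∑ i, (u (b i) - M) = ∑ i, u (b i) - k * M := by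
    intro b
    simp [Finset.sum_sub_distrib]
  simp only [hcen] at hsq
  rw [le_div_iff₀ (by positivity), Finset.sum_mul]
  have : ∑ b : Fin k → ι with k * δ < |∑ i, u (b i) - k * M|, (∏ i, p (b i)) * (k * δ) ^ 2 ≤
      k * ∑ a, p a * (u a - M) ^ 2 := by
    rw [← hsq]
    refine (Finset.sum_le_sum fun b hb => ?_).trans
      (Finset.sum_le_sum_of_subset_of_nonneg (Finset.filter_subset _ _) fun b _ _ =>
        mul_nonneg (Finset.prod_nonneg fun i _ => hp0 _) (sq_nonneg _))
    have hb := (Finset.mem_filter.1 hb).2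
    refine mul_le_mul_of_nonneg_left ?_ (Finset.prod_nonneg fun i _ => hp0 _)
    rw [← sq_abs (∑ i, u (b i) - k * M)]
    exact pow_le_pow_left₀ (by positivity) hb.le _
  have h2 : ∑ b : Fin k → ι with k * δ < |∑ i, u (b i) - k * M|, (∏ i, p (b i)) * (k * δ ^ 2) =
      (∑ b : Fin k → ι with k * δ < |∑ i, u (b i) - k * M|, (∏ i, p (b i)) * (k * δ) ^ 2) / k := by
    rw [Finset.sum_div]
    refine Finset.sum_congr rfl fun b _ => ?_
    field_simp
  rw [h2, div_le_iff₀ hkpos]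
  linarith

open Classical in
/-- The weak law of large numbers for finitely many functions on a finite probability space. -/
lemma eventually_half_le_sum_prod (hp0 : ∀ a, 0 ≤ p a) (hp1 : ∑ a, p a = 1) {J : Type*}
    (s : Finset J) (u : J → ι → ℝ) {δ : ℝ} (hδ : 0 < δ) :
    ∀ᶠ k : ℕ in atTop, 1 / 2 ≤
      ∑ b : Fin k → ι with ∀ j ∈ s, |∑ i, u j (b i) - k * ∑ a, p a * u j a| ≤ k * δ,
        ∏ i, p (b i) := by
  set V : ℝ := ∑ j ∈ s, ∑ a, p a * (u j a - ∑ a, p a * u j a) ^ 2 with hV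
  have ht := (tendsto_natCast_atTop_atTop (R := ℝ)).eventually_ge_atTop (2 * V / δ ^ 2)
  filter_upwards [eventually_ge_atTop 1, ht] with k hk hkV
  have hkpos : (0 : ℝ) < k := by exact_mod_cast hk
  have hnn : ∀ b : Fin k → ι, 0 ≤ ∏ i, p (b i) := fun b => Finset.prod_nonneg fun i _ => hp0 _
  have hsplit := Finset.sum_filter_add_sum_filter_not Finset.univ
    (fun b : Fin k → ι => ∀ j ∈ s, |∑ i, u j (b i) - k * ∑ a, p a * u j a| ≤ k * δ)
    (fun b => ∏ i, p (b i))
  rw [sum_prod_weights hp1] at hsplit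
  have hbad : ∑ b : Fin k → ι with ¬ ∀ j ∈ s, |∑ i, u j (b i) - k * ∑ a, p a * u j a| ≤ k * δ,
      ∏ i, p (b i) ≤ V / (k * δ ^ 2) := by
    rw [hV, Finset.sum_div]
    refine le_trans ?_ (Finset.sum_le_sum fun j _ => sum_prod_deviation_le hp0 hp1 (u j) hδ hk)
    refine le_trans (Finset.sum_le_sum_of_subset_of_nonneg
      (t := s.biUnion fun j => Finset.univ.filter fun b : Fin k → ι =>
        k * δ < |∑ i, u j (b i) - k * ∑ a, p a * u j a|) ?_ fun b _ _ => hnn b) ?_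
    · intro b hb
      simp only [Finset.mem_filter, Finset.mem_univ, true_and, not_forall, not_le] at hb
      obtain ⟨j, hj, h⟩ := hb
      simp only [Finset.mem_biUnion, Finset.mem_filter, Finset.mem_univ, true_and]
      exact ⟨j, hj, h⟩
    · exact sum_biUnion_le s _ hnn
  have : V / (k * δ ^ 2) ≤ 1 / 2 := by
    rw [div_le_iff₀ (by positivity)] at hkV ⊢
    linarith
  linarith

end WeakLaw

section Invariance

variable {X : Type*} [MeasurableSpace X] {T : X → X}

lemma Invariant.measurePreserving {ν : Measure X} (hν : Invariant T ν) (hT : Measurable T) :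
    MeasurePreserving T ν ν := ⟨hT, hν⟩

lemma integrable_birkhoff {ν : Measure X} (hν : Invariant T ν) (hT : Measurable T) {f : X → ℝ}
    (hf : Integrable f ν) (m : ℕ) : Integrable (birkhoff T f m) ν := by
  unfold birkhoff
  exact integrable_finsetSum _ fun i _ =>
    ((hν.measurePreserving hT).iterate i).integrable_comp_of_integrable hf

lemma integral_birkhoff {ν : Measure X} (hν : Invariant T ν) (hT : Measurable T) {f : X → ℝ}
    (hf : Integrable f ν) (hfm : Measurable f) (m : ℕ) :
    ∫ x, birkhoff T f m x ∂ν = m * ∫ x, f x ∂ν := by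
  unfold birkhoff
  rw [integral_finsetSum (f := fun i x => f (T^[i] x)) _ fun i _ =>
    ((hν.measurePreserving hT).iterate i).integrable_comp_of_integrable hf]
  have : ∀ i, ∫ x, f (T^[i] x) ∂ν = ∫ x, f x ∂ν := by
    intro i
    have hmp := (hν.measurePreserving hT).iterate i
    have := integral_map (μ := ν) hmp.measurable.aemeasurable
      (f := f) hfm.aestronglyMeasurable
    rw [hmp.map_eq] at this
    exact this.symm
  simp [this]

end Invariance

section FiniteApprox

variable {S : Type*} [Countable S] [TopologicalSpace S] [DiscreteTopology S] {A : S → S → Prop}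
variable {ψ : Space A → ℝ} {μ : Measure (Space A)} {c κ : ℝ} {N : ℕ}

/-- The indicator function of a cylinder. -/
noncomputable def ind (A : S → S → Prop) (w : List S) : Space A → ℝ := (cylinder A w).indicator 1

lemma ind_nonneg (w : List S) (x : Space A) : 0 ≤ ind A w x :=
  indicator_nonneg (fun _ _ => zero_le_one) x

lemma ind_le_one (w : List S) (x : Space A) : ind A w x ≤ 1 :=
  indicator_le_self' (fun _ _ => zero_le_one) x

lemma measurable_ind (w : List S) : Measurable (ind A w) :=
  measurable_one.indicator (isClopen_cylinder w).2.measurableSet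

lemma ind_eq_of_mem_cyl (w : List S) (x z : Space A) (h : z ∈ cyl x w.length) :
    ind A w z = ind A w x := by
  have : z ∈ cylinder A w ↔ x ∈ cylinder A w := by
    constructor
    · intro hz i
      rw [← hz i, (mem_cyl.1 h) i i.2]
    · intro hx i
      rw [← hx i, (mem_cyl.1 h) i i.2]
  unfold ind
  by_cases hx : x ∈ cylinder A w
  · simp [hx, this.2 hx]
  · simp [hx, mt this.1 hx]

lemma integrable_ind (w : List S) (ν : Measure (Space A)) [IsFiniteMeasure ν] :
    Integrable (ind A w) ν :=
  (integrable_const (1 : ℝ)).indicator (isClopen_cylinder w).2.measurableSet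

lemma integral_ind (w : List S) (ν : Measure (Space A)) :
    ∫ x, ind A w x ∂ν = ν.real (cylinder A w) :=
  integral_indicator_one (isClopen_cylinder w).2.measurableSet

lemma abs_birkhoff_ind_sub_le (w : List S) {n : ℕ} {x z : Space A} (hz : z ∈ cyl x n) :
    |birkhoff (shift A) (ind A w) n z - birkhoff (shift A) (ind A w) n x| ≤ w.length :=
  abs_birkhoff_sub_le (ind_nonneg w) (ind_le_one w) (ind_eq_of_mem_cyl w) hz

lemma hasSum_integral_pre (ν : Measure (Space A)) {f : Space A → ℝ} (hf : Integrable f ν) (m : ℕ) :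
    HasSum (fun v : Fin m → S => ∫ x in (pre m) ⁻¹' {v}, f x ∂ν) (∫ x, f x ∂ν) := by
  have h := hasSum_integral_iUnion (μ := ν) (f := f)
    (s := fun v : Fin m → S => (pre m : Space A → _) ⁻¹' {v})
    (fun v => measurableSet_pre m v) (fun v w hvw => by
      refine disjoint_left.2 fun x hx hx' => hvw ?_
      rw [← show pre m x = v from hx, ← show pre m x = w from hx']) hf.integrableOn
  have hu : (⋃ v : Fin m → S, (pre m : Space A → _) ⁻¹' {v}) = univ :=
    eq_univ_of_forall fun x => mem_iUnion.2 ⟨pre m x, rfl⟩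
  rwa [hu, setIntegral_univ] at h

/-- An invariant measure is approximated by weights on finitely many words. -/
lemma GibbsData.exists_finite_approx (hg : GibbsData ψ μ c κ N) (ν : Measure (Space A))
    [IsProbabilityMeasure ν] (hν : Invariant (shift A) ν) (hψ : Integrable ψ ν) {m : ℕ} {h : ℝ}
    (hH : ENNReal.ofReal (m * h) ≤ partitionEntropy ν (pre m)) (I : Finset (List S)) :
    ∃ (F : Finset (Fin m → S)) (β : (Fin m → S) → Space A) (p : (Fin m → S) → ℝ),
      (∀ v ∈ F, pre m (β v) = v) ∧ (∀ v ∈ F, 0 < p v) ∧ ∑ v ∈ F, p v = 1 ∧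
      m * (h + ∫ x, ψ x ∂ν) - 2 * Real.log c - 2 ≤
        ∑ v ∈ F, p v * (-Real.log (p v) + birkhoff (shift A) ψ m (β v)) ∧
      ∀ w ∈ I, |∑ v ∈ F, p v * birkhoff (shift A) (ind A w) m (β v) -
        m * ν.real (cylinder A w)| ≤ w.length + 1 := by
  classical
  have hcpos : 0 < c := by linarith [hg.one_le]
  have hT : Measurable (shift A) := continuous_shift.measurable
  obtain ⟨x0⟩ : Nonempty (Space A) := nonempty_of_isProbabilityMeasure ν
  let β : (Fin m → S) → Space A := fun v => if h : ∃ z : Space A, pre m z = v then h.choose else x0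
  have hβ : ∀ v, (∃ z : Space A, pre m z = v) → pre m (β v) = v := by
    intro v hv
    simp only [β, dif_pos hv]
    exact hv.choose_spec
  set q : (Fin m → S) → ℝ := fun v => ν.real ((pre m : Space A → _) ⁻¹' {v}) with hq
  have hq0 : ∀ v, 0 ≤ q v := fun v => measureReal_nonneg
  have hqβ : ∀ v, 0 < q v → pre m (β v) = v := by
    intro v hv
    refine hβ v ?_
    by_contra hne
    have : (pre m : Space A → _) ⁻¹' {v} = ∅ := by
      ext z
      simp only [mem_preimage, mem_singleton_iff, mem_empty_iff_false, iff_false]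
      exact fun hz => hne ⟨z, hz⟩
    simp [hq, this] at hv
  have hmem : ∀ v, 0 < q v → ∀ z : Space A, pre m z = v → z ∈ cyl (β v) m := by
    intro v hv z hz
    rw [← pre_eq_iff, hqβ v hv, hz]
  have hintgr : ∀ {f : Space A → ℝ}, Integrable f ν → Integrable (birkhoff (shift A) f m) ν :=
    fun hf => integrable_birkhoff hν hT hf m
  -- comparison of cell integrals with point values
  have hcellψ : ∀ v, ∫ x in (pre m) ⁻¹' {v}, birkhoff (shift A) ψ m x ∂ν ≤
      q v * (birkhoff (shift A) ψ m (β v) + 2 * Real.log c) := by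
    intro v
    rcases (hq0 v).eq_or_lt with h0 | h0
    · have : ν ((pre m : Space A → _) ⁻¹' {v}) = 0 := by
        have := h0.symm
        rwa [hq, measureReal_eq_zero_iff] at this
      rw [Measure.restrict_eq_zero.2 this, ← h0]
      simp
    · calc _ ≤ ∫ x in (pre m) ⁻¹' {v}, (birkhoff (shift A) ψ m (β v) + 2 * Real.log c) ∂ν := by
            refine setIntegral_mono_on (hintgr hψ).integrableOn (integrable_const _)
              (measurableSet_pre m v) fun z hz => ?_
            have h1 := hg.exp_le_of_mem (x := z) (z := β v) (n := m) (by
              rw [← pre_eq_iff, hqβ v h0]; exact (show pre m z = v from hz).symm)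
            have h2 : c ^ 2 = Real.exp (2 * Real.log c) := by
              rw [two_mul, Real.exp_add, Real.exp_log hcpos, sq]
            rw [h2, ← Real.exp_add, Real.exp_le_exp] at h1
            linarith
        _ = _ := by simp [hq, measureReal_def]
  have hcellf : ∀ w v, |q v * birkhoff (shift A) (ind A w) m (β v) -
      ∫ x in (pre m) ⁻¹' {v}, birkhoff (shift A) (ind A w) m x ∂ν| ≤ w.length * q v := by
    intro w v
    rcases (hq0 v).eq_or_lt with h0 | h0
    · have : ν ((pre m : Space A → _) ⁻¹' {v}) = 0 := by
        have := h0.symm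
        rwa [hq, measureReal_eq_zero_iff] at this
      rw [Measure.restrict_eq_zero.2 this, ← h0]
      simp
    · have e : q v * birkhoff (shift A) (ind A w) m (β v) -
          ∫ x in (pre m) ⁻¹' {v}, birkhoff (shift A) (ind A w) m x ∂ν =
          ∫ x in (pre m) ⁻¹' {v}, (birkhoff (shift A) (ind A w) m (β v) -
            birkhoff (shift A) (ind A w) m x) ∂ν := by
        rw [integral_sub (integrable_const _) (hintgr (integrable_ind w ν)).integrableOn]
        simp [hq, measureReal_def]
      rw [e]
      have := norm_setIntegral_le_of_norm_le_const (μ := ν) (s := (pre m : Space A → _) ⁻¹' {v})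
        (C := (w.length : ℝ)) (f := fun x => birkhoff (shift A) (ind A w) m (β v) -
            birkhoff (shift A) (ind A w) m x) (measure_lt_top _ _) (fun z hz => by
          rw [Real.norm_eq_abs, abs_sub_comm]
          exact abs_birkhoff_ind_sub_le w (hmem v h0 z hz))
      simpa [Real.norm_eq_abs] using this
  -- limits along finite sets
  have hlimM : Tendsto (fun F : Finset (Fin m → S) => ∑ v ∈ F, q v) atTop (𝓝 1) := by
    have := hasSum_integral_pre ν (integrable_const (1 : ℝ)) m
    simpa [HasSum, hq, measureReal_def] using this
  have hlimB : Tendsto (fun F : Finset (Fin m → S) =>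
      ∑ v ∈ F, ∫ x in (pre m) ⁻¹' {v}, birkhoff (shift A) ψ m x ∂ν) atTop
      (𝓝 (m * ∫ x, ψ x ∂ν)) := by
    rw [← integral_birkhoff hν hT hψ hg.meas]
    exact hasSum_integral_pre ν (hintgr hψ) m
  have hlimC : ∀ w, Tendsto (fun F : Finset (Fin m → S) =>
      (∑ v ∈ F, ∫ x in (pre m) ⁻¹' {v}, birkhoff (shift A) (ind A w) m x ∂ν) / ∑ v ∈ F, q v) atTop
      (𝓝 (m * ν.real (cylinder A w))) := by
    intro w
    rw [← integral_ind, ← integral_birkhoff hν hT (integrable_ind w ν) (measurable_ind w)]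
    have := Tendsto.div (hasSum_integral_pre ν (hintgr (integrable_ind w ν)) m) hlimM one_ne_zero
    rw [div_one] at this
    exact this
  have hevA : ∀ᶠ F : Finset (Fin m → S) in atTop,
      m * h - 1 / 4 < ∑ v ∈ F, Real.negMulLog (q v) := by
    have hnn : ∀ v, 0 ≤ Real.negMulLog (q v) := fun v =>
      Real.negMulLog_nonneg (hq0 v) measureReal_le_one
    rcases lt_or_ge (m * h - 1 / 4) 0 with hneg | hpos
    · exact Eventually.of_forall fun F => hneg.trans_le (Finset.sum_nonneg fun v _ => hnn v)
    · rw [partitionEntropy_eq_negMulLog] at hH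
      have hlt : ENNReal.ofReal (m * h - 1 / 4) <
          ∑' v, ENNReal.ofReal (Real.negMulLog (q v)) :=
        ((ENNReal.ofReal_lt_ofReal_iff (by linarith)).2 (by linarith)).trans_le hH
      have hsum := ENNReal.summable (f := fun v => ENNReal.ofReal (Real.negMulLog (q v)))
      have := hsum.hasSum.eventually (lt_mem_nhds hlt)
      filter_upwards [this] with F hF
      rw [← ENNReal.ofReal_sum_of_nonneg fun v _ => hnn v] at hF
      exact (ENNReal.ofReal_lt_ofReal_iff_of_nonneg hpos).1 hF
  set K : ℝ := m * h + m * ∫ x, ψ x ∂ν with hK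
  have hevK : ∀ᶠ F : Finset (Fin m → S) in atTop,
      K - 1 / 2 - 1 < (K - 1 / 2) / (∑ v ∈ F, q v) + Real.log (∑ v ∈ F, q v) := by
    have : Tendsto (fun F : Finset (Fin m → S) =>
        (K - 1 / 2) / (∑ v ∈ F, q v) + Real.log (∑ v ∈ F, q v)) atTop
        (𝓝 ((K - 1 / 2) / 1 + Real.log 1)) :=
      (tendsto_const_nhds.div hlimM one_ne_zero).add
        ((Real.continuousAt_log one_ne_zero).tendsto.comp hlimM)
    refine this.eventually (lt_mem_nhds ?_)
    simp
  have hevB := hlimB.eventually (lt_mem_nhds (show m * ∫ x, ψ x ∂ν - 1 / 4 < m * ∫ x, ψ x ∂ν by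
    linarith))
  have hevM := hlimM.eventually (lt_mem_nhds (show (0 : ℝ) < 1 by norm_num))
  have hevC : ∀ᶠ F : Finset (Fin m → S) in atTop, ∀ w ∈ I,
      |(∑ v ∈ F, ∫ x in (pre m) ⁻¹' {v}, birkhoff (shift A) (ind A w) m x ∂ν) / (∑ v ∈ F, q v) -
        m * ν.real (cylinder A w)| < 1 := by
    rw [Filter.eventually_all_finset]
    intro w _
    have := (hlimC w).eventually (Metric.ball_mem_nhds _ one_pos)
    simpa [Real.dist_eq] using this
  obtain ⟨F, hFA, hFK, hFB, hFM, hFC⟩ := (hevA.and (hevK.and (hevB.and (hevM.and hevC)))).exists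
  set M := ∑ v ∈ F, q v with hM
  have hfilter : ∀ G : (Fin m → S) → ℝ, (∀ v, q v = 0 → G v = 0) →
      ∑ v ∈ F.filter (fun v => 0 < q v), G v = ∑ v ∈ F, G v := by
    intro G hG
    refine Finset.sum_subset (Finset.filter_subset _ _) fun v hv hv' => hG v ?_
    have : ¬ 0 < q v := fun h => hv' (Finset.mem_filter.2 ⟨hv, h⟩)
    exact le_antisymm (not_lt.1 this) (hq0 v)
  refine ⟨F.filter (fun v => 0 < q v), β, fun v => q v / M, fun v hv =>
    hqβ v (Finset.mem_filter.1 hv).2, fun v hv => div_pos (Finset.mem_filter.1 hv).2 hFM, ?_, ?_,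
    fun w hw => ?_⟩
  · rw [hfilter _ fun v hv => by simp [hv], ← Finset.sum_div, ← hM, div_self hFM.ne']
  · rw [hfilter _ fun v hv => by simp [hv]]
    have e : ∀ v ∈ F, q v / M * (-Real.log (q v / M) + birkhoff (shift A) ψ m (β v)) =
        (Real.negMulLog (q v) + q v * birkhoff (shift A) ψ m (β v)) / M +
          q v * (Real.log M / M) := by
      intro v _
      rcases (hq0 v).eq_or_lt with h0 | h0
      · simp [← h0]
      · rw [Real.log_div h0.ne' hFM.ne', Real.negMulLog]
        field_simp
        ring
    rw [Finset.sum_congr rfl e, Finset.sum_add_distrib, ← Finset.sum_div, ← Finset.sum_mul, ← hM,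
      Finset.sum_add_distrib, mul_div_cancel₀ _ hFM.ne']
    have h1 := Finset.sum_le_sum fun v (_ : v ∈ F) => hcellψ v
    simp only [mul_add, Finset.sum_add_distrib, ← Finset.sum_mul] at h1
    rw [← hM] at h1
    have h2 : (K - 1 / 2 - M * (2 * Real.log c)) / M ≤
        (∑ v ∈ F, Real.negMulLog (q v) + ∑ v ∈ F, q v * birkhoff (shift A) ψ m (β v)) / M := by
      refine div_le_div_of_nonneg_right ?_ hFM.le
      linarith
    rw [sub_div, mul_div_cancel_left₀ _ hFM.ne'] at h2
    have h3 : (m : ℝ) * (h + ∫ x, ψ x ∂ν) = K := by rw [hK]; ring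
    rw [h3]
    linarith
  · rw [hfilter _ fun v hv => by simp [hv]]
    have e : ∑ v ∈ F, q v / M * birkhoff (shift A) (ind A w) m (β v) =
        (∑ v ∈ F, q v * birkhoff (shift A) (ind A w) m (β v)) / M := by
      rw [Finset.sum_div]
      exact Finset.sum_congr rfl fun v _ => by ring
    have h1 : |(∑ v ∈ F, q v * birkhoff (shift A) (ind A w) m (β v)) -
        ∑ v ∈ F, ∫ x in (pre m) ⁻¹' {v}, birkhoff (shift A) (ind A w) m x ∂ν| ≤ w.length * M := by
      rw [← Finset.sum_sub_distrib, hM, Finset.mul_sum]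
      exact (Finset.abs_sum_le_sum_abs _ _).trans (Finset.sum_le_sum fun v _ => hcellf w v)
    have h2 : |(∑ v ∈ F, q v * birkhoff (shift A) (ind A w) m (β v)) / M -
        (∑ v ∈ F, ∫ x in (pre m) ⁻¹' {v}, birkhoff (shift A) (ind A w) m x ∂ν) / M| ≤ w.length := by
      rw [← sub_div, abs_div, abs_of_pos hFM, div_le_iff₀ hFM]
      exact h1
    rw [e]
    exact (abs_sub_le _ _ _).trans (add_le_add h2 (hFC w hw).le)

end FiniteApprox

lemma sum_le_Zfn {X B : Type*} [MeasurableSpace X] {T : X → X} (ψ : X → ℝ) (n : ℕ) {C : Set X}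
    (s : Finset B) (z : B → X) (hz : ∀ b ∈ s, z b ∈ C) (hinj : InjOn z s) :
    ENNReal.ofReal (∑ b ∈ s, Real.exp (birkhoff T ψ n (z b))) ≤ Zfn T ψ n C := by
  rw [ENNReal.ofReal_sum_of_nonneg fun _ _ => (Real.exp_pos _).le, ← Finset.sum_coe_sort,
    ← tsum_fintype (L := .unconditional _)]
  exact ENNReal.tsum_comp_le_tsum_of_injective
    (f := fun b : s => (⟨z b, hz b b.2⟩ : C))
    (fun a b h => Subtype.ext (hinj a.2 b.2 (congrArg Subtype.val h)))
    (fun x : C => ENNReal.ofReal (Real.exp (birkhoff T ψ n x)))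

section Chain

variable {S : Type*} [Countable S] [TopologicalSpace S] [DiscreteTopology S] {A : S → S → Prop}
variable {ψ : Space A → ℝ} {μ : Measure (Space A)} {c κ : ℝ} {N : ℕ} {ι : Type*}

/-- Iterated gluing of the orbit segments given by `β ∘ b` in front of the point `y`. -/
def chain (gl : Space A → Space A → Space A) (β : ι → Space A) (y : Space A) :
    (k : ℕ) → (Fin k → ι) → Space A
  | 0, _ => y
  | k + 1, b => gl (β (b 0)) (chain gl β y k (Fin.tail b))

variable {gl : Space A → Space A → Space A} {m : ℕ} (β : ι → Space A) (y : Space A)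

lemma shift_iterate_chain (hs : ∀ x x', (shift A)^[m + N] (gl x x') = x') (k : ℕ) (b : Fin k → ι) :
    (shift A)^[k * (m + N)] (chain gl β y k b) = y := by
  induction k with
  | zero => simp [chain]
  | succ k ih =>
    rw [Nat.succ_mul, Function.iterate_add_apply, chain, hs, ih]

lemma chain_injective (hs : ∀ x x', (shift A)^[m + N] (gl x x') = x')
    (hm : ∀ x x', gl x x' ∈ cyl x m) (hβ : ∀ a a', pre m (β a) = pre m (β a') → a = a') (k : ℕ) :
    Function.Injective (chain gl β y k) := by
  induction k with
  | zero => exact fun b b' _ => Subsingleton.elim _ _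
  | succ k ih =>
    intro b b' h
    simp only [chain] at h
    have h1 : b 0 = b' 0 := by
      refine hβ _ _ ?_
      rw [← pre_eq_iff.2 (hm (β (b 0)) (chain gl β y k (Fin.tail b))), h, pre_eq_iff.2 (hm _ _)]
    have h2 : Fin.tail b = Fin.tail b' := by
      refine ih ?_
      rw [← hs (β (b 0)) (chain gl β y k (Fin.tail b)), h, hs]
    rw [← Fin.cons_self_tail b, ← Fin.cons_self_tail b', h1, h2]

lemma le_exp_birkhoff_chain (hs : ∀ x x', (shift A)^[m + N] (gl x x') = x')
    (hκ0 : 0 ≤ κ) (hκ : ∀ x x', κ * Real.exp (birkhoff (shift A) ψ m x) ≤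
      Real.exp (birkhoff (shift A) ψ (m + N) (gl x x'))) (k : ℕ) (b : Fin k → ι) :
    κ ^ k * Real.exp (∑ i, birkhoff (shift A) ψ m (β (b i))) ≤
      Real.exp (birkhoff (shift A) ψ (k * (m + N)) (chain gl β y k b)) := by
  induction k with
  | zero => simp [birkhoff_zero]
  | succ k ih =>
    rw [Nat.succ_mul, add_comm (k * _), birkhoff_add, chain, hs, Real.exp_add, Fin.sum_univ_succ,
      Real.exp_add, pow_succ]
    calc _ = (κ * Real.exp (birkhoff (shift A) ψ m (β (b 0)))) *
          (κ ^ k * Real.exp (∑ i, birkhoff (shift A) ψ m (β (Fin.tail b i)))) := by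
            simp only [Fin.tail]; ring
      _ ≤ _ := mul_le_mul (hκ _ _) (ih _) (by positivity) (Real.exp_pos _).le

lemma abs_birkhoff_glue_le {w : List S} {x z : Space A} (h : z ∈ cyl x m) :
    |birkhoff (shift A) (ind A w) (m + N) z - birkhoff (shift A) (ind A w) m x| ≤
      w.length + N := by
  rw [birkhoff_add]
  have h1 := abs_birkhoff_ind_sub_le w h
  have h2 := birkhoff_nonneg_le (ind_nonneg w) (ind_le_one w) N ((shift A)^[m] z)
  rw [abs_le] at h1 ⊢
  constructor <;> linarith [h1.1, h1.2, h2.1, h2.2]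

lemma abs_birkhoff_chain_sub_le (hs : ∀ x x', (shift A)^[m + N] (gl x x') = x')
    (hm : ∀ x x', gl x x' ∈ cyl x m) (w : List S) (k : ℕ) (b : Fin k → ι) :
    |birkhoff (shift A) (ind A w) (k * (m + N)) (chain gl β y k b) -
      ∑ i, birkhoff (shift A) (ind A w) m (β (b i))| ≤ k * (w.length + N) := by
  induction k with
  | zero => simp [birkhoff_zero]
  | succ k ih =>
    rw [Nat.succ_mul, add_comm (k * _), birkhoff_add, chain, hs, Fin.sum_univ_succ]
    have h1 := abs_birkhoff_glue_le (N := N) (w := w)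
      (hm (β (b 0)) (chain gl β y k (Fin.tail b)))
    have h2 := ih (Fin.tail b)
    simp only [Fin.tail] at h1 h2 ⊢
    push_cast
    rw [abs_le] at h1 h2 ⊢
    constructor <;> linarith [h1.1, h1.2, h2.1, h2.2]

end Chain

section LowerBound

variable {S : Type*} [Countable S] [TopologicalSpace S] [DiscreteTopology S] {A : S → S → Prop}
variable {ψ : Space A → ℝ} {μ : Measure (Space A)} {c κ : ℝ} {N : ℕ}

lemma GibbsData.eventually_le_Zfn (hg : GibbsData ψ μ c κ N) (y : Space A)
    (ν : ProbabilityMeasure (Space A)) (hν : Invariant (shift A) (ν : Measure (Space A)))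
    (hψ : Integrable ψ (ν : Measure (Space A))) {h : ℝ}
    (hh : ∀ᶠ m : ℕ in atTop, ENNReal.ofReal (m * h) ≤
      partitionEntropy (ν : Measure (Space A)) (pre m))
    {G : Set (ProbabilityMeasure (Space A))} (hG : IsOpen G) (hνG : ν ∈ G) {η : ℝ} (hη : 0 < η) :
    ∀ᶠ n : ℕ in atTop,
      ENNReal.ofReal (Real.exp (n * (h + ∫ x, ψ x ∂(ν : Measure (Space A)) - η))) ≤
      Zfn (shift A) ψ n (preimSet (shift A) n y ∩ {x | empirical (shift A) x n ∈ G}) := by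
  classical
  have hκ := hg.κ_pos
  obtain ⟨I, ε, hε, hI⟩ := exists_cylinder_nbhd hG hνG
  set e : ℝ := h + ∫ x, ψ x ∂(ν : Measure (Space A)) with he
  set C1 : ℝ := 2 * Real.log c + 3 - Real.log κ with hC1
  set L : ℕ := ∑ w ∈ I, w.length with hL
  have hlen : ∀ w ∈ I, (w.length : ℝ) ≤ L := fun w hw => by
    exact_mod_cast Finset.single_le_sum (f := fun w : List S => w.length)
        (fun _ _ => Nat.zero_le _) hw
  -- choice of the block length
  have hm1 := (tendsto_natCast_atTop_atTop (R := ℝ)).eventually_ge_atTop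
    ((N * |e| + |C1|) * 2 / η)
  have hm2 := (tendsto_natCast_atTop_atTop (R := ℝ)).eventually_gt_atTop
    ((2 * L + 2 * N + 2) * 2 / ε)
  obtain ⟨m, hmh, hm0, hm1, hm2⟩ := (hh.and ((eventually_ge_atTop 1).and (hm1.and hm2))).exists
  rw [div_le_iff₀ hη] at hm1
  rw [div_lt_iff₀ hε] at hm2
  obtain ⟨F, β, p, hβ, hp0, hp1, hD, hw⟩ := hg.exists_finite_approx _ hν hψ hmh I
  have hβinj : ∀ a a' : F, pre m (β a) = pre m (β a') → a = a' := fun a a' h => by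
    rw [hβ a a.2, hβ a' a'.2] at h
    exact Subtype.ext h
  choose gl hglm hgls hglκ using hg.glue m hm0
  have hpre : ∀ r : ℕ, ∃ z : Space A, N + 1 ≤ r → (shift A)^[r] z = y := by
    intro r
    by_cases hr : N + 1 ≤ r
    · obtain ⟨z, -, hz, -⟩ := hg.glue (r - N) (by omega) y y
      exact ⟨z, fun _ => by rwa [Nat.sub_add_cancel (by omega)] at hz⟩
    · exact ⟨y, fun h => absurd h hr⟩
  choose yr hyr using hpre
  set T := m + N with hT
  set R := N + 1 + T with hR
  set C2 : ℝ := ∑ r ∈ Finset.range R, |birkhoff (shift A) ψ r (yr r)| with hC2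
  have hC2r : ∀ r < R, -C2 ≤ birkhoff (shift A) ψ r (yr r) := fun r hr =>
    (neg_le_neg (Finset.single_le_sum (f := fun r => |birkhoff (shift A) ψ r (yr r)|)
      (fun _ _ => abs_nonneg _) (Finset.mem_range.2 hr))).trans (neg_abs_le _)
  -- large deviations from the mean are excluded
  let u : Option (List S) → F → ℝ := fun j => j.elim
    (fun a => -Real.log (p a) + birkhoff (shift A) ψ m (β a))
    (fun w a => birkhoff (shift A) (ind A w) m (β a))
  have hp1' : ∑ a : F, p a = 1 := by rw [Finset.sum_coe_sort F p, hp1]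
  have hwlln := eventually_half_le_sum_prod (p := fun a : F => p a) (fun a => (hp0 a a.2).le) hp1'
    (insert none (I.image some)) u one_pos
  obtain ⟨k0, hk0⟩ := eventually_atTop.1 hwlln
  have hn1 := (tendsto_natCast_atTop_atTop (R := ℝ)).eventually_ge_atTop
    ((R * |e| + C2 + Real.log 2) * 2 / η)
  have hn2 := (tendsto_natCast_atTop_atTop (R := ℝ)).eventually_gt_atTop ((2 * R) * 2 / ε)
  filter_upwards [hn1, hn2, eventually_ge_atTop (N + 1 + k0 * T)] with n hn1 hn2 hn
  rw [div_le_iff₀ hη] at hn1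
  rw [div_lt_iff₀ hε] at hn2
  have hTpos : 0 < T := by omega
  obtain ⟨k, r, hnk, hr1, hr2, hk⟩ : ∃ k r, n = k * T + r ∧ N + 1 ≤ r ∧ r < R ∧ k0 ≤ k := by
    refine ⟨(n - (N + 1)) / T, N + 1 + (n - (N + 1)) % T, ?_, by omega, ?_, ?_⟩
    · have := Nat.div_add_mod' (n - (N + 1)) T
      omega
    · have := Nat.mod_lt (n - (N + 1)) hTpos
      omega
    · rw [Nat.le_div_iff_mul_le hTpos]
      omega
  have hnR : (n : ℝ) = k * (m + N) + r := by rw [hnk, hT]; push_cast; ring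
  have hrR : (r : ℝ) ≤ R := by exact_mod_cast hr2.le
  have hkm : (k : ℝ) * m ≤ n := by
    rw [hnR]
    have : (0 : ℝ) ≤ k * N := by positivity
    have : (0 : ℝ) ≤ r := by positivity
    linarith
  have hnpos : (0 : ℝ) < n := by
    have : 0 < n := by omega
    exact_mod_cast this
  set s := Finset.univ.filter fun b : Fin k → F => ∀ j ∈ insert none (I.image some),
    |∑ i, u j (b i) - k * ∑ a : F, p a * u j a| ≤ k * 1 with hs
  have hhalf := hk0 k hk
  set z : (Fin k → F) → Space A := chain gl (fun a : F => β a) (yr r) k with hz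
  have hzr : ∀ b, (shift A)^[k * T] (z b) = yr r := shift_iterate_chain _ _ hgls k
  have hzinj : Function.Injective z := chain_injective _ _ hgls hglm hβinj k
  have hzmem : ∀ b ∈ s, z b ∈ preimSet (shift A) n y ∩ {x | empirical (shift A) x n ∈ G} := by
    intro b hb
    refine ⟨?_, hI _ fun w hwI => ?_⟩
    · change (shift A)^[n] (z b) = y
      rw [hnk, add_comm, Function.iterate_add_apply, hzr, hyr r hr1]
    · rw [empirical_real _ (by omega) (isClopen_cylinder w).2.measurableSet]
      change |(n : ℝ)⁻¹ * birkhoff (shift A) (ind A w) n (z b) - _| < ε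
      set q := (ν : Measure (Space A)).real (cylinder A w) with hq
      have hq0 : 0 ≤ q := measureReal_nonneg
      have hq1 : q ≤ 1 := measureReal_le_one
      have hb1 := (Finset.mem_filter.1 hb).2 (some w) (by simp [hwI])
      have e1 : ∑ a : F, p a * u (some w) a =
          ∑ v ∈ F, p v * birkhoff (shift A) (ind A w) m (β v) :=
        Finset.sum_coe_sort F fun v => p v * birkhoff (shift A) (ind A w) m (β v)
      rw [e1] at hb1
      simp only [u, Option.elim] at hb1
      have h1 := hw w hwI
      have h2 := abs_birkhoff_chain_sub_le (fun a : F => β a) (yr r) hgls hglm w k b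
      have h3 := birkhoff_nonneg_le (ind_nonneg w) (ind_le_one w) r (yr r)
      have h4 : birkhoff (shift A) (ind A w) n (z b) =
          birkhoff (shift A) (ind A w) (k * T) (z b) + birkhoff (shift A) (ind A w) r (yr r) := by
        rw [hnk, birkhoff_add, hzr]
      have hl := hlen w hwI
      have hk0' : (0 : ℝ) ≤ k := by positivity
      have h1' : |k * ∑ v ∈ F, p v * birkhoff (shift A) (ind A w) m (β v) - k * (m * q)| ≤
          k * (w.length + 1) := by
        rw [← mul_sub, abs_mul, abs_of_nonneg hk0']
        exact mul_le_mul_of_nonneg_left h1 hk0'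
      have hkl : (k : ℝ) * w.length ≤ k * L := mul_le_mul_of_nonneg_left hl hk0'
      have hkNq : (k : ℝ) * N * q ≤ k * N := mul_le_of_le_one_right (by positivity) hq1
      have hkNq0 : 0 ≤ (k : ℝ) * N * q := by positivity
      have hrq : (r : ℝ) * q ≤ r := mul_le_of_le_one_right (by positivity) hq1
      have hrq0 : 0 ≤ (r : ℝ) * q := by positivity
      have hnq : (n : ℝ) * q = k * (m * q) + k * N * q + r * q := by rw [hnR]; ring
      have hmain : |birkhoff (shift A) (ind A w) n (z b) - n * q| ≤
          k * (2 * L + 2 * N + 2) + 2 * r := by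
        rw [h4, hnq]
        rw [abs_le] at h1' h2 hb1 ⊢
        constructor <;> linarith [h1'.1, h1'.2, h2.1, h2.2, h3.1, h3.2, hb1.1, hb1.2]
      have hlt : |birkhoff (shift A) (ind A w) n (z b) - n * q| < n * ε := by
        have a1 : k * (2 * (L : ℝ) + 2 * N + 2) * 2 ≤ n * ε := by
          calc k * (2 * (L : ℝ) + 2 * N + 2) * 2 = k * ((2 * L + 2 * N + 2) * 2) := by ring
            _ ≤ k * (m * ε) := mul_le_mul_of_nonneg_left hm2.le hk0'
            _ = k * m * ε := by ring
            _ ≤ n * ε := mul_le_mul_of_nonneg_right hkm hε.le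
        linarith
      have e2 : (n : ℝ)⁻¹ * birkhoff (shift A) (ind A w) n (z b) - q =
          (n : ℝ)⁻¹ * (birkhoff (shift A) (ind A w) n (z b) - n * q) := by
        field_simp
      rw [e2, abs_mul, abs_of_pos (inv_pos.2 hnpos), inv_mul_lt_iff₀ hnpos]
      exact hlt
  refine le_trans (ENNReal.ofReal_le_ofReal ?_) (sum_le_Zfn ψ n s z hzmem hzinj.injOn)
  have hk0' : (0 : ℝ) ≤ k := by positivity
  set D : ℝ := ∑ v ∈ F, p v * (-Real.log (p v) + birkhoff (shift A) ψ m (β v)) with hDdef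
  have hterm : ∀ b ∈ s, Real.exp (k * (D - 1 + Real.log κ) - C2) * ∏ i, p (b i) ≤
      Real.exp (birkhoff (shift A) ψ n (z b)) := by
    intro b hb
    have h1 := le_exp_birkhoff_chain (fun a : F => β a) (yr r) hgls hκ.le hglκ k b
    have h2 := (Finset.mem_filter.1 hb).2 none (by simp)
    have e1 : ∑ a : F, p a * u none a = D :=
      Finset.sum_coe_sort F fun v => p v * (-Real.log (p v) + birkhoff (shift A) ψ m (β v))
    rw [e1] at h2
    simp only [u, Option.elim, Finset.sum_add_distrib, Finset.sum_neg_distrib] at h2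
    have h3 : ∏ i, p (b i) = Real.exp (∑ i, Real.log (p (b i))) := by
      rw [Real.exp_sum]
      exact Finset.prod_congr rfl fun i _ => (Real.exp_log (hp0 _ (b i).2)).symm
    have h4 : κ ^ k = Real.exp (k * Real.log κ) := by
      rw [Real.exp_nat_mul, Real.exp_log hκ]
    rw [hnk, birkhoff_add, hzr, h3, ← Real.exp_add, Real.exp_le_exp]
    rw [h4, ← Real.exp_add, Real.exp_le_exp] at h1
    have h5 := hC2r r hr2
    have h6 := (abs_le.1 h2).1
    linarith
  have hsum : Real.exp (k * (D - 1 + Real.log κ) - C2) * (1 / 2) ≤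
      ∑ b ∈ s, Real.exp (birkhoff (shift A) ψ n (z b)) := by
    calc _ ≤ Real.exp (k * (D - 1 + Real.log κ) - C2) * ∑ b ∈ s, ∏ i, p (b i) :=
          mul_le_mul_of_nonneg_left hhalf (Real.exp_pos _).le
      _ = ∑ b ∈ s, Real.exp (k * (D - 1 + Real.log κ) - C2) * ∏ i, p (b i) := Finset.mul_sum ..
      _ ≤ _ := Finset.sum_le_sum hterm
  refine le_trans ?_ hsum
  have hlog2 : (1 / 2 : ℝ) = Real.exp (-Real.log 2) := by
    rw [Real.exp_neg, Real.exp_log two_pos]; norm_num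
  rw [hlog2, ← Real.exp_add, Real.exp_le_exp]
  have a1 : (k : ℝ) * (m * e - C1) ≤ k * (D - 1 + Real.log κ) := by
    refine mul_le_mul_of_nonneg_left ?_ hk0'
    rw [hC1]; linarith
  have a2 : k * (N * |e| + |C1|) * 2 ≤ n * η := by
    calc k * (N * |e| + |C1|) * 2 = k * ((N * |e| + |C1|) * 2) := by ring
      _ ≤ k * (m * η) := mul_le_mul_of_nonneg_left hm1 hk0'
      _ = k * m * η := by ring
      _ ≤ n * η := mul_le_mul_of_nonneg_right hkm hη.le
  have a3 : (n : ℝ) * e = k * (m * e) + k * N * e + r * e := by rw [hnR]; ring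
  have a4 : (k : ℝ) * N * e ≤ k * N * |e| :=
      mul_le_mul_of_nonneg_left (le_abs_self e) (by positivity)
  have a5 : (r : ℝ) * e ≤ R * |e| :=
    (mul_le_mul_of_nonneg_left (le_abs_self e) (by positivity)).trans
      (mul_le_mul_of_nonneg_right hrR (abs_nonneg e))
  have a6 : (k : ℝ) * C1 ≤ k * |C1| := mul_le_mul_of_nonneg_left (le_abs_self C1) hk0'
  linarith

end LowerBound

section Tower

variable {Ω X : Type*} [MeasurableSpace Ω] [MeasurableSpace X]

/-- The average over one period of the images of a measure along an orbit. -/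
noncomputable def tower (T : X → X) (Q : Measure Ω) (Φ : Ω → X) (t : ℕ) : Measure X :=
  (t : ℝ≥0∞)⁻¹ • ∑ i ∈ Finset.range t, Q.map (fun b => T^[i] (Φ b))

variable {T : X → X} {Q : Measure Ω} {Φ : Ω → X} {t : ℕ}

lemma measurable_orbit (hT : Measurable T) (hΦ : Measurable Φ) (i : ℕ) :
    Measurable fun b => T^[i] (Φ b) := (hT.iterate i).comp hΦ

lemma tower_apply (hT : Measurable T) (hΦ : Measurable Φ) {D : Set X} (hD : MeasurableSet D) :
    tower T Q Φ t D = (t : ℝ≥0∞)⁻¹ * ∑ i ∈ Finset.range t, Q ((fun b => T^[i] (Φ b)) ⁻¹' D) := by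
  rw [tower, Measure.smul_apply, Measure.finsetSum_apply, smul_eq_mul]
  congr 1
  exact Finset.sum_congr rfl fun i _ => Measure.map_apply (measurable_orbit hT hΦ i) hD

lemma isProbabilityMeasure_tower [IsProbabilityMeasure Q] (hT : Measurable T) (hΦ : Measurable Φ)
    (ht : 1 ≤ t) : IsProbabilityMeasure (tower T Q Φ t) := by
  refine ⟨?_⟩
  rw [tower_apply hT hΦ MeasurableSet.univ]
  simp only [preimage_univ, measure_univ, Finset.sum_const, Finset.card_range,
      nsmul_eq_mul, mul_one]
  exact ENNReal.inv_mul_cancel (by exact_mod_cast (by omega : t ≠ 0)) (ENNReal.natCast_ne_top t)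

lemma tower_real [IsProbabilityMeasure Q] (hT : Measurable T) (hΦ : Measurable Φ) {D : Set X}
    (hD : MeasurableSet D) :
    (tower T Q Φ t).real D =
      ∑ i ∈ Finset.range t, (t : ℝ)⁻¹ * (Q.map (fun b => T^[i] (Φ b))).real D := by
  rw [measureReal_def, tower_apply hT hΦ hD, ENNReal.toReal_mul, ENNReal.toReal_inv,
    ENNReal.toReal_natCast, ENNReal.toReal_sum fun _ _ => measure_ne_top _ _, Finset.mul_sum]
  refine Finset.sum_congr rfl fun i _ => ?_
  rw [measureReal_def, Measure.map_apply (measurable_orbit hT hΦ i) hD]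

lemma invariant_tower (hT : Measurable T) (hΦ : Measurable Φ) {θ : Ω → Ω}
    (hθ : MeasurePreserving θ Q Q) (h : ∀ b, T^[t] (Φ b) = Φ (θ b)) :
    Invariant T (tower T Q Φ t) := by
  have hmap : ∀ i, Measure.map T (Q.map (fun b => T^[i] (Φ b))) =
      Q.map (fun b => T^[i + 1] (Φ b)) := by
    intro i
    rw [Measure.map_map hT (measurable_orbit hT hΦ i)]
    congr 1
    funext b
    simp only [Function.comp, Function.iterate_succ_apply']
  have hper : Q.map (fun b => T^[t] (Φ b)) = Q.map (fun b => T^[0] (Φ b)) := by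
    have : (fun b => T^[t] (Φ b)) = Φ ∘ θ := funext h
    rw [this, ← Measure.map_map hΦ hθ.measurable, hθ.map_eq]
    rfl
  have hsum : ∑ i ∈ Finset.range t, Q.map (fun b => T^[i + 1] (Φ b)) =
      ∑ i ∈ Finset.range t, Q.map (fun b => T^[i] (Φ b)) := by
    rcases t with _ | t
    · simp
    · rw [Finset.sum_range_succ, hper,
        Finset.sum_range_succ' (fun i => Q.map (fun b => T^[i] (Φ b)))]
  unfold Invariant tower
  have hadd : Measure.map T (∑ i ∈ Finset.range t, Q.map (fun b => T^[i] (Φ b))) =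
      ∑ i ∈ Finset.range t, Measure.map T (Q.map (fun b => T^[i] (Φ b))) := by
    ext D hD
    simp only [Measure.map_apply hT hD, Measure.finsetSum_apply]
  rw [Measure.map_smul, hadd, Finset.sum_congr rfl fun i _ => hmap i, hsum]

lemma integrable_comp_orbit [IsProbabilityMeasure Q] (hT : Measurable T) (hΦ : Measurable Φ)
    {f : X → ℝ} (hf : Measurable f) {C : ℝ} (hC : ∀ b i, |f (T^[i] (Φ b))| ≤ C) (i : ℕ) :
    Integrable (fun b => f (T^[i] (Φ b))) Q :=
  Integrable.of_bound (C := C) (hf.comp (measurable_orbit hT hΦ i)).aestronglyMeasurable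
    (Eventually.of_forall fun b => by simpa using hC b i)

lemma integrable_tower [IsProbabilityMeasure Q] (hT : Measurable T) (hΦ : Measurable Φ)
    (ht : 1 ≤ t) {f : X → ℝ} (hf : Measurable f) {C : ℝ} (hC : ∀ b i, |f (T^[i] (Φ b))| ≤ C) :
    Integrable f (tower T Q Φ t) := by
  refine Integrable.smul_measure ?_ (by simpa using (by omega : t ≠ 0))
  rw [integrable_finsetSum_measure]
  intro i _
  rw [integrable_map_measure hf.aestronglyMeasurable (measurable_orbit hT hΦ i).aemeasurable]
  exact integrable_comp_orbit hT hΦ hf hC i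

lemma integral_tower [IsProbabilityMeasure Q] (hT : Measurable T) (hΦ : Measurable Φ)
    {f : X → ℝ} (hf : Measurable f) {C : ℝ} (hC : ∀ b i, |f (T^[i] (Φ b))| ≤ C) :
    ∫ x, f x ∂(tower T Q Φ t) = (t : ℝ)⁻¹ * ∫ b, birkhoff T f t (Φ b) ∂Q := by
  rw [tower, integral_smul_measure, integral_finsetSum_measure]
  · simp only [birkhoff]
    rw [integral_finsetSum _ fun i _ => integrable_comp_orbit hT hΦ hf hC i]
    simp only [ENNReal.toReal_inv, ENNReal.toReal_natCast, smul_eq_mul]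
    congr 1
    exact Finset.sum_congr rfl fun i _ => integral_map (measurable_orbit hT hΦ i).aemeasurable
      hf.aestronglyMeasurable
  · intro i _
    rw [integrable_map_measure hf.aestronglyMeasurable (measurable_orbit hT hΦ i).aemeasurable]
    exact integrable_comp_orbit hT hΦ hf hC i

lemma partitionEntropy_map {α : Type*} {f : Ω → X} (hf : Measurable f) {g : X → α}
    (hg : ∀ a, MeasurableSet (g ⁻¹' {a})) :
    partitionEntropy (Q.map f) g = partitionEntropy Q (g ∘ f) := by
  unfold partitionEntropy
  refine tsum_congr fun a => ?_
  rw [Measure.map_apply hf (hg a)]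
  rfl

lemma le_partitionEntropy_tower [IsProbabilityMeasure Q] (hT : Measurable T) (hΦ : Measurable Φ)
    (ht : 1 ≤ t) {α : Type*} {g : X → α} (hg : ∀ a, MeasurableSet (g ⁻¹' {a})) {e : ℝ≥0∞}
    (he : ∀ i < t, e ≤ partitionEntropy Q (fun b => g (T^[i] (Φ b)))) :
    e ≤ partitionEntropy (tower T Q Φ t) g := by
  have htpos : (0 : ℝ) < t := by exact_mod_cast ht
  have hm : ∀ i, Measurable fun b => T^[i] (Φ b) := measurable_orbit hT hΦ
  have := fun i => Measure.isProbabilityMeasure_map (μ := Q) (hm i).aemeasurable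
  refine le_trans ?_ (sum_mul_partitionEntropy_le (Finset.range t) (fun _ => (t : ℝ)⁻¹)
    (fun _ _ => by positivity) (by simp [htpos.ne'])
    (fun i => Q.map (fun b => T^[i] (Φ b))) _ g fun a => tower_real hT hΦ (hg a))
  calc e = ∑ i ∈ Finset.range t, ENNReal.ofReal ((t : ℝ)⁻¹) * e := by
        rw [Finset.sum_const, Finset.card_range, nsmul_eq_mul, ← mul_assoc,
          ENNReal.ofReal_inv_of_pos htpos, ENNReal.ofReal_natCast, ENNReal.mul_inv_cancel _
            (ENNReal.natCast_ne_top t), one_mul]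
        exact_mod_cast (by omega : t ≠ 0)
    _ ≤ _ := Finset.sum_le_sum fun i hi => by
        refine mul_le_mul' le_rfl ?_
        rw [partitionEntropy_map (hm i) hg]
        exact he i (Finset.mem_range.1 hi)

end Tower

section Bernoulli

variable {d : ℕ}

/-- The measure with weights `p` on `Fin d`. -/
noncomputable def weights (p : Fin d → ℝ) : Measure (Fin d) :=
  ∑ a, ENNReal.ofReal (p a) • Measure.dirac a

lemma weights_singleton (p : Fin d → ℝ) (a : Fin d) : weights p {a} = ENNReal.ofReal (p a) := by
  classical
  simp [weights, Measure.finsetSum_apply, indicator, Finset.sum_ite_eq,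
    eq_comm]

lemma isProbabilityMeasure_weights {p : Fin d → ℝ} (hp0 : ∀ a, 0 ≤ p a) (hp1 : ∑ a, p a = 1) :
    IsProbabilityMeasure (weights p) := by
  refine ⟨?_⟩
  simp [weights, Measure.finsetSum_apply, ← ENNReal.ofReal_sum_of_nonneg fun a _ => hp0 a, hp1]

/-- The Bernoulli measure with weights `p`. -/
noncomputable def bernoulli (p : Fin d → ℝ) : Measure (ℕ → Fin d) :=
  Measure.infinitePi fun _ => weights p

lemma measurePreserving_bernoulli {p : Fin d → ℝ} [IsProbabilityMeasure (weights p)] :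
    MeasurePreserving (fun (b : ℕ → Fin d) i => b (i + 1)) (bernoulli p) (bernoulli p) := by
  have hm : Measurable (fun (b : ℕ → Fin d) i => b (i + 1)) := by fun_prop
  refine ⟨hm, ?_⟩
  refine Measure.eq_infinitePi _ fun s t ht => ?_
  rw [Measure.map_apply hm (MeasurableSet.pi s.countable_toSet fun i _ => ht i)]
  have : (fun (b : ℕ → Fin d) i => b (i + 1)) ⁻¹' (Set.pi s t) =
      Set.pi (s.map ⟨Nat.succ, Nat.succ_injective⟩) fun i => t (i - 1) := by
    ext b
    simp [Set.mem_pi]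
  rw [this, bernoulli, Measure.infinitePi_pi _ fun i _ => ht _, Finset.prod_map]
  simp

lemma bernoulli_real_preimage {p : Fin d → ℝ} [IsProbabilityMeasure (weights p)]
    (hp0 : ∀ a, 0 ≤ p a) (k : ℕ) (v : Fin k → Fin d) :
    (bernoulli p).real ((fun (b : ℕ → Fin d) (i : Fin k) => b (i + 1)) ⁻¹' {v}) =
      ∏ i, p (v i) := by
  let t : ℕ → Set (Fin d) := fun j => if h : j - 1 < k ∧ 1 ≤ j then {v ⟨j - 1, h.1⟩} else univ
  have ht : ∀ j (hj : j < k), t (j + 1) = {v ⟨j, hj⟩} := by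
    intro j hj
    simp [t, hj]
  have : (fun (b : ℕ → Fin d) (i : Fin k) => b (i + 1)) ⁻¹' {v} =
      Set.pi (Finset.range (k + 1) : Finset ℕ) t := by
    ext b
    simp only [mem_preimage, mem_singleton_iff, funext_iff, Set.mem_pi, Finset.coe_range, mem_Iio]
    constructor
    · intro h j hj
      rcases j with _ | j
      · simp [t]
      · rw [ht j (by omega)]
        exact h ⟨j, by omega⟩
    · intro h i
      have := h (i + 1) (by omega)
      rw [ht i i.2] at this
      exact this
  rw [measureReal_def, this, bernoulli, Measure.infinitePi_pi _ fun i _ =>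
      Set.toFinite _ |>.measurableSet,
    Finset.prod_range_succ', Finset.prod_range]
  have h0 : t 0 = univ := by simp [t]
  rw [h0, measure_univ, mul_one, ENNReal.toReal_prod]
  refine Finset.prod_congr rfl fun i _ => ?_
  rw [ht i i.2, weights_singleton, ENNReal.toReal_ofReal (hp0 _)]

lemma sum_negMulLog_prod {ι : Type*} [Fintype ι] {p : ι → ℝ} (hp0 : ∀ a, 0 < p a)
    (hp1 : ∑ a, p a = 1) (k : ℕ) :
    ∑ v : Fin k → ι, Real.negMulLog (∏ i, p (v i)) = k * ∑ a, Real.negMulLog (p a) := by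
  set H := ∑ a, Real.negMulLog (p a) with hH
  have hc : ∑ a, p a * (-Real.log (p a) - H) = 0 := by
    simp only [mul_sub, Finset.sum_sub_distrib, ← Finset.sum_mul, hp1, one_mul]
    rw [hH, sub_eq_zero]
    exact Finset.sum_congr rfl fun a _ => by rw [Real.negMulLog]; ring
  have h := sum_prod_mul_sum hp1 hc k
  have e : ∀ v : Fin k → ι, (∏ i, p (v i)) * ∑ i, (-Real.log (p (v i)) - H) =
      Real.negMulLog (∏ i, p (v i)) - k * H * ∏ i, p (v i) := by
    intro v
    rw [Real.negMulLog, Real.log_prod fun i _ => (hp0 _).ne', Finset.sum_sub_distrib,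
      Finset.sum_neg_distrib]
    simp only [Finset.sum_const, Finset.card_univ, Fintype.card_fin, nsmul_eq_mul]
    ring
  rw [Finset.sum_congr rfl fun v _ => e v, Finset.sum_sub_distrib, ← Finset.mul_sum,
    sum_prod_weights hp1, mul_one] at h
  linarith

lemma partitionEntropy_bernoulli {p : Fin d → ℝ} [IsProbabilityMeasure (weights p)]
    (hp0 : ∀ a, 0 < p a) (hp1 : ∑ a, p a = 1) (k : ℕ) :
    partitionEntropy (bernoulli p) (fun (b : ℕ → Fin d) (i : Fin k) => b (i + 1)) =
      ENNReal.ofReal (k * ∑ a, Real.negMulLog (p a)) := by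
  have : IsProbabilityMeasure (bernoulli p) := by unfold bernoulli; infer_instance
  rw [partitionEntropy_fintype, ← sum_negMulLog_prod hp0 hp1]
  simp only [bernoulli_real_preimage fun a => (hp0 a).le]

end Bernoulli

section Horseshoe

variable {S : Type*} [Countable S] [TopologicalSpace S] [DiscreteTopology S] {A : S → S → Prop}
variable {ψ : Space A → ℝ} {μ : Measure (Space A)} {c κ : ℝ} {N : ℕ}

/-- The coding map of a horseshoe: concatenation of the first `t` symbols of the points `
zz a a'`. -/
lemma exists_coding {d n t : ℕ} (hn : 1 ≤ n) (hnt : n ≤ t) (β : Fin d → Space A)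
    (zz : Fin d → Fin d → Space A) (hz : ∀ a a', zz a a' ∈ cyl (β a) n)
    (hzs : ∀ a a', (shift A)^[t] (zz a a') = β a') :
    ∃ Φ : (ℕ → Fin d) → Space A, ∀ b i,
      (Φ b).1 i = (zz (b (i / t)) (b (i / t + 1))).1 (i % t) := by
  have ht : 0 < t := by omega
  have hadm : ∀ (b : ℕ → Fin d) i, A ((zz (b (i / t)) (b (i / t + 1))).1 (i % t))
      ((zz (b ((i + 1) / t)) (b ((i + 1) / t + 1))).1 ((i + 1) % t)) := by
    intro b i
    by_cases h : i % t + 1 < t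
    · have h1 : (i + 1) / t = i / t := by
        rw [Nat.add_div ht, Nat.div_eq_of_lt (show 1 < t by omega),
            Nat.mod_eq_of_lt (show 1 < t by omega)]
        simp [Nat.not_le.2 h]
      have h2 : (i + 1) % t = i % t + 1 := by
        rw [Nat.add_mod, Nat.mod_eq_of_lt (show 1 < t by omega), Nat.mod_eq_of_lt h]
      rw [h1, h2]
      exact (zz _ _).2 _
    · have hlt := Nat.mod_lt i ht
      have h0 : i % t + 1 = t := by omega
      have hi := Nat.div_add_mod i t
      have h3 : i + 1 = t * (i / t + 1) := by rw [mul_add, mul_one]; omega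
      have h1 : (i + 1) / t = i / t + 1 := by rw [h3, Nat.mul_div_cancel_left _ ht]
      have h2 : (i + 1) % t = 0 := by rw [h3, Nat.mul_mod_right]
      rw [h1, h2, mem_cyl.1 (hz _ _) 0 (by omega)]
      have h4 : (zz (b (i / t)) (b (i / t + 1))).1 t = (β (b (i / t + 1))).1 0 := by
        rw [← hzs (b (i / t)) (b (i / t + 1)), shift_iterate_apply, add_zero]
      rw [← h4]
      have := (zz (b (i / t)) (b (i / t + 1))).2 (i % t)
      rwa [h0] at this
  exact ⟨fun b => ⟨fun i => (zz (b (i / t)) (b (i / t + 1))).1 (i % t), hadm b⟩, fun b i => rfl⟩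

lemma measurable_of_apply {Ω : Type*} [MeasurableSpace Ω] {Φ : Ω → Space A}
    (h : ∀ i a, MeasurableSet {b | (Φ b).1 i = a}) : Measurable Φ := by
  refine measurable_of_isOpen fun U hU => ?_
  have : Φ ⁻¹' U = ⋃ (w : List S) (_ : cylinder A w ⊆ U), Φ ⁻¹' cylinder A w := by
    ext b
    simp only [mem_preimage, mem_iUnion, exists_prop]
    constructor
    · intro hb
      obtain ⟨n, hn⟩ := exists_cyl_subset hU hb
      refine ⟨word (Φ b) n, ?_, ?_⟩ <;> rw [cylinder_word]
      · exact hn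
      · exact mem_cyl_self _ _
    · rintro ⟨w, hw, hb⟩
      exact hw hb
  rw [this]
  refine MeasurableSet.iUnion fun w => MeasurableSet.iUnion fun _ => ?_
  have : Φ ⁻¹' cylinder A w = ⋂ i : Fin w.length, {b | (Φ b).1 i = w.get i} := by
    ext b
    simp [cylinder]
  rw [this]
  exact MeasurableSet.iInter fun i => h _ _

/-- A potential with a Gibbs state is bounded on points whose first symbol lies in a finite set. -/
lemma GibbsData.exists_abs_le (hg : GibbsData ψ μ c κ N) (s : Finset S) :
    ∃ C : ℝ, ∀ x : Space A, x.1 0 ∈ s → |ψ x| ≤ C := by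
  have := hg.prob
  have hc : 0 < c := by linarith [hg.one_le]
  refine ⟨Real.log c + ∑ a ∈ s, |Real.log (μ.real (cylinder A [a]) / c)|, fun x hx => ?_⟩
  have hcyl : cyl x 1 = cylinder A [x.1 0] := by
    rw [← cylinder_word]; simp [word]
  have hlc : 0 ≤ Real.log c := Real.log_nonneg hg.one_le
  have hs : |Real.log (μ.real (cylinder A [x.1 0]) / c)| ≤
      ∑ a ∈ s, |Real.log (μ.real (cylinder A [a]) / c)| :=
    Finset.single_le_sum (f := fun a => |Real.log (μ.real (cylinder A [a]) / c)|)
      (fun _ _ => abs_nonneg _) hx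
  have h1 := hg.exp_le 1 x
  have h2 := hg.le_exp 1 x
  have hpos := hg.measure_cyl_pos x 1
  rw [birkhoff_one] at h1 h2
  have h3 : ψ x ≤ Real.log c := by
    rw [← Real.exp_le_exp, Real.exp_log hc]
    exact h1.trans (mul_le_of_le_one_right hc.le measureReal_le_one)
  have h4 : Real.log (μ.real (cylinder A [x.1 0]) / c) ≤ ψ x := by
    rw [← hcyl, Real.log_le_iff_le_exp (by positivity), div_le_iff₀ hc]
    linarith
  have h5 := abs_nonneg (Real.log (μ.real (cylinder A [x.1 0]) / c))
  have h6 := neg_abs_le (Real.log (μ.real (cylinder A [x.1 0]) / c))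
  rw [abs_le]
  constructor <;> linarith

lemma le_entropy_of_forall {X : Type*} [MeasurableSpace X] {T : X → X} {ν : Measure X} {q : X → ℕ}
    (hq : Measurable q) (hqf : (range q).Finite) {t : ℕ} (ht : 1 ≤ t) {H : ℝ} (hH : 0 ≤ H)
    (h : ∀ L : ℕ, ENNReal.ofReal ((L / t - 1 : ℕ) * H) ≤
      partitionEntropy ν (fun x => fun i : Fin L => q (T^[i] x))) :
    ENNReal.ofReal (H / t) ≤ entropy T ν := by
  refine le_iSup₂_of_le q ⟨hq, hqf⟩ ?_
  have htpos : (0 : ℝ) < t := by exact_mod_cast ht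
  have hlim : Tendsto (fun L : ℕ => (H / t) - 2 * H * (L : ℝ)⁻¹) atTop (𝓝 (H / t)) := by
    have := (tendsto_inv_atTop_zero.comp (tendsto_natCast_atTop_atTop (R := ℝ))).const_mul (2 * H)
    simpa using this.const_sub (H / t)
  have hlim' := (ENNReal.continuous_ofReal.tendsto _).comp hlim
  refine hlim'.liminf_eq.symm.le.trans (liminf_le_liminf ?_)
  filter_upwards [eventually_ge_atTop 1] with L hL
  have hLpos : (0 : ℝ) < L := by exact_mod_cast hL
  refine le_trans ?_ (mul_le_mul_right (h L) _)
  rw [← ENNReal.ofReal_mul (by positivity)]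
  refine ENNReal.ofReal_le_ofReal ?_
  have h1 : (L : ℝ) / t - 2 ≤ (L / t - 1 : ℕ) := by
    have h2 : (L : ℝ) / t < (L / t : ℕ) + 1 := by
      rw [div_lt_iff₀ htpos]
      have h4 := Nat.div_add_mod L t
      have h5 := Nat.mod_lt L ht
      have h6 : L < (L / t + 1) * t := by rw [Nat.add_mul, Nat.mul_comm]; omega
      exact_mod_cast h6
    have h3 : ((L / t : ℕ) : ℝ) ≤ (L / t - 1 : ℕ) + 1 := by
      exact_mod_cast (by omega : L / t ≤ (L / t - 1) + 1)
    linarith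
  calc H / t - 2 * H * (L : ℝ)⁻¹ = (L : ℝ)⁻¹ * (((L : ℝ) / t - 2) * H) := by field_simp
    _ ≤ _ := by gcongr

/-- The horseshoe construction: an invariant measure built from finitely many weighted words. -/
lemma GibbsData.exists_horseshoe (hg : GibbsData ψ μ c κ N) {d n : ℕ} (hn : 1 ≤ n)
    (β : Fin d → Space A) (hβ : ∀ a a', pre n (β a) = pre n (β a') → a = a') {p : Fin d → ℝ}
    (hp0 : ∀ a, 0 < p a) (hp1 : ∑ a, p a = 1) :
    ∃ ν : ProbabilityMeasure (Space A), Invariant (shift A) (ν : Measure (Space A)) ∧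
      Integrable ψ (ν : Measure (Space A)) ∧
      ENNReal.ofReal ((∑ a, Real.negMulLog (p a)) / (n + N : ℕ)) ≤
        entropy (shift A) (ν : Measure (Space A)) ∧
      (∑ a, p a * birkhoff (shift A) ψ n (β a) + Real.log κ - 2 * Real.log c) / (n + N : ℕ) ≤
        ∫ x, ψ x ∂(ν : Measure (Space A)) ∧
      ∀ w, |(ν : Measure (Space A)).real (cylinder A w) -
        (n : ℝ)⁻¹ * ∑ a, p a * birkhoff (shift A) (ind A w) n (β a)| ≤ (w.length + 2 * N) / n := by
  classical
  have hcpos : 0 < c := by linarith [hg.one_le]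
  have hκ := hg.κ_pos
  have hT : Measurable (shift A) := continuous_shift.measurable
  choose gl hglm hgls hglκ using hg.glue n hn
  set t := n + N with ht
  have ht1 : 1 ≤ t := by omega
  have htpos : (0 : ℝ) < t := by exact_mod_cast ht1
  have hnpos : (0 : ℝ) < n := by exact_mod_cast hn
  obtain ⟨Φ, hΦ⟩ := exists_coding hn (show n ≤ t by omega) β (fun a a' => gl (β a) (β a'))
    (fun a a' => hglm _ _) (fun a a' => hgls _ _)
  have hcoord : ∀ b q j, j < n → (Φ b).1 (q * t + j) = (β (b q)).1 j := by
    intro b q j hj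
    have h1 : (q * t + j) / t = q := by
      rw [Nat.mul_comm, Nat.mul_add_div (by omega), Nat.div_eq_of_lt (by omega), add_zero]
    have h2 : (q * t + j) % t = j := by
      rw [Nat.mul_comm, Nat.mul_add_mod, Nat.mod_eq_of_lt (by omega)]
    rw [hΦ, h1, h2]
    exact mem_cyl.1 (hglm _ _) j hj
  have hcylt : ∀ b, Φ b ∈ cyl (gl (β (b 0)) (β (b 1))) t := by
    intro b
    rw [mem_cyl]
    intro i hi
    rw [hΦ, Nat.div_eq_of_lt hi, Nat.mod_eq_of_lt hi]
  have hper : ∀ b, (shift A)^[t] (Φ b) = Φ fun i => b (i + 1) := by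
    intro b
    refine Space.ext fun i => ?_
    have h1 : (t + i) / t = i / t + 1 := by
      rw [Nat.add_div_left _ (by omega)]
    rw [shift_iterate_apply, hΦ, hΦ, h1, Nat.add_mod_left]
  have hΦm : Measurable Φ := by
    refine measurable_of_apply fun i a => ?_
    have : {b : ℕ → Fin d | (Φ b).1 i = a} = (fun b : ℕ → Fin d => (b (i / t), b (i / t + 1))) ⁻¹'
        {u | (gl (β u.1) (β u.2)).1 (i % t) = a} := by
      ext b
      simp [hΦ]
    rw [this]
    exact (by fun_prop : Measurable fun b : ℕ → Fin d => (b (i / t), b (i / t + 1)))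
      (Set.toFinite _).measurableSet
  let Fs : Finset S := Finset.univ.biUnion fun u : Fin d × Fin d =>
    (Finset.range t).image fun j => (gl (β u.1) (β u.2)).1 j
  have hFs : ∀ b i, (Φ b).1 i ∈ Fs := by
    intro b i
    rw [hΦ]
    refine Finset.mem_biUnion.2 ⟨(b (i / t), b (i / t + 1)), Finset.mem_univ _, ?_⟩
    exact Finset.mem_image.2 ⟨i % t, Finset.mem_range.2 (Nat.mod_lt _ ht1), rfl⟩
  have hFs' : ∀ b i, ((shift A)^[i] (Φ b)).1 0 ∈ Fs := fun b i => by
    rw [shift_iterate_apply]; exact hFs b _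
  have hprob := isProbabilityMeasure_weights (fun a => (hp0 a).le) hp1
  have hbprob : IsProbabilityMeasure (bernoulli p) := by unfold bernoulli; infer_instance
  have hνprob := isProbabilityMeasure_tower (Q := bernoulli p) hT hΦm ht1
  obtain ⟨C, hC⟩ := hg.exists_abs_le Fs
  have hψC : ∀ b i, |ψ ((shift A)^[i] (Φ b))| ≤ C := fun b i => hC _ (hFs' b i)
  have hfirst : ∀ f : Fin d → ℝ, ∫ b, f (b 0) ∂(bernoulli p) = ∑ a, p a * f a := by
    intro f
    have hmp : MeasurePreserving (Function.eval 0) (bernoulli p) (weights p) :=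
      measurePreserving_eval_infinitePi (fun _ => weights p) 0
    have h1 := integral_map (μ := bernoulli p) hmp.measurable.aemeasurable (f := f)
      (measurable_of_finite f).aestronglyMeasurable
    rw [hmp.map_eq] at h1
    rw [show ∫ b, f (b 0) ∂(bernoulli p) = ∫ b, f (Function.eval 0 b) ∂(bernoulli p) from rfl, ← h1,
      integral_fintype Integrable.of_finite]
    refine Finset.sum_congr rfl fun a _ => ?_
    rw [measureReal_def, weights_singleton, ENNReal.toReal_ofReal (hp0 a).le, smul_eq_mul]
  have hfirsti : ∀ f : Fin d → ℝ, Integrable (fun b => f (b 0)) (bernoulli p) := by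
    intro f
    refine Integrable.of_bound (C := ∑ a, |f a|) ?_ (Eventually.of_forall fun b => ?_)
    · exact ((measurable_of_finite f).comp (measurable_pi_apply 0)).aestronglyMeasurable
    · exact Finset.single_le_sum (f := fun a => |f a|) (fun _ _ => abs_nonneg _) (Finset.mem_univ _)
  refine ⟨⟨tower (shift A) (bernoulli p) Φ t, hνprob⟩,
    invariant_tower hT hΦm measurePreserving_bernoulli hper,
    integrable_tower hT hΦm ht1 hg.meas hψC, ?_, ?_, fun w => ?_⟩
  · -- entropy
    obtain ⟨e, he⟩ := Countable.exists_injective_nat S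
    let q : Space A → ℕ := fun x => if x.1 0 ∈ Fs then e (x.1 0) + 1 else 0
    have hq : Measurable q := by
      refine (continuous_of_prefix (n := 1) fun x z hz => ?_).measurable
      simp only [q, mem_cyl.1 hz 0 one_pos]
    have hqf : (range q).Finite := by
      refine ((Fs.image fun a => e a + 1) ∪ {0}).finite_toSet.subset ?_
      rintro _ ⟨x, rfl⟩
      by_cases hx : x.1 0 ∈ Fs
      · simp only [q, hx, if_true]
        exact Finset.mem_coe.2 (Finset.mem_union_left _ (Finset.mem_image_of_mem _ hx))
      · simp [q, hx]
    have hqe : ∀ x z : Space A, x.1 0 ∈ Fs → z.1 0 ∈ Fs → q x = q z → x.1 0 = z.1 0 := by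
      intro x z hx hz h
      simp only [q, hx, hz, if_true] at h
      exact he (by omega)
    have hqs : ∀ a, MeasurableSet (q ⁻¹' {a}) := fun a => hq (measurableSet_singleton a)
    refine le_entropy_of_forall hq hqf ht1 (Finset.sum_nonneg fun a _ =>
      Real.negMulLog_nonneg (hp0 a).le ?_) fun L => ?_
    · rw [← hp1]
      exact Finset.single_le_sum (fun a _ => (hp0 a).le) (Finset.mem_univ a)
    refine le_partitionEntropy_tower hT hΦm ht1
      (fun v => measurableSet_preimage_iterates hT hqs v) fun i hi => ?_
    rw [← partitionEntropy_bernoulli hp0 hp1]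
    have hmeas : ∀ v : Fin L → ℕ, MeasurableSet ((fun b => fun j : Fin L =>
        q ((shift A)^[j] ((shift A)^[i] (Φ b)))) ⁻¹' {v}) := fun v =>
      (measurable_orbit hT hΦm i) (measurableSet_preimage_iterates hT hqs v)
    refine partitionEntropy_mono _ hmeas (fun v => ?_) fun x z hxz => ?_
    · exact (by fun_prop : Measurable (fun (b : ℕ → Fin d) (i : Fin (L / t - 1)) => b (i + 1)))
        (measurableSet_singleton v)
    · funext l
      refine hβ _ _ (funext fun j => ?_)
      have hl := l.2
      have hlt : (l + 1) * t + t ≤ L := by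
        have h1 : ((l : ℕ) + 1 + 1) * t ≤ L / t * t := Nat.mul_le_mul_right _ (by omega)
        have h2 := Nat.div_mul_le_self L t
        have h3 : ((l : ℕ) + 1 + 1) * t = (l + 1) * t + t := by ring
        omega
      have hge : t ≤ (l + 1) * t := Nat.le_mul_of_pos_left _ (by omega)
      have hj := j.2
      have h1 := congrFun hxz ⟨(l + 1) * t + j - i, by omega⟩
      have h2 := hqe _ _ (by rw [shift_iterate_apply, shift_iterate_apply]; exact hFs _ _)
        (by rw [shift_iterate_apply, shift_iterate_apply]; exact hFs _ _) h1
      simp only [shift_iterate_apply, add_zero] at h2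
      have h3 : i + ((l + 1) * t + j - i) = (l + 1) * t + j := by omega
      rw [h3, hcoord _ _ _ hj, hcoord _ _ _ hj] at h2
      exact h2
  · -- integral
    change _ ≤ ∫ x, ψ x ∂(tower (shift A) (bernoulli p) Φ t)
    rw [integral_tower hT hΦm hg.meas hψC, div_eq_inv_mul]
    refine mul_le_mul_of_nonneg_left ?_ (by positivity)
    rw [← hfirst fun a => birkhoff (shift A) ψ n (β a)]
    have hintgr : Integrable (fun b => birkhoff (shift A) ψ t (Φ b)) (bernoulli p) := by
      unfold birkhoff
      exact integrable_finsetSum _ fun i _ => integrable_comp_orbit hT hΦm hg.meas hψC i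
    have := integral_mono (μ := bernoulli p) (((hfirsti fun a => birkhoff (shift A) ψ n (β a)).add
      (integrable_const (Real.log κ - 2 * Real.log c)))) hintgr fun b => by
        have h1 := hglκ (β (b 0)) (β (b 1))
        have h2 := hg.exp_le_of_mem (hcylt b)
        have h3 := h1.trans h2
        have h4 : c ^ 2 = Real.exp (2 * Real.log c) := by
          rw [two_mul, Real.exp_add, Real.exp_log hcpos, sq]
        rw [h4, ← Real.exp_add, ← Real.exp_log hκ, ← Real.exp_add, Real.exp_le_exp] at h3
        change birkhoff (shift A) ψ n (β (b 0)) + (Real.log κ - 2 * Real.log c) ≤ _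
        linarith
    rw [integral_add' (hfirsti fun a => birkhoff (shift A) ψ n (β a)) (integrable_const _)] at this
    simp only [integral_const, probReal_univ, one_smul] at this
    linarith
  · -- frequencies
    have hw0 : ∀ b i, |ind A w ((shift A)^[i] (Φ b))| ≤ 1 := fun b i => by
      rw [abs_of_nonneg (ind_nonneg _ _)]; exact ind_le_one _ _
    change |(tower (shift A) (bernoulli p) Φ t).real (cylinder A w) - _| ≤ _
    rw [← integral_ind, integral_tower hT hΦm (measurable_ind w) hw0,
      ← hfirst fun a => birkhoff (shift A) (ind A w) n (β a)]
    have hintgr : Integrable (fun b => birkhoff (shift A) (ind A w) t (Φ b)) (bernoulli p) := by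
      unfold birkhoff
      exact integrable_finsetSum _ fun i _ => integrable_comp_orbit hT hΦm (measurable_ind w) hw0 i
    have hfi := hfirsti fun a => birkhoff (shift A) (ind A w) n (β a)
    have h1 : |∫ b, birkhoff (shift A) (ind A w) t (Φ b) ∂(bernoulli p) -
        ∫ b, birkhoff (shift A) (ind A w) n (β (b 0)) ∂(bernoulli p)| ≤ w.length + N := by
      rw [← integral_sub hintgr hfi]
      have := norm_integral_le_of_norm_le_const (μ := bernoulli p)
        (f := fun b => birkhoff (shift A) (ind A w) t (Φ b) -
          birkhoff (shift A) (ind A w) n (β (b 0))) (C := w.length + N)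
              (Eventually.of_forall fun b => by
            rw [Real.norm_eq_abs]
            refine abs_birkhoff_glue_le ?_
            rw [mem_cyl]
            intro i hi
            have := hcoord b 0 i hi
            rwa [zero_mul, zero_add] at this)
      simpa using this
    set I1 := ∫ b, birkhoff (shift A) (ind A w) t (Φ b) ∂(bernoulli p)
    set I2 := ∫ b, birkhoff (shift A) (ind A w) n (β (b 0)) ∂(bernoulli p) with hI2
    have h2 : 0 ≤ I2 ∧ I2 ≤ n := by
      constructor
      · exact integral_nonneg fun b => (birkhoff_nonneg_le (ind_nonneg w) (ind_le_one w) _ _).1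
      · have := integral_mono hfi (integrable_const (n : ℝ)) fun b =>
          (birkhoff_nonneg_le (ind_nonneg w) (ind_le_one w) n (β (b 0))).2
        simpa using this
    have htn : (t : ℝ) = n + N := by rw [ht]; push_cast; ring
    have hN0 : (0 : ℝ) ≤ N := by positivity
    have e1 : (t : ℝ)⁻¹ * I1 - (n : ℝ)⁻¹ * I2 = (t : ℝ)⁻¹ * ((I1 - I2) - N * (I2 / n)) := by
      have : (N : ℝ) = t - n := by rw [htn]; ring
      rw [this]
      field_simp
      ring
    have h3 : 0 ≤ I2 / n ∧ I2 / n ≤ 1 :=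
      ⟨div_nonneg h2.1 hnpos.le, (div_le_one hnpos).2 h2.2⟩
    have h4 : |(I1 - I2) - N * (I2 / n)| ≤ w.length + 2 * N := by
      have h5 : 0 ≤ N * (I2 / n) := mul_nonneg hN0 h3.1
      have h6 : N * (I2 / n) ≤ N := mul_le_of_le_one_right hN0 h3.2
      rw [abs_le] at h1 ⊢
      constructor <;> linarith [h1.1, h1.2]
    rw [e1, abs_mul, abs_of_pos (inv_pos.2 htpos),
      div_eq_inv_mul ((w.length : ℝ) + 2 * N)]
    refine mul_le_mul ?_ h4 (abs_nonneg _) (by positivity)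
    exact inv_anti₀ hnpos (by rw [htn]; linarith)

end Horseshoe

section LocalUpperBound

variable {S : Type*} [Countable S] [TopologicalSpace S] [DiscreteTopology S] {A : S → S → Prop}
variable {ψ : Space A → ℝ} {μ : Measure (Space A)} {c κ : ℝ} {N : ℕ}

lemma empirical_real_cylinder (x : Space A) {n : ℕ} (hn : 1 ≤ n) (w : List S) :
    ((empirical (shift A) x n : ProbabilityMeasure (Space A)) : Measure (Space A)).real
      (cylinder A w) = (n : ℝ)⁻¹ * birkhoff (shift A) (ind A w) n x :=
  empirical_real x hn (isClopen_cylinder w).2.measurableSet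

lemma GibbsData.exists_invariant_of_finset (hg : GibbsData ψ μ c κ N) {n : ℕ} (hn : 1 ≤ n)
    {s : Finset (Space A)} (hs : InjOn (pre n) (s : Set (Space A))) (hne : s.Nonempty) :
    ∃ ν : ProbabilityMeasure (Space A), Invariant (shift A) (ν : Measure (Space A)) ∧
      Integrable ψ (ν : Measure (Space A)) ∧
      ∃ h : ℝ, 0 ≤ h ∧ ENNReal.ofReal h ≤ entropy (shift A) (ν : Measure (Space A)) ∧
      Real.log (∑ x ∈ s, Real.exp (birkhoff (shift A) ψ n x)) + Real.log κ - 2 * Real.log c ≤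
        (n + N : ℕ) * (h + ∫ x, ψ x ∂(ν : Measure (Space A))) ∧
      ∀ (w : List S) (r ε : ℝ), (∀ x ∈ s,
        |((empirical (shift A) x n : ProbabilityMeasure (Space A)) : Measure (Space A)).real
          (cylinder A w) - r| ≤ ε) →
        |(ν : Measure (Space A)).real (cylinder A w) - r| ≤ ε + (w.length + 2 * N) / n := by
  classical
  set W := ∑ x ∈ s, Real.exp (birkhoff (shift A) ψ n x) with hW
  have hWpos : 0 < W := Finset.sum_pos (fun _ _ => Real.exp_pos _) hne
  let e := s.equivFin.symm
  let β : Fin s.card → Space A := fun a => (e a).1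
  have hsum : ∀ f : Space A → ℝ, ∑ a, f (β a) = ∑ x ∈ s, f x := fun f => by
    rw [← Finset.sum_coe_sort s f]
    exact e.sum_comp fun x : s => f x
  let p : Fin s.card → ℝ := fun a => Real.exp (birkhoff (shift A) ψ n (β a)) / W
  have hp0 : ∀ a, 0 < p a := fun a => div_pos (Real.exp_pos _) hWpos
  have hp1 : ∑ a, p a = 1 := by
    rw [← Finset.sum_div, hsum fun x => Real.exp (birkhoff (shift A) ψ n x), div_self hWpos.ne']
  have hlog : ∀ a, Real.negMulLog (p a) + p a * birkhoff (shift A) ψ n (β a) =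
      p a * Real.log W := fun a => by
    rw [Real.negMulLog, Real.log_div (Real.exp_pos _).ne' hWpos.ne', Real.log_exp]
    ring
  have hlogs : ∑ a, Real.negMulLog (p a) + ∑ a, p a * birkhoff (shift A) ψ n (β a) =
      Real.log W := by
    rw [← Finset.sum_add_distrib, Finset.sum_congr rfl fun a _ => hlog a, ← Finset.sum_mul, hp1,
      one_mul]
  have hH : 0 ≤ ∑ a, Real.negMulLog (p a) := Finset.sum_nonneg fun a _ =>
    Real.negMulLog_nonneg (hp0 a).le (by
      rw [← hp1]; exact Finset.single_le_sum (fun a _ => (hp0 a).le) (Finset.mem_univ a))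
  obtain ⟨ν, hν, hintgr, hent, hψ, hfr⟩ := hg.exists_horseshoe hn β (fun a a' h => by
    have := hs (Finset.mem_coe.2 (e a).2) (Finset.mem_coe.2 (e a').2) h
    exact e.injective (Subtype.ext this)) hp0 hp1
  have htpos : (0 : ℝ) < (n + N : ℕ) := by exact_mod_cast (by omega : 0 < n + N)
  refine ⟨ν, hν, hintgr, _, div_nonneg hH htpos.le, hent, ?_, fun w r ε hr => ?_⟩
  · rw [div_le_iff₀ htpos] at hψ
    rw [mul_add, mul_div_cancel₀ _ htpos.ne', ← hlogs]
    linarith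
  · have h1 : |(n : ℝ)⁻¹ * ∑ a, p a * birkhoff (shift A) (ind A w) n (β a) - r| ≤ ε := by
      have h2 : (n : ℝ)⁻¹ * ∑ a, p a * birkhoff (shift A) (ind A w) n (β a) - r =
          ∑ a, p a * ((n : ℝ)⁻¹ * birkhoff (shift A) (ind A w) n (β a) - r) := by
        simp only [mul_sub, Finset.sum_sub_distrib]
        rw [← Finset.sum_mul, hp1, one_mul, Finset.mul_sum]
        congr 1
        exact Finset.sum_congr rfl fun a _ => by ring
      rw [h2]
      calc _ ≤ ∑ a, |p a * ((n : ℝ)⁻¹ * birkhoff (shift A) (ind A w) n (β a) - r)| :=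
            Finset.abs_sum_le_sum_abs _ _
        _ ≤ ∑ a, p a * ε := Finset.sum_le_sum fun a _ => by
            rw [abs_mul, abs_of_pos (hp0 a)]
            refine mul_le_mul_of_nonneg_left ?_ (hp0 a).le
            have := hr (β a) (e a).2
            rwa [empirical_real_cylinder _ hn] at this
        _ = ε := by rw [← Finset.sum_mul, hp1, one_mul]
    have h3 := hfr w
    rw [abs_le] at h1 h3 ⊢
    constructor <;> linarith [h1.1, h1.2, h3.1, h3.2]

lemma exists_finset_half_le {ι : Type*} {f : ι → ℝ} (hf : ∀ i, 0 < f i)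
    (h0 : ∑' i, ENNReal.ofReal (f i) ≠ 0) (ht : ∑' i, ENNReal.ofReal (f i) ≠ ⊤) :
    ∃ s : Finset ι, s.Nonempty ∧
      ∑' i, ENNReal.ofReal (f i) ≤ ENNReal.ofReal (2 * ∑ i ∈ s, f i) := by
  have hlt : (∑' i, ENNReal.ofReal (f i)) / 2 < ∑' i, ENNReal.ofReal (f i) :=
    ENNReal.half_lt_self h0 ht
  have hev := (ENNReal.summable (f := fun i => ENNReal.ofReal (f i))).hasSum.eventually
    (lt_mem_nhds hlt)
  obtain ⟨s, hs⟩ := hev.exists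
  refine ⟨s, ?_, ?_⟩
  · rw [Finset.nonempty_iff_ne_empty]
    rintro rfl
    simp at hs
  · rw [ENNReal.ofReal_mul (by norm_num), ENNReal.ofReal_sum_of_nonneg fun i _ => (hf i).le]
    rw [ENNReal.div_lt_iff (by simp) (by simp), mul_comm] at hs
    simpa using hs.le

/-- The local upper bound. -/
lemma GibbsData.exists_nhd_Zfn_le (hg : GibbsData ψ μ c κ N) (y : Space A)
    {G : Set (ProbabilityMeasure (Space A))} (hG : IsOpen G) {μ₀ : ProbabilityMeasure (Space A)}
    (hμ₀ : μ₀ ∈ G) {a : ℝ} (hF : ∀ ν ∈ G, Invariant (shift A) (ν : Measure (Space A)) →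
      Integrable ψ (ν : Measure (Space A)) → ∀ h : ℝ, 0 ≤ h →
      ENNReal.ofReal h ≤ entropy (shift A) (ν : Measure (Space A)) →
      h + ∫ x, ψ x ∂(ν : Measure (Space A)) ≤ a) :
    ∃ U : Set (ProbabilityMeasure (Space A)), IsOpen U ∧ μ₀ ∈ U ∧ ∃ C : ℝ, ∀ᶠ n : ℕ in atTop,
      Zfn (shift A) ψ n (preimSet (shift A) n y ∩ {x | empirical (shift A) x n ∈ U}) ≤
        ENNReal.ofReal (Real.exp (n * a + C)) := by
  classical
  obtain ⟨I, ε, hε, hI⟩ := exists_cylinder_nbhd hG hμ₀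
  refine ⟨_, isOpen_cylinder_nbhd I (ε / 2) μ₀, fun w _ => by simpa using by positivity,
    |(N : ℝ) * a| + 2 * Real.log c - Real.log κ + Real.log 2, ?_⟩
  set U := {ν : ProbabilityMeasure (Space A) | ∀ w ∈ I, |(ν : Measure (Space A)).real (cylinder A w)
        - (μ₀ : Measure (Space A)).real (cylinder A w)| < ε / 2} with hU
  have hsmall : ∀ᶠ n : ℕ in atTop, ∀ w ∈ I, ((w.length : ℝ) + 2 * N) / n < ε / 2 := by
    refine (Finset.eventually_all I).2 fun w _ => ?_
    exact (tendsto_const_div_atTop_nhds_zero_nat _).eventually (gt_mem_nhds (by positivity))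
  filter_upwards [hsmall, eventually_ge_atTop 1] with n hsm hn
  set D := preimSet (shift A) n y ∩ {x | empirical (shift A) x n ∈ U} with hD
  have hinj : InjOn (pre n) D := (injOn_pre_preimSet y n).mono inter_subset_left
  by_cases h0 : Zfn (shift A) ψ n D = 0
  · rw [h0]; exact zero_le
  have htop : Zfn (shift A) ψ n D ≠ ⊤ := ((hg.Zfn_le hinj).trans_lt ENNReal.ofReal_lt_top).ne
  obtain ⟨s, hne, hs⟩ := exists_finset_half_le (fun x : D => Real.exp_pos _) h0 htop
  let s' : Finset (Space A) := s.map (Function.Embedding.subtype _)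
  have hs'D : ∀ x ∈ s', x ∈ D := by
    intro x hx
    obtain ⟨x, _, rfl⟩ := Finset.mem_map.1 hx
    exact x.2
  obtain ⟨ν, hν, hintgr, h, h0, hent, hlog, hfr⟩ := hg.exists_invariant_of_finset hn (s := s')
    (fun x hx z hz => hinj (hs'D x hx) (hs'D z hz)) (hne.map)
  have hνG : ν ∈ G := hI ν fun w hw =>
    (hfr w _ (ε / 2) fun x hx => ((hs'D x hx).2 w hw).le).trans_lt (by linarith [hsm w hw])
  have h1 := hF ν hνG hν hintgr h h0 hent
  refine hs.trans (ENNReal.ofReal_le_ofReal ?_)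
  have hsum : ∑ x ∈ s', Real.exp (birkhoff (shift A) ψ n x) =
      ∑ x ∈ s, Real.exp (birkhoff (shift A) ψ n x) := Finset.sum_map _ _ _
  rw [hsum] at hlog
  have hWpos : 0 < ∑ x ∈ s, Real.exp (birkhoff (shift A) ψ n x) :=
    Finset.sum_pos (fun _ _ => Real.exp_pos _) hne
  rw [← Real.log_le_iff_le_exp (by positivity), Real.log_mul (by norm_num) hWpos.ne']
  have h2 : ((n + N : ℕ) : ℝ) * (h + ∫ x, ψ x ∂(ν : Measure (Space A))) ≤ (n + N : ℕ) * a := by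
    gcongr
  have h3 := le_abs_self ((N : ℝ) * a)
  push_cast at h2 hlog
  linarith

end LocalUpperBound

section LogLimits

variable {u : ℕ → ℝ≥0∞} {a C : ℝ}

lemma tendsto_coe_add_div (a C : ℝ) :
    Tendsto (fun n : ℕ => ((a + C / n : ℝ) : EReal)) atTop (𝓝 (a : EReal)) := by
  refine (continuous_coe_real_ereal.tendsto _).comp ?_
  simpa using (tendsto_const_div_atTop_nhds_zero_nat C).const_add a

lemma inv_mul_log_ofReal_exp {n : ℕ} (hn : 1 ≤ n) :
    (((n : ℝ)⁻¹ : ℝ) : EReal) * ENNReal.log (ENNReal.ofReal (Real.exp (n * a + C))) =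
      ((a + C / n : ℝ) : EReal) := by
  have hn' : (n : ℝ) ≠ 0 := by positivity
  rw [ENNReal.log_ofReal_of_pos (Real.exp_pos _), Real.log_exp, ← EReal.coe_mul]
  congr 1
  field_simp

lemma limsup_log_le (h : ∀ᶠ n : ℕ in atTop, u n ≤ ENNReal.ofReal (Real.exp (n * a + C))) :
    atTop.limsup (fun n : ℕ => (((n : ℝ)⁻¹ : ℝ) : EReal) * ENNReal.log (u n)) ≤ a := by
  refine (limsup_le_limsup ?_).trans (tendsto_coe_add_div a C).limsup_eq.le
  filter_upwards [h, eventually_ge_atTop 1] with n hn h1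
  rw [← inv_mul_log_ofReal_exp h1]
  exact mul_le_mul_of_nonneg_left (ENNReal.log_le_log hn) (by
    rw [EReal.coe_nonneg]; positivity)

lemma le_liminf_log (h : ∀ᶠ n : ℕ in atTop, ENNReal.ofReal (Real.exp (n * a + C)) ≤ u n) :
    a ≤ atTop.liminf (fun n : ℕ => (((n : ℝ)⁻¹ : ℝ) : EReal) * ENNReal.log (u n)) := by
  refine (tendsto_coe_add_div a C).liminf_eq.symm.le.trans (liminf_le_liminf ?_)
  filter_upwards [h, eventually_ge_atTop 1] with n hn h1
  rw [← inv_mul_log_ofReal_exp h1]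
  exact mul_le_mul_of_nonneg_left (ENNReal.log_le_log hn) (by
    rw [EReal.coe_nonneg]; positivity)

end LogLimits

section AbstractLDP

variable {Y : Type*} [TopologicalSpace Y] [MeasurableSpace Y] {ζ : ℕ → Measure Y} {F : Y → EReal}

/-- Exponential upper bound with rate `a`, up to a multiplicative constant. -/
def ExpBound (ζ : ℕ → Measure Y) (a : ℝ) (s : Set Y) : Prop :=
  ∃ C : ℝ, ∀ᶠ n : ℕ in atTop, ζ n s ≤ ENNReal.ofReal (Real.exp (n * a + C))

lemma ExpBound.mono {a : ℝ} {s t : Set Y} (hst : s ⊆ t) (h : ExpBound ζ a t) :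
    ExpBound ζ a s := by
  obtain ⟨C, hC⟩ := h
  exact ⟨C, hC.mono fun n hn => (measure_mono hst).trans hn⟩

lemma ExpBound.union {a : ℝ} {s t : Set Y} (hs : ExpBound ζ a s) (ht : ExpBound ζ a t) :
    ExpBound ζ a (s ∪ t) := by
  obtain ⟨C, hC⟩ := hs
  obtain ⟨D, hD⟩ := ht
  refine ⟨Real.log (Real.exp C + Real.exp D), ?_⟩
  filter_upwards [hC, hD] with n h1 h2
  refine (measure_union_le s t).trans ((add_le_add h1 h2).trans_eq ?_)
  rw [← ENNReal.ofReal_add (by positivity) (by positivity)]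
  congr 1
  rw [Real.exp_add, Real.exp_add, Real.exp_add, Real.exp_log (by positivity), mul_add]

lemma ExpBound.of_le {a b : ℝ} (hab : a ≤ b) {s : Set Y} (hs : ExpBound ζ a s) :
    ExpBound ζ b s := by
  obtain ⟨C, hC⟩ := hs
  refine ⟨C, hC.mono fun n hn => hn.trans (ENNReal.ofReal_le_ofReal (Real.exp_le_exp.2 ?_))⟩
  gcongr

lemma ExpBound.limsup_le {a : ℝ} {s : Set Y} (hs : ExpBound ζ a s) :
    atTop.limsup (fun n : ℕ => (((n : ℝ)⁻¹ : ℝ) : EReal) * ENNReal.log (ζ n s)) ≤ a :=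
  limsup_log_le hs.choose_spec

lemma exists_open_of_neg_rateOf_lt {x : Y} {a : EReal} (h : -rateOf F x < a) :
    ∃ G, IsOpen G ∧ x ∈ G ∧ ⨆ ν ∈ G, F ν < a := by
  rw [rateOf, neg_neg] at h
  simp only [iInf_lt_iff] at h
  obtain ⟨G, ⟨h1, h2⟩, h3⟩ := h
  exact ⟨G, h1, h2, h3⟩

lemma neg_rateOf_le {x : Y} {G : Set Y} (hG : IsOpen G) (hx : x ∈ G) :
    -rateOf F x ≤ ⨆ ν ∈ G, F ν := by
  rw [rateOf, neg_neg]
  exact iInf₂_le G ⟨hG, hx⟩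

lemma lowerSemicontinuous_rateOf : LowerSemicontinuous (rateOf F) := by
  intro x b hb
  obtain ⟨G, hG, hx, hlt⟩ := exists_open_of_neg_rateOf_lt (F := F) (x := x) (a := -b)
    (EReal.neg_lt_neg_iff.2 hb)
  filter_upwards [hG.mem_nhds hx] with z hz
  exact EReal.neg_lt_neg_iff.1 ((neg_rateOf_le hG hz).trans_lt hlt)

lemma expTight_of_expBound (hT : ∀ L : ℝ, 0 < L → ∃ K, IsCompact K ∧ ExpBound ζ (-L) Kᶜ) :
    ExpTight ζ := fun L hL => by
  obtain ⟨K, hK, hb⟩ := hT L hL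
  exact ⟨K, hK, hb.limsup_le⟩

/-- A local lower bound, a local upper bound and exponential tightness give the LDP. -/
lemma hasLDP_of_local
    (hL : ∀ G, IsOpen G → ∀ x ∈ G,
      F x ≤ atTop.liminf fun n : ℕ => (((n : ℝ)⁻¹ : ℝ) : EReal) * ENNReal.log (ζ n G))
    (hU : ∀ G, IsOpen G → ∀ x ∈ G, ∀ a : ℝ, (∀ z ∈ G, F z ≤ a) →
      ∃ U, IsOpen U ∧ x ∈ U ∧ ExpBound ζ a U)
    (hT : ∀ L : ℝ, 0 < L → ∃ K, IsCompact K ∧ ExpBound ζ (-L) Kᶜ) :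
    HasLDP ζ (rateOf F) := by
  refine ⟨fun G hG => ?_, fun K hK => ?_⟩
  · rw [EReal.neg_le]
    refine le_iInf₂ fun x hx => ?_
    rw [EReal.neg_le]
    exact (neg_rateOf_le hG hx).trans (iSup₂_le (hL G hG))
  · refine EReal.le_of_forall_lt_iff_le.1 fun a ha => ?_
    obtain ⟨K', hK', hb⟩ := hT (max 1 (-a)) (by positivity)
    have hb' : ExpBound ζ a K'ᶜ := hb.of_le (by linarith [le_max_right 1 (-a)])
    have hc : ExpBound ζ a (K' ∩ K) := by
      refine (hK'.inter_right hK).induction_on (p := ExpBound ζ a) ?_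
          (fun s t hst ht => ht.mono hst)
        (fun s t hs ht => hs.union ht) fun x hx => ?_
      · exact ⟨0, Eventually.of_forall fun n => by simp⟩
      · have h1 : -rateOf F x < a :=
          (EReal.neg_le_neg_iff.2 (iInf₂_le x hx.2)).trans_lt ha
        obtain ⟨G, hG, hxG, hlt⟩ := exists_open_of_neg_rateOf_lt h1
        obtain ⟨U, hUo, hxU, hUb⟩ := hU G hG x hxG a fun z hz =>
          (le_iSup₂ (f := fun ν (_ : ν ∈ G) => F ν) z hz).trans hlt.le
        exact ⟨U, mem_nhdsWithin_of_mem_nhds (hUo.mem_nhds hxU), hUb⟩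
    refine (ExpBound.mono ?_ (hc.union hb')).limsup_le
    intro x hx
    by_cases h : x ∈ K'
    · exact Or.inl ⟨h, hx⟩
    · exact Or.inr h

lemma goodRate_of_local [T2Space Y]
    (hL : ∀ G, IsOpen G → ∀ x ∈ G,
      F x ≤ atTop.liminf fun n : ℕ => (((n : ℝ)⁻¹ : ℝ) : EReal) * ENNReal.log (ζ n G))
    (hT : ∀ L : ℝ, 0 < L → ∃ K, IsCompact K ∧ ExpBound ζ (-L) Kᶜ) :
    GoodRate (rateOf F) := by
  refine ⟨lowerSemicontinuous_rateOf, fun α hα => ?_⟩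
  obtain ⟨K, hK, hb⟩ := hT (α + 1) (by positivity)
  refine hK.of_isClosed_subset (lowerSemicontinuous_rateOf.isClosed_preimage α) fun x hx => ?_
  by_contra hxK
  have h1 : -rateOf F x ≤ ((-(α + 1) : ℝ) : EReal) :=
    (neg_rateOf_le hK.isClosed.isOpen_compl hxK).trans
      ((iSup₂_le (hL _ hK.isClosed.isOpen_compl)).trans
        (le_trans (liminf_le_limsup (f := atTop)) hb.limsup_le))
  rw [EReal.neg_le, ← EReal.coe_neg, neg_neg] at h1
  have h2 := EReal.coe_le_coe_iff.1 (h1.trans hx)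
  linarith

end AbstractLDP

section Integral

variable {X : Type*} [MeasurableSpace X] {ν : Measure X} {φ : X → ℝ}

lemma ofReal_eq_ofReal_max_zero (x : ℝ) : ENNReal.ofReal x = ENNReal.ofReal (max x 0) := by
  rcases le_total x 0 with h | h
  · rw [max_eq_right h, ENNReal.ofReal_zero, ENNReal.ofReal_of_nonpos h]
  · rw [max_eq_left h]

lemma IntegralGtBot.integrable [IsFiniteMeasure ν] (hφ : Measurable φ) {M : ℝ} (hM : ∀ x, φ x ≤ M)
    (h : IntegralGtBot φ ν) : Integrable φ ν := by
  refine ⟨hφ.aestronglyMeasurable, ?_⟩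
  have hle : ∀ x, ‖φ x‖ₑ ≤ ENNReal.ofReal M + ENNReal.ofReal (-φ x) := fun x => by
    rw [← ofReal_norm, Real.norm_eq_abs]
    refine (ENNReal.ofReal_le_ofReal ?_).trans ((ENNReal.ofReal_add_le (p := max (φ x) 0)
      (q := max (-φ x) 0)).trans (add_le_add ?_ ?_))
    · rw [abs_eq_max_neg]
      exact max_le (by linarith [le_max_left (φ x) 0, le_max_right (-φ x) 0])
        (by linarith [le_max_left (-φ x) 0, le_max_right (φ x) 0])
    · rw [← ofReal_eq_ofReal_max_zero]
      exact ENNReal.ofReal_le_ofReal (hM x)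
    · rw [← ofReal_eq_ofReal_max_zero]
  refine (lintegral_mono hle).trans_lt ?_
  rw [lintegral_add_left measurable_const, lintegral_const]
  exact ENNReal.add_lt_top.2 ⟨ENNReal.mul_lt_top ENNReal.ofReal_lt_top (measure_lt_top _ _),
    h.lt_top⟩

lemma lintegral_ofReal_ne_top (h : Integrable φ ν) : ∫⁻ x, ENNReal.ofReal (φ x) ∂ν ≠ ⊤ := by
  refine ((lintegral_mono fun x => ?_).trans_lt h.2).ne
  exact Real.ofReal_le_enorm _

lemma integralGtBot_of_integrable (h : Integrable φ ν) : IntegralGtBot φ ν :=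
  lintegral_ofReal_ne_top h.neg

lemma eintegral_eq (h : Integrable φ ν) : eintegral φ ν = ((∫ x, φ x ∂ν : ℝ) : EReal) := by
  rw [eintegral, integral_eq_lintegral_pos_part_sub_lintegral_neg_part h, EReal.coe_sub,
    EReal.coe_ennreal_toReal (lintegral_ofReal_ne_top h),
    EReal.coe_ennreal_toReal (integralGtBot_of_integrable h)]

end Integral

section FreeEnergy

variable {X : Type*} [MeasurableSpace X] {T : X → X} {φ : X → ℝ} {P : ℝ} {ν : ProbabilityMeasure X}

lemma freeEnergy_eq (hν : Invariant T (ν : Measure X)) (h : Integrable φ (ν : Measure X)) :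
    freeEnergy T φ P ν = ((entropy T (ν : Measure X) : ℝ≥0∞) : EReal) +
      ((∫ x, (φ x - P) ∂(ν : Measure X) : ℝ) : EReal) := by
  rw [freeEnergy, if_pos ⟨hν, integralGtBot_of_integrable h⟩, eintegral_eq h,
    integral_sub h (integrable_const _), EReal.coe_sub]
  simp [sub_eq_add_neg, add_assoc]

lemma le_freeEnergy (hν : Invariant T (ν : Measure X))
    (hφ : Integrable (fun x => φ x - P) (ν : Measure X)) {h : ℝ} (h0 : 0 ≤ h)
    (hh : ENNReal.ofReal h ≤ entropy T (ν : Measure X)) :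
    ((h + ∫ x, (φ x - P) ∂(ν : Measure X) : ℝ) : EReal) ≤ freeEnergy T φ P ν := by
  have hφ' : Integrable φ (ν : Measure X) := by
    exact (hφ.add (integrable_const P)).congr (Eventually.of_forall fun x => sub_add_cancel _ _)
  rw [freeEnergy_eq hν hφ', EReal.coe_add]
  refine add_le_add_left ?_ _
  have : ((ENNReal.ofReal h : ℝ≥0∞) : EReal) ≤ ((entropy T (ν : Measure X) : ℝ≥0∞) : EReal) :=
    EReal.coe_ennreal_le_coe_ennreal_iff.2 hh
  rwa [EReal.coe_ennreal_ofReal, max_eq_left h0] at this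

lemma exists_of_lt_freeEnergy (hφ : Measurable φ) {M : ℝ} (hM : ∀ x, φ x ≤ M) {a : ℝ}
    (ha : (a : EReal) < freeEnergy T φ P ν) :
    Invariant T (ν : Measure X) ∧ Integrable (fun x => φ x - P) (ν : Measure X) ∧
      ∃ h : ℝ, 0 ≤ h ∧ (h = 0 ∨ ENNReal.ofReal h < entropy T (ν : Measure X)) ∧
        a < h + ∫ x, (φ x - P) ∂(ν : Measure X) := by
  have hne : Invariant T (ν : Measure X) ∧ IntegralGtBot φ (ν : Measure X) := by
    by_contra hcon
    rw [freeEnergy, if_neg hcon] at ha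
    exact not_lt_bot ha
  have hintgr := hne.2.integrable hφ hM
  refine ⟨hne.1, hintgr.sub (integrable_const P), ?_⟩
  rw [freeEnergy_eq hne.1 hintgr] at ha
  obtain ⟨a', ha1, ha2⟩ := EReal.lt_iff_exists_real_btwn.1 ha
  set J := ∫ x, (φ x - P) ∂(ν : Measure X)
  have ha1 : a < a' := EReal.coe_lt_coe_iff.1 ha1
  by_cases hJ : a' - J ≤ 0
  · exact ⟨0, le_rfl, Or.inl rfl, by linarith⟩
  · push Not at hJ
    refine ⟨a' - J, hJ.le, Or.inr ?_, by linarith⟩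
    have h1 : ((a' - J : ℝ) : EReal) < ((entropy T (ν : Measure X) : ℝ≥0∞) : EReal) := by
      rw [EReal.coe_sub]
      exact EReal.sub_lt_of_lt_add ha2
    rw [← EReal.coe_ennreal_lt_coe_ennreal_iff, EReal.coe_ennreal_ofReal, max_eq_left hJ.le]
    exact h1

end FreeEnergy

section Mix

variable {X : Type*} [MeasurableSpace X] {t : ℝ} (h0 : 0 ≤ t) (h1 : t ≤ 1)
  (μ ν : ProbabilityMeasure X)

lemma coe_mix : (mix t h0 h1 μ ν : Measure X) =
    ENNReal.ofReal t • (μ : Measure X) + ENNReal.ofReal (1 - t) • (ν : Measure X) := rfl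

lemma mix_real (D : Set X) : (mix t h0 h1 μ ν : Measure X).real D =
    t * (μ : Measure X).real D + (1 - t) * (ν : Measure X).real D := by
  rw [coe_mix, measureReal_def, Measure.add_apply, Measure.smul_apply, Measure.smul_apply,
    smul_eq_mul, smul_eq_mul, ENNReal.toReal_add (ENNReal.mul_ne_top ENNReal.ofReal_ne_top
      (measure_ne_top _ _)) (ENNReal.mul_ne_top ENNReal.ofReal_ne_top (measure_ne_top _ _)),
    ENNReal.toReal_mul, ENNReal.toReal_mul, ENNReal.toReal_ofReal h0,
    ENNReal.toReal_ofReal (by linarith)]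
  rfl

lemma mix_zero : mix 0 le_rfl zero_le_one μ ν = ν := by
  ext1
  simp [coe_mix]

lemma mix_one : mix 1 zero_le_one le_rfl μ ν = μ := by
  ext1
  simp [coe_mix]

variable {μ ν} {T : X → X}

lemma invariant_mix (hT : Measurable T) (hμ : Invariant T (μ : Measure X))
    (hν : Invariant T (ν : Measure X)) : Invariant T (mix t h0 h1 μ ν : Measure X) := by
  unfold Invariant at *
  rw [coe_mix, Measure.map_add _ _ hT, Measure.map_smul, Measure.map_smul, hμ, hν]

lemma integrable_mix {f : X → ℝ} (hμ : Integrable f (μ : Measure X))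
    (hν : Integrable f (ν : Measure X)) : Integrable f (mix t h0 h1 μ ν : Measure X) :=
  (hμ.smul_measure ENNReal.ofReal_ne_top).add_measure (hν.smul_measure ENNReal.ofReal_ne_top)

lemma integral_mix {f : X → ℝ} (hμ : Integrable f (μ : Measure X))
    (hν : Integrable f (ν : Measure X)) : ∫ x, f x ∂(mix t h0 h1 μ ν : Measure X) =
      t * ∫ x, f x ∂(μ : Measure X) + (1 - t) * ∫ x, f x ∂(ν : Measure X) := by
  rw [coe_mix, integral_add_measure (hμ.smul_measure ENNReal.ofReal_ne_top)
    (hν.smul_measure ENNReal.ofReal_ne_top), integral_smul_measure, integral_smul_measure,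
    ENNReal.toReal_ofReal h0, ENNReal.toReal_ofReal (by linarith)]
  rfl

lemma mul_partitionEntropy_le_mix {α : Type*} [Countable α] (g : X → α) :
    ENNReal.ofReal t * partitionEntropy (μ : Measure X) g +
      ENNReal.ofReal (1 - t) * partitionEntropy (ν : Measure X) g ≤
      partitionEntropy (mix t h0 h1 μ ν : Measure X) g := by
  let w : Bool → ℝ := fun b => cond b t (1 - t)
  let ρ : Bool → ProbabilityMeasure X := fun b => cond b μ ν
  have := sum_mul_partitionEntropy_le Finset.univ w (fun j _ => by
    cases j
    · exact sub_nonneg.2 h1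
    · exact h0) (by simp [w]) (fun j => (ρ j : Measure X)) (mix t h0 h1 μ ν : Measure X) g
    (fun a => by rw [mix_real, Fintype.sum_bool]; rfl)
  simpa [w, ρ] using this

lemma exists_partition_of_entropy {ρ : Measure X} {h : ℝ}
    (hh : h = 0 ∨ ENNReal.ofReal h < entropy T ρ) :
    ∃ p : X → ℕ, Measurable p ∧ (range p).Finite ∧ ∀ᶠ n : ℕ in atTop, ENNReal.ofReal h ≤
      ENNReal.ofReal ((n : ℝ)⁻¹) * partitionEntropy ρ (fun x => fun i : Fin n => p (T^[i] x)) := by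
  rcases hh with rfl | hh
  · exact ⟨fun _ => 0, measurable_const, (Set.finite_singleton 0).subset (by
      rintro _ ⟨_, rfl⟩; rfl), by simp⟩
  · rw [entropy] at hh
    simp only [lt_iSup_iff] at hh
    obtain ⟨p, ⟨hp, hpf⟩, hlt⟩ := hh
    exact ⟨p, hp, hpf, (eventually_lt_of_lt_liminf hlt).mono fun n hn => hn.le⟩

/-- Concavity of the entropy. -/
lemma le_entropy_mix (hT : Measurable T) {a b : ℝ} (ha0 : 0 ≤ a) (hb0 : 0 ≤ b)
    (ha : a = 0 ∨ ENNReal.ofReal a < entropy T (μ : Measure X))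
    (hb : b = 0 ∨ ENNReal.ofReal b < entropy T (ν : Measure X)) :
    ENNReal.ofReal (t * a + (1 - t) * b) ≤ entropy T (mix t h0 h1 μ ν : Measure X) := by
  obtain ⟨p, hp, hpf, hpe⟩ := exists_partition_of_entropy ha
  obtain ⟨q, hq, hqf, hqe⟩ := exists_partition_of_entropy hb
  let r : X → ℕ := fun x => Nat.pair (p x) (q x)
  have hr : Measurable r := (measurable_of_countable fun u : ℕ × ℕ => Nat.pair u.1 u.2).comp
    (hp.prodMk hq)
  have hrf : (range r).Finite := by
    refine ((hpf.prod hqf).image fun u : ℕ × ℕ => Nat.pair u.1 u.2).subset ?_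
    rintro _ ⟨x, rfl⟩
    exact ⟨(p x, q x), ⟨⟨x, rfl⟩, ⟨x, rfl⟩⟩, rfl⟩
  refine le_iSup₂_of_le r ⟨hr, hrf⟩ (le_liminf_of_le (by isBoundedDefault) ?_)
  filter_upwards [hpe, hqe] with n hn1 hn2
  have hmeas : ∀ f : X → ℕ, Measurable f → ∀ v : Fin n → ℕ,
      MeasurableSet ((fun x => fun i : Fin n => f (T^[i] x)) ⁻¹' {v}) := fun f hf v =>
    measurableSet_preimage_iterates hT (fun a => hf (measurableSet_singleton a)) v
  have e1 : ∀ ρ : ProbabilityMeasure X, partitionEntropy (ρ : Measure X)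
      (fun x => fun i : Fin n => p (T^[i] x)) ≤
      partitionEntropy (ρ : Measure X) (fun x => fun i : Fin n => r (T^[i] x)) := fun ρ =>
    partitionEntropy_mono (ρ : Measure X) (hmeas r hr) (hmeas p hp) fun x z h => funext fun i =>
      (Nat.pair_eq_pair.1 (congrFun h i)).1
  have e2 : ∀ ρ : ProbabilityMeasure X, partitionEntropy (ρ : Measure X)
      (fun x => fun i : Fin n => q (T^[i] x)) ≤
      partitionEntropy (ρ : Measure X) (fun x => fun i : Fin n => r (T^[i] x)) := fun ρ =>
    partitionEntropy_mono (ρ : Measure X) (hmeas r hr) (hmeas q hq) fun x z h => funext fun i =>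
      (Nat.pair_eq_pair.1 (congrFun h i)).2
  have h1' : 0 ≤ 1 - t := by linarith
  rw [ENNReal.ofReal_add (by positivity) (by positivity), ENNReal.ofReal_mul h0,
    ENNReal.ofReal_mul h1']
  calc _ ≤ ENNReal.ofReal t * (ENNReal.ofReal ((n : ℝ)⁻¹) * partitionEntropy (μ : Measure X)
          (fun x => fun i : Fin n => r (T^[i] x))) +
        ENNReal.ofReal (1 - t) * (ENNReal.ofReal ((n : ℝ)⁻¹) * partitionEntropy (ν : Measure X)
          (fun x => fun i : Fin n => r (T^[i] x))) := by
        gcongr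
        · exact hn1.trans (by gcongr; exact e1 _)
        · exact hn2.trans (by gcongr; exact e2 _)
    _ = ENNReal.ofReal ((n : ℝ)⁻¹) * (ENNReal.ofReal t * partitionEntropy (μ : Measure X)
          (fun x => fun i : Fin n => r (T^[i] x)) + ENNReal.ofReal (1 - t) *
          partitionEntropy (ν : Measure X) (fun x => fun i : Fin n => r (T^[i] x))) := by ring
    _ ≤ _ := by
        gcongr
        exact mul_partitionEntropy_le_mix h0 h1 _

/-- Concavity of the free energy. -/
lemma le_freeEnergy_mix (hT : Measurable T) {φ : X → ℝ} {P M : ℝ} (hφ : Measurable φ)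
    (hM : ∀ x, φ x ≤ M) {a b : ℝ} (ha : (a : EReal) < freeEnergy T φ P μ)
    (hb : (b : EReal) < freeEnergy T φ P ν) :
    ((t * a + (1 - t) * b : ℝ) : EReal) ≤ freeEnergy T φ P (mix t h0 h1 μ ν) := by
  obtain ⟨hμ, hiμ, u, hu0, hu, hau⟩ := exists_of_lt_freeEnergy hφ hM ha
  obtain ⟨hν, hiν, v, hv0, hv, hbv⟩ := exists_of_lt_freeEnergy hφ hM hb
  have h1' : 0 ≤ 1 - t := by linarith
  refine le_trans ?_ (le_freeEnergy (invariant_mix h0 h1 hT hμ hν) (integrable_mix h0 h1 hiμ hiν)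
    (by positivity) (le_entropy_mix h0 h1 hT hu0 hv0 hu hv))
  rw [integral_mix h0 h1 hiμ hiν, EReal.coe_le_coe_iff]
  nlinarith [mul_le_mul_of_nonneg_left hau.le h0, mul_le_mul_of_nonneg_left hbv.le h1']

end Mix

section Convex

variable {S : Type*} [Countable S] [TopologicalSpace S] [DiscreteTopology S] {A : S → S → Prop}

lemma exists_open_mix_subset {t : ℝ} (h0 : 0 ≤ t) (h1 : t ≤ 1)
    {μ ν : ProbabilityMeasure (Space A)} {G : Set (ProbabilityMeasure (Space A))} (hG : IsOpen G)
    (h : mix t h0 h1 μ ν ∈ G) :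
    ∃ U V : Set (ProbabilityMeasure (Space A)), IsOpen U ∧ IsOpen V ∧ μ ∈ U ∧ ν ∈ V ∧
      ∀ μ' ∈ U, ∀ ν' ∈ V, mix t h0 h1 μ' ν' ∈ G := by
  obtain ⟨I, ε, hε, hI⟩ := exists_cylinder_nbhd hG h
  refine ⟨_, _, isOpen_cylinder_nbhd I (ε / 2) μ, isOpen_cylinder_nbhd I (ε / 2) ν,
    fun w _ => by simpa using by positivity, fun w _ => by simpa using by positivity,
    fun μ' hμ' ν' hν' => hI _ fun w hw => ?_⟩
  have e1 := abs_lt.1 (hμ' w hw)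
  have e2 := abs_lt.1 (hν' w hw)
  rw [mix_real, mix_real, abs_lt]
  constructor <;> nlinarith

lemma convexRate_rateOf {F : ProbabilityMeasure (Space A) → EReal} (hF0 : ∀ ν, F ν ≤ 0)
    (hF : ∀ (t : ℝ) (h0 : 0 ≤ t) (h1 : t ≤ 1) (μ ν : ProbabilityMeasure (Space A)) (a b : ℝ),
      (a : EReal) < F μ → (b : EReal) < F ν →
      ((t * a + (1 - t) * b : ℝ) : EReal) ≤ F (mix t h0 h1 μ ν)) :
    ConvexRate (rateOf F) := by
  have hnn : ∀ μ, 0 ≤ rateOf F μ := fun μ => by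
    have := (neg_rateOf_le (F := F) isOpen_univ (mem_univ μ)).trans (iSup₂_le fun ν _ => hF0 ν)
    rwa [EReal.neg_le, neg_zero] at this
  intro μ ν t h0 h1
  rcases h0.eq_or_lt with rfl | ht0
  · simp [mix_zero]
  rcases h1.eq_or_lt with rfl | ht1
  · simp [mix_one]
  have ht1' : 0 < 1 - t := by linarith
  by_cases hμ : rateOf F μ = ⊤
  · rw [hμ, EReal.coe_mul_top_of_pos ht0, EReal.top_add_of_ne_bot]
    · exact le_top
    · exact (EReal.bot_lt_zero.trans_le (mul_nonneg (EReal.coe_nonneg.2 ht1'.le) (hnn ν))).ne'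
  by_cases hν : rateOf F ν = ⊤
  · rw [hν, EReal.coe_mul_top_of_pos ht1', EReal.add_top_of_ne_bot]
    · exact le_top
    · exact (EReal.bot_lt_zero.trans_le (mul_nonneg (EReal.coe_nonneg.2 ht0.le) (hnn μ))).ne'
  lift rateOf F μ to ℝ using ⟨hμ, (EReal.bot_lt_zero.trans_le (hnn μ)).ne'⟩ with a ha
  lift rateOf F ν to ℝ using ⟨hν, (EReal.bot_lt_zero.trans_le (hnn ν)).ne'⟩ with b hb
  rw [← EReal.coe_mul, ← EReal.coe_mul, ← EReal.coe_add]
  refine EReal.le_of_forall_lt_iff_le.1 fun r hr => ?_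
  have hr := EReal.coe_lt_coe_iff.1 hr
  set ε := r - (t * a + (1 - t) * b) with hε
  have hεpos : 0 < ε := by linarith
  rw [rateOf, EReal.neg_le]
  refine le_iInf₂ fun G hG => ?_
  obtain ⟨U, V, hU, hV, hμU, hνV, hUV⟩ := exists_open_mix_subset h0 h1 hG.1 hG.2
  have key : ∀ (W : Set (ProbabilityMeasure (Space A))) (ρ : ProbabilityMeasure (Space A)) (s : ℝ),
      IsOpen W → ρ ∈ W → (s : EReal) = rateOf F ρ → ∃ ρ' ∈ W, ((-s - ε : ℝ) : EReal) < F ρ' := by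
    intro W ρ s hW hρ hs
    have e1 := neg_rateOf_le (F := F) hW hρ
    rw [← hs, ← EReal.coe_neg] at e1
    have e2 : ((-s - ε : ℝ) : EReal) < ⨆ ν ∈ W, F ν :=
      (EReal.coe_lt_coe_iff.2 (by linarith)).trans_le e1
    simp only [lt_iSup_iff] at e2
    obtain ⟨ρ', h1, h2⟩ := e2
    exact ⟨ρ', h1, h2⟩
  obtain ⟨μ', hμ', ha'⟩ := key U μ a hU hμU ha
  obtain ⟨ν', hν', hb'⟩ := key V ν b hV hνV hb
  have e3 := hF t h0 h1 μ' ν' _ _ ha' hb'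
  rw [← EReal.coe_neg]
  refine le_trans (EReal.coe_le_coe_iff.2 ?_)
    (e3.trans (le_iSup₂ (f := fun ν (_ : ν ∈ G) => F ν) _ (hUV μ' hμ' ν' hν')))
  rw [hε]
  apply le_of_eq
  ring

end Convex

section Main

variable {S : Type*} [Countable S] [TopologicalSpace S] [DiscreteTopology S] {A : S → S → Prop}
variable {φ : Space A → ℝ} {P : ℝ} {μ : Measure (Space A)} {c κ : ℝ} {N : ℕ}

lemma GibbsData.le_log (hg : GibbsData (fun x => φ x - P) μ c κ N) (x : Space A) :
    φ x ≤ Real.log c + P := by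
  have := hg.prob
  have hc : 0 < c := by linarith [hg.one_le]
  have h := hg.exp_le 1 x
  rw [birkhoff_one] at h
  have h2 := (Real.le_log_iff_exp_le hc).2
      (h.trans (mul_le_of_le_one_right hc.le measureReal_le_one))
  linarith

lemma GibbsData.measurable_potential (hg : GibbsData (fun x => φ x - P) μ c κ N) :
    Measurable φ := by
  simpa using hg.meas.add_const P

lemma GibbsData.freeEnergy_le_liminf (hg : GibbsData (fun x => φ x - P) μ c κ N) (y : Space A)
    {G : Set (ProbabilityMeasure (Space A))} (hG : IsOpen G)
    {ν : ProbabilityMeasure (Space A)} (hν : ν ∈ G) :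
    freeEnergy (shift A) φ P ν ≤ atTop.liminf fun n : ℕ => (((n : ℝ)⁻¹ : ℝ) : EReal) *
      ENNReal.log (weightedDistr (shift A) φ n (preimSet (shift A) n y) G) := by
  have _ : BorelSpace (ProbabilityMeasure (Space A)) := ⟨rfl⟩
  have hc : 0 < c := by linarith [hg.one_le]
  refine EReal.ge_of_forall_gt_iff_ge.1 fun a ha => ?_
  obtain ⟨hinv, hintgr, h, h0, hh, hlt⟩ :=
    exists_of_lt_freeEnergy hg.measurable_potential hg.le_log ha
  have hev : ∀ᶠ m : ℕ in atTop, ENNReal.ofReal (m * h) ≤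
      partitionEntropy (ν : Measure (Space A)) (pre m) := by
    rcases hh with rfl | hh
    · simp
    · exact eventually_le_partitionEntropy_pre _ hinv h0 hh
  have hlow := hg.eventually_le_Zfn y ν hinv hintgr hev hG hν (sub_pos.2 hlt)
  refine le_liminf_log (C := -Real.log c) (hlow.mono fun n hn => ?_)
  rw [← weightedDistr_sub_const φ P]
  refine le_trans ?_ (hg.le_weightedDistr y n hG.measurableSet)
  rw [Real.exp_add, Real.exp_neg, Real.exp_log hc, mul_comm, ENNReal.ofReal_mul (by positivity)]
  refine mul_le_mul_right (le_trans (le_of_eq ?_) hn) _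
  congr 3
  ring

lemma GibbsData.expBound_of_Zfn_le (hg : GibbsData (fun x => φ x - P) μ c κ N) (y : Space A)
    {G : Set (ProbabilityMeasure (Space A))} (hG : MeasurableSet G) {a C : ℝ}
    (h : ∀ᶠ n : ℕ in atTop, Zfn (shift A) (fun x => φ x - P) n
      (preimSet (shift A) n y ∩ {x | empirical (shift A) x n ∈ G}) ≤
        ENNReal.ofReal (Real.exp (n * a + C))) :
    ExpBound (fun n => weightedDistr (shift A) φ n (preimSet (shift A) n y)) a G := by
  have hc : 0 < c := by linarith [hg.one_le]
  have hκ := hg.κ_pos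
  refine ⟨C + Real.log (c / κ), ?_⟩
  filter_upwards [h, eventually_ge_atTop (N + 1)] with n hn hN
  rw [← weightedDistr_sub_const φ P]
  refine (hg.weightedDistr_le y hN hG).trans ((mul_le_mul_right hn _).trans_eq ?_)
  rw [← ENNReal.ofReal_mul (by positivity), ← add_assoc, Real.exp_add _ (Real.log _),
    Real.exp_log (by positivity), mul_comm]

lemma GibbsData.exists_nhd_expBound (hg : GibbsData (fun x => φ x - P) μ c κ N) (y : Space A)
    {G : Set (ProbabilityMeasure (Space A))} (hG : IsOpen G)
    {ν : ProbabilityMeasure (Space A)} (hν : ν ∈ G) {a : ℝ}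
    (ha : ∀ ρ ∈ G, freeEnergy (shift A) φ P ρ ≤ a) :
    ∃ U, IsOpen U ∧ ν ∈ U ∧
      ExpBound (fun n => weightedDistr (shift A) φ n (preimSet (shift A) n y)) a U := by
  have _ : BorelSpace (ProbabilityMeasure (Space A)) := ⟨rfl⟩
  obtain ⟨U, hU, hνU, C, hC⟩ := hg.exists_nhd_Zfn_le y hG hν (a := a)
    fun ρ hρ hinv hintgr h h0 hh =>
      EReal.coe_le_coe_iff.1 ((le_freeEnergy hinv hintgr h0 hh).trans (ha ρ hρ))
  exact ⟨U, hU, hνU, hg.expBound_of_Zfn_le y hU.measurableSet hC⟩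

lemma GibbsData.exists_compact_expBound (hg : GibbsData (fun x => φ x - P) μ c κ N) (y : Space A)
    {L : ℝ} (hL : 0 < L) :
    ∃ K, IsCompact K ∧
      ExpBound (fun n => weightedDistr (shift A) φ n (preimSet (shift A) n y)) (-L) Kᶜ := by
  have _ : BorelSpace (ProbabilityMeasure (Space A)) := ⟨rfl⟩
  obtain ⟨K, hK, hb⟩ := hg.exists_compact_Zfn_le y hL.le
  refine ⟨K, hK, hg.expBound_of_Zfn_le y hK.isClosed.isOpen_compl.measurableSet
    (C := Real.log 2) ?_⟩
  filter_upwards [eventually_ge_atTop 1] with n hn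
  refine (hb n hn).trans_eq ?_
  rw [Real.exp_add, Real.exp_log (by norm_num), mul_comm]
  congr 3
  ring

lemma GibbsData.freeEnergy_nonpos (hg : GibbsData (fun x => φ x - P) μ c κ N) (y : Space A)
    (ν : ProbabilityMeasure (Space A)) : freeEnergy (shift A) φ P ν ≤ 0 := by
  have _ : BorelSpace (ProbabilityMeasure (Space A)) := ⟨rfl⟩
  have h : ExpBound (fun n => weightedDistr (shift A) φ n (preimSet (shift A) n y)) 0 univ := by
    refine hg.expBound_of_Zfn_le y MeasurableSet.univ (C := Real.log c)
      (Eventually.of_forall fun n => ?_)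
    rw [mul_zero, zero_add, Real.exp_log (by linarith [hg.one_le])]
    exact hg.Zfn_le ((injOn_pre_preimSet y n).mono inter_subset_left)
  have h2 := (hg.freeEnergy_le_liminf y isOpen_univ (mem_univ ν)).trans
    (le_trans (liminf_le_limsup (f := atTop)) h.limsup_le)
  simpa using h2

end Main

end CMS

open CMS in
/-- **Theorem B (iterated preimages).** For a finitely primitive countable Markov shift with a
Gibbs state for a measurable potential `φ` and any `y ∈ X`, the distributions `ζ_{y,n}` of
weighted iterated preimages of `y` are exponentially tight and satisfy the LDP with the convex
good rate function of Theorem A. -/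
theorem theoremB_preimages {S : Type*} [Countable S] [TopologicalSpace S] [DiscreteTopology S]
    (A : S → S → Prop) (hA : NoZeroRowCol A) (hprim : FinitelyPrimitive A)
    (φ : Space A → ℝ) (hφ : Measurable φ)
    (μφ : ProbabilityMeasure (Space A)) (c₀ P : ℝ) (hc₀ : 1 ≤ c₀)
    (hGibbs : IsGibbsWith A φ (μφ : Measure (Space A)) c₀ P)
    (y : Space A) :
    ExpTight (fun n => weightedDistr (shift A) φ n (preimSet (shift A) n y)) ∧
    HasLDP (fun n => weightedDistr (shift A) φ n (preimSet (shift A) n y))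
      (rateOf (freeEnergy (shift A) φ P)) ∧
    GoodRate (rateOf (freeEnergy (shift A) φ P)) ∧
    ConvexRate (rateOf (freeEnergy (shift A) φ P)) := by
  obtain ⟨κ, N, hg⟩ := exists_gibbsData hprim hφ (μφ : Measure (Space A)) hc₀ hGibbs
  have hT := fun (L : ℝ) (hL : 0 < L) => hg.exists_compact_expBound y hL
  have hlow := fun (G : Set (ProbabilityMeasure (Space A))) (hG : IsOpen G) ν (hν : ν ∈ G) =>
    hg.freeEnergy_le_liminf y hG hν
  exact ⟨expTight_of_expBound hT,
    hasLDP_of_local hlow (fun G hG ν hν a ha => hg.exists_nhd_expBound y hG hν ha) hT,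
    goodRate_of_local hlow hT,
    convexRate_rateOf (hg.freeEnergy_nonpos y) fun t h0 h1 _ _ _ _ ha hb =>
      le_freeEnergy_mix h0 h1 continuous_shift.measurable hφ hg.le_log ha hb⟩
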